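/- Graph representation near a potential splash (Proposition 2.5(ii)): Let ε₄, ε₅ be as in Proposition 2.5(i). Suppose t ∈ [0,T], inf_{α,β∈ℝ} F(z)(α,β,t) = ε ≤ ε₄, and let α₁, α₂ ∈ ℝ be a pair with |α₁ − α₂| ∈ [2ε₁, ε₁⁻¹/2] and |z(α₁,t) − z(α₂,t)| = inf{|z(α,t) − z(β,t)| : |α − β| ∈ [ε₁, ε₁⁻¹]} (here ε₁ = ε₁(A) > 0 is a constant such that |z(α,t) − z(β,t)| ≥ ε₁|α − β| whenever |α − β| ≤ ε₁, which exists by the local chord-arc bound), and set d := |z(α₂,t) − z(α₁,t)|. Then there exist a rigid motion R : ℝ² → ℝ² (an isometry of the plane) with R(0,0) = (z(α₁,t) + z(α₂,t))/2, R(0,−d/2) = z(α₁,t), R(0,d/2) = z(α₂,t), and functions f₁, f₂, β₁, β₂ : (−ε₅⁴, ε₅⁴) → (−ε₅², ε₅²) such that: R(ρ, f₁(ρ)) = z(α₁ + β₁(ρ), t) and R(ρ, f₂(ρ)) = z(α₂ + β₂(ρ), t) for all ρ ∈ (−ε₅⁴, ε₅⁴); f₁(0) = −d/2, f₂(0) =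 d/2, β₁(0) = β₂(0) = 0, f₁'(0) = f₂'(0) = 0; ‖f₁‖_{C⁴} + ‖f₂‖_{C⁴} + ‖β₁‖_{C⁴} + ‖β₂‖_{C⁴} ≲ 1; C⁻¹ ≤ −β₁'(ρ)β₂'(ρ) ≤ C and f₂(ρ) − f₁(ρ) ≥ d for all ρ ∈ (−ε₅⁴, ε₅⁴); and R({(ρ,y) : ρ ∈ (−ε₅⁴,ε₅⁴), y ∈ (f₂(ρ), ε₅²)}) ⊆ Ω¹(t), R({(ρ,y) : ρ ∈ (−ε₅⁴,ε₅⁴), y ∈ (−ε₅², f₁(ρ))}) ⊆ Ω¹(t), R({(ρ,y) : ρ ∈ (−ε₅⁴,ε₅⁴), y ∈ (f₁(ρ), f₂(ρ))}) ⊆ Ω²(t). -/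

import Mathlib

noncomputable section
open Set MeasureTheory Filter

/-- The plane `ℝ²` with the Euclidean norm. -/
abbrev E2 : Type := EuclideanSpace ℝ (Fin 2)

/-- The real inner product on `ℝ²`. -/
def rinner (x y : E2) : ℝ := inner ℝ x y

/-- The vector `(1,0)`. -/
def xvec : E2 := (EuclideanSpace.equiv (Fin 2) ℝ).symm ![1, 0]

/-- The vector `(0,1)`. -/
def e2vec : E2 := (EuclideanSpace.equiv (Fin 2) ℝ).symm ![0, 1]

/-- The period vector `(2π, 0)`. -/
def transl : E2 := (EuclideanSpace.equiv (Fin 2) ℝ).symm ![2 * Real.pi, 0]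

/-- The rotation of a vector by `π/2`: `(x,y)^⊥ = (-y,x)`. -/
def perpv (w : E2) : E2 := (EuclideanSpace.equiv (Fin 2) ℝ).symm ![-(w 1), w 0]

/-- The chord-arc function `F(z)` of a time-dependent curve. -/
def chordArcT (z : ℝ → ℝ → E2) (α β t : ℝ) : ℝ :=
  if α = β then ‖deriv (fun a => z a t) α‖ else ‖z α t - z β t‖ / |α - β|

/-- The two-fluid interface system on the time interval `[0,T]`, in the `2π`-periodic setting,
with densities `ρ1, ρ2`, surface tension coefficient `σ`, gravity constant `grav`, and
quantitative bounds measured by the constant `A`. -/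
structure TwoFluid (ρ1 ρ2 σ grav T A : ℝ) where
  /-- the parametrization of the interface -/
  z : ℝ → ℝ → E2
  /-- the domain of the first fluid -/
  Ω1 : ℝ → Set E2
  /-- the domain of the second fluid -/
  Ω2 : ℝ → Set E2
  /-- the velocity field of the first fluid -/
  u1 : E2 → ℝ → E2
  /-- the velocity field of the second fluid -/
  u2 : E2 → ℝ → E2
  /-- the pressure of the first fluid -/
  P1 : E2 → ℝ → ℝ
  /-- the pressure of the second fluid -/
  P2 : E2 → ℝ → ℝ
  hΩ1_open : ∀ t ∈ Icc (0:ℝ) T, IsOpen (Ω1 t)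
  hΩ2_open : ∀ t ∈ Icc (0:ℝ) T, IsOpen (Ω2 t)
  hΩ1_conn : ∀ t ∈ Icc (0:ℝ) T, IsConnected (Ω1 t)
  hΩ2_conn : ∀ t ∈ Icc (0:ℝ) T, IsConnected (Ω2 t)
  hΩ1_sc : ∀ t ∈ Icc (0:ℝ) T, SimplyConnectedSpace (Ω1 t)
  hΩ2_sc : ∀ t ∈ Icc (0:ℝ) T, SimplyConnectedSpace (Ω2 t)
  /-- `ℝ²` is the disjoint union of `Ω1 t`, `Ω2 t` and the interface `Γ_t` -/
  hUnion : ∀ t ∈ Icc (0:ℝ) T, Ω1 t ∪ Ω2 t ∪ range (fun α => z α t) = univ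
  hDisj12 : ∀ t ∈ Icc (0:ℝ) T, Disjoint (Ω1 t) (Ω2 t)
  hDisj1Γ : ∀ t ∈ Icc (0:ℝ) T, Disjoint (Ω1 t) (range (fun α => z α t))
  hDisj2Γ : ∀ t ∈ Icc (0:ℝ) T, Disjoint (Ω2 t) (range (fun α => z α t))
  hFront1 : ∀ t ∈ Icc (0:ℝ) T, frontier (Ω1 t) = range (fun α => z α t)
  hFront2 : ∀ t ∈ Icc (0:ℝ) T, frontier (Ω2 t) = range (fun α => z α t)
  /-- `Ω1` contains a lower half-plane and `Ω2` an upper half-plane -/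
  hStrip : ∃ a : ℝ, 1 ≤ a ∧ ∀ t ∈ Icc (0:ℝ) T,
      {x : E2 | x 1 ≤ -a} ⊆ Ω1 t ∧ {x : E2 | a ≤ x 1} ⊆ Ω2 t
  /-- `u1(·,t)` is `C³` on the closure of `Ω1 t` -/
  hu1_reg : ∀ t ∈ Icc (0:ℝ) T, ContDiffOn ℝ 3 (fun x => u1 x t) (closure (Ω1 t))
  hu2_reg : ∀ t ∈ Icc (0:ℝ) T, ContDiffOn ℝ 3 (fun x => u2 x t) (closure (Ω2 t))
  hP1_reg : ∀ t ∈ Icc (0:ℝ) T, ContDiffOn ℝ 1 (fun x => P1 x t) (closure (Ω1 t))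
  hP2_reg : ∀ t ∈ Icc (0:ℝ) T, ContDiffOn ℝ 1 (fun x => P2 x t) (closure (Ω2 t))
  /-- Euler's equation in `Ω1 t` -/
  hEuler1 : ∀ t ∈ Icc (0:ℝ) T, ∀ x ∈ Ω1 t,
      ρ1 • (deriv (fun s => u1 x s) t + fderiv ℝ (fun y => u1 y t) x (u1 x t)) =
        -gradient (fun y => P1 y t) x - (grav * ρ1) • e2vec
  /-- Euler's equation in `Ω2 t` -/
  hEuler2 : ∀ t ∈ Icc (0:ℝ) T, ∀ x ∈ Ω2 t,
      ρ2 • (deriv (fun s => u2 x s) t + fderiv ℝ (fun y => u2 y t) x (u2 x t)) =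
        -gradient (fun y => P2 y t) x - (grav * ρ2) • e2vec
  /-- incompressibility of the first fluid -/
  hdiv1 : ∀ t ∈ Icc (0:ℝ) T, ∀ x ∈ Ω1 t,
      fderiv ℝ (fun y => u1 y t) x (EuclideanSpace.single 0 1) 0 +
        fderiv ℝ (fun y => u1 y t) x (EuclideanSpace.single 1 1) 1 = 0
  hdiv2 : ∀ t ∈ Icc (0:ℝ) T, ∀ x ∈ Ω2 t,
      fderiv ℝ (fun y => u2 y t) x (EuclideanSpace.single 0 1) 0 +
        fderiv ℝ (fun y => u2 y t) x (EuclideanSpace.single 1 1) 1 = 0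
  /-- irrotationality of the first fluid -/
  hcurl1 : ∀ t ∈ Icc (0:ℝ) T, ∀ x ∈ Ω1 t,
      fderiv ℝ (fun y => u1 y t) x (EuclideanSpace.single 0 1) 1 -
        fderiv ℝ (fun y => u1 y t) x (EuclideanSpace.single 1 1) 0 = 0
  hcurl2 : ∀ t ∈ Icc (0:ℝ) T, ∀ x ∈ Ω2 t,
      fderiv ℝ (fun y => u2 y t) x (EuclideanSpace.single 0 1) 1 -
        fderiv ℝ (fun y => u2 y t) x (EuclideanSpace.single 1 1) 0 = 0
  /-- kinematic boundary condition for the first fluid -/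
  hkin1 : ∀ t ∈ Icc (0:ℝ) T, ∀ α : ℝ,
      rinner (deriv (fun s => z α s) t - u1 (z α t) t) (perpv (deriv (fun a => z a t) α)) = 0
  hkin2 : ∀ t ∈ Icc (0:ℝ) T, ∀ α : ℝ,
      rinner (deriv (fun s => z α s) t - u2 (z α t) t) (perpv (deriv (fun a => z a t) α)) = 0
  /-- the pressure jump at the interface is given by the surface tension times the curvature -/
  hjump : ∀ t ∈ Icc (0:ℝ) T, ∀ α : ℝ,
      P2 (z α t) t - P1 (z α t) t =
        -σ * (deriv (fun a => z a t) α 0 * deriv (fun a => deriv (fun b => z b t) a) α 1 -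
              deriv (fun a => z a t) α 1 * deriv (fun a => deriv (fun b => z b t) a) α 0) /
          ((deriv (fun a => z a t) α 0) ^ 2 + (deriv (fun a => z a t) α 1) ^ 2) ^ ((3:ℝ)/2)
  /-- `2π`-periodicity -/
  hper_z : ∀ t ∈ Icc (0:ℝ) T, ∀ α : ℝ, z (α + 2 * Real.pi) t = z α t + transl
  hper_Ω1 : ∀ t ∈ Icc (0:ℝ) T, (fun x => x + transl) '' Ω1 t = Ω1 t
  hper_Ω2 : ∀ t ∈ Icc (0:ℝ) T, (fun x => x + transl) '' Ω2 t = Ω2 t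
  hper_u1 : ∀ t ∈ Icc (0:ℝ) T, ∀ x ∈ Ω1 t, u1 (x + transl) t = u1 x t
  hper_u2 : ∀ t ∈ Icc (0:ℝ) T, ∀ x ∈ Ω2 t, u2 (x + transl) t = u2 x t
  /-- finite kinetic energy in a period -/
  hL2_1 : ∀ t ∈ Icc (0:ℝ) T,
      IntegrableOn (fun x => ‖u1 x t‖ ^ 2) (Ω1 t ∩ {x : E2 | x 0 ∈ Icc 0 (2 * Real.pi)})
  hL2_2 : ∀ t ∈ Icc (0:ℝ) T,
      IntegrableOn (fun x => ‖u2 x t‖ ^ 2) (Ω2 t ∩ {x : E2 | x 0 ∈ Icc 0 (2 * Real.pi)})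
  /-- `z(α,t) - (α,0)` is `C⁴` with all derivatives of order `≤ 4` bounded by `A` -/
  hz_smooth : ContDiffOn ℝ 4 (fun p : ℝ × ℝ => z p.1 p.2 - p.1 • xvec) (univ ×ˢ Icc (0:ℝ) T)
  hz_bound : ∀ p ∈ (univ ×ˢ Icc (0:ℝ) T : Set (ℝ × ℝ)), ∀ i : ℕ, i ≤ 4 →
      ‖iteratedFDerivWithin ℝ i (fun p : ℝ × ℝ => z p.1 p.2 - p.1 • xvec)
          (univ ×ˢ Icc (0:ℝ) T) p‖ ≤ A
  /-- the parametrization is regular -/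
  hz_lower : ∀ t ∈ Icc (0:ℝ) T, ∀ α : ℝ, A⁻¹ ≤ ‖deriv (fun a => z a t) α‖
  /-- `v¹(α,t) = u¹(z(α,t),t)` is `C³` with all derivatives of order `≤ 3` bounded by `A` -/
  hv1_smooth : ContDiffOn ℝ 3 (fun p : ℝ × ℝ => u1 (z p.1 p.2) p.2) (univ ×ˢ Icc (0:ℝ) T)
  hv1_bound : ∀ p ∈ (univ ×ˢ Icc (0:ℝ) T : Set (ℝ × ℝ)), ∀ i : ℕ, i ≤ 3 →
      ‖iteratedFDerivWithin ℝ i (fun p : ℝ × ℝ => u1 (z p.1 p.2) p.2)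
          (univ ×ˢ Icc (0:ℝ) T) p‖ ≤ A
  /-- the chord-arc condition at time `0` -/
  hchord0 : ∀ α β : ℝ, A⁻¹ ≤ chordArcT z α β 0
  /-- `u²` is bounded by `A` on the interface at time `0` -/
  hu2_init : ∀ α : ℝ, ‖u2 (z α 0) 0‖ ≤ A

/-- The point `(x, y) ∈ ℝ²`. -/
def vec2 (x y : ℝ) : E2 := (EuclideanSpace.equiv (Fin 2) ℝ).symm ![x, y]



lemma exp_const_of_cont {h : ℝ → ℂ} (hc : Continuous h) {c : ℂ} (he : ∀ t, Complex.exp (h t) = c)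
    (a b : ℝ) : h a = h b := by
  have := Complex.isCoveringMap_exp.eq_of_comp_eq (A := ℝ) hc (continuous_const (y := h b))
    (by funext t; simp [he]) b rfl
  exact congrFun this a

lemma log_branch_const {f g : ℝ → ℂ} (hf : Continuous f) (hg : Continuous g)
    (he : ∀ t, Complex.exp (f t) = g t) {c : ℂ} (hpos : ∀ t, 0 < (c * g t).re) (a b : ℝ) :
    f a - Complex.log (c * g a) = f b - Complex.log (c * g b) := by
  have hc0 : c ≠ 0 := by
    rintro rfl
    simpa using hpos 0
  refine exp_const_of_cont (h := fun t => f t - Complex.log (c * g t)) (c := c⁻¹) ?_ ?_ a b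
  · refine hf.sub ?_
    refine Continuous.clog (by fun_prop) ?_
    intro t
    exact Or.inl (hpos t)
  · intro t
    have h1 : c * g t ≠ 0 := by
      intro h; have := hpos t; rw [h] at this; simp at this
    have h2 : g t ≠ 0 := right_ne_zero_of_mul h1
    rw [Complex.exp_sub, he, Complex.exp_log h1]
    field_simp

lemma log_I_mul {w : ℂ} (h1 : 0 < w.re) (h2 : w.im < 0) :
    Complex.log (Complex.I * w) = Complex.log w + Real.pi / 2 * Complex.I := by
  have hw : w ≠ 0 := by rintro rfl; simp at h1
  rw [(Complex.log_mul_eq_add_log_iff Complex.I_ne_zero hw).2, Complex.log_I, add_comm]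
  have h3 : w.arg < 0 := Complex.arg_neg_iff.2 h2
  have h4 : |w.arg| ≤ Real.pi / 2 := Complex.abs_arg_le_pi_div_two_iff.2 h1.le
  rw [abs_le] at h4
  rw [Complex.arg_I]
  have := Real.pi_pos
  constructor <;> linarith [h4.1]

lemma crossing {p q : ℝ → ℂ} (hp : Continuous p) (hq : Continuous q)
    (h1 : ∀ s, (q 0).re < (p s).re) (h2 : ∀ s, (p s).re < (q 1).re)
    (h3 : ∀ t, (p 0).im < (q t).im) (h4 : ∀ t, (q t).im < (p 1).im) :
    ∃ s t, p s = q t := by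
  by_contra! hne
  have huniv : IsSimplyConnected (univ : Set (ℝ × ℝ)) := by
    have : ContractibleSpace (univ : Set (ℝ × ℝ)) :=
      Convex.contractibleSpace (convex_univ (𝕜 := ℝ)) ⟨0, mem_univ _⟩
    exact (inferInstance : SimplyConnectedSpace (univ : Set (ℝ × ℝ)))
  obtain ⟨f, hfc, hfe⟩ := Complex.exists_continuousOn_eqOn_exp_comp (X := ℝ × ℝ) (U := univ)
    huniv isOpen_univ (g := fun x => p x.1 - q x.2) (by fun_prop)
    (by rintro ⟨x, -, hx⟩; exact hne x.1 x.2 (sub_eq_zero.1 hx))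
  have hfc : Continuous f := by simpa using hfc
  have hfe : ∀ s t, Complex.exp (f (s, t)) = p s - q t := fun s t => hfe (mem_univ (s, t))
  have e1 := log_branch_const (f := fun t => f (0, t)) (g := fun t => p 0 - q t) (by fun_prop)
    (by fun_prop) (fun t => hfe 0 t) (c := Complex.I) (by intro t; simp; linarith [h3 t]) 0 1
  have e2 := log_branch_const (f := fun s => f (s, 1)) (g := fun s => p s - q 1) (by fun_prop)
    (by fun_prop) (fun t => hfe t 1) (c := -1) (by intro t; simp; linarith [h2 t]) 0 1
  have e3 := log_branch_const (f := fun t => f (1, t)) (g := fun t => p 1 - q t) (by fun_prop)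
    (by fun_prop) (fun t => hfe 1 t) (c := -Complex.I) (by intro t; simp; linarith [h4 t]) 0 1
  have e4 := log_branch_const (f := fun s => f (s, 0)) (g := fun s => p s - q 0) (by fun_prop)
    (by fun_prop) (fun t => hfe t 0) (c := 1) (by intro t; simp; linarith [h1 t]) 0 1
  have a1 := log_I_mul (w := p 0 - q 0) (by simp; linarith [h1 0]) (by simp; linarith [h3 0])
  have a2 := log_I_mul (w := Complex.I * (p 0 - q 1)) (by simp; linarith [h3 1])
    (by simp; linarith [h2 0])
  have a3 := log_I_mul (w := -1 * (p 1 - q 1)) (by simp; linarith [h2 1])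
    (by simp; linarith [h4 1])
  have a4 := log_I_mul (w := -Complex.I * (p 1 - q 0)) (by simp; linarith [h4 0])
    (by simp; linarith [h1 1])
  have b2 : Complex.I * (Complex.I * (p 0 - q 1)) = -1 * (p 0 - q 1) := by
    rw [← mul_assoc, Complex.I_mul_I]
  have b3 : Complex.I * (-1 * (p 1 - q 1)) = -Complex.I * (p 1 - q 1) := by ring
  have b4 : Complex.I * (-Complex.I * (p 1 - q 0)) = 1 * (p 1 - q 0) := by
    linear_combination (-(p 1 - q 0)) * Complex.I_mul_I
  rw [b2] at a2; rw [b3] at a3; rw [b4] at a4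
  simp only [one_mul] at e4 a4
  have : (2 * Real.pi * Complex.I : ℂ) = 0 := by
    linear_combination -e1 - e2 + e3 + e4 - a1 - a2 - a3 - a4
  simp [Real.pi_ne_zero] at this


lemma circle_mean_sq {f : ℂ → ℂ} {c : ℂ} {R r : ℝ} (hf : DifferentiableOn ℂ f (Metric.ball c R))
    (hr : 0 < r) (hrR : r < R) :
    ENNReal.ofReal (2 * Real.pi * ‖f c‖ ^ 2) ≤
      ∫⁻ θ in Ioo (-Real.pi) Real.pi, ENNReal.ofReal (‖f (circleMap c r θ)‖ ^ 2) := by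
  have hsub : Metric.closedBall c |r| ⊆ Metric.ball c R := by
    rw [abs_of_pos hr]; exact Metric.closedBall_subset_ball hrR
  have h1 : DiffContOnCl ℂ (fun w => f w ^ 2) (Metric.ball c |r|) := by
    refine ⟨((hf.pow 2).mono (Metric.ball_subset_closedBall.trans hsub)), ?_⟩
    exact (hf.pow 2).continuousOn.mono (Metric.closure_ball_subset_closedBall.trans hsub)
  have h2 := h1.circleAverage
  have hcont : Continuous fun θ => f (circleMap c r θ) := by
    refine hf.continuousOn.comp_continuous (continuous_circleMap c r) fun θ => hsub ?_
    exact Metric.sphere_subset_closedBall (circleMap_mem_sphere' c r θ)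
  rw [Real.circleAverage_def] at h2
  have hper : Function.Periodic (fun θ => f (circleMap c r θ) ^ 2) (2 * Real.pi) := by
    intro θ; simp [periodic_circleMap c r θ]
  have h3 := hper.intervalIntegral_add_eq 0 (-Real.pi)
  have e : -Real.pi + 2 * Real.pi = Real.pi := by ring
  rw [zero_add, e] at h3
  rw [h3] at h2
  have hpi := Real.pi_pos
  have h4 : ‖∫ θ in (-Real.pi)..Real.pi, f (circleMap c r θ) ^ 2‖ = 2 * Real.pi * ‖f c‖ ^ 2 := by
    rw [← norm_pow, ← h2, norm_smul, norm_inv, Real.norm_of_nonneg (by positivity)]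
    field_simp
  rw [← h4]
  have h5 : ‖∫ θ in (-Real.pi)..Real.pi, f (circleMap c r θ) ^ 2‖ ≤
      ∫ θ in Ioo (-Real.pi) Real.pi, ‖f (circleMap c r θ)‖ ^ 2 := by
    refine (intervalIntegral.norm_integral_le_integral_norm (by linarith)).trans ?_
    rw [intervalIntegral.integral_of_le (by linarith), integral_Ioc_eq_integral_Ioo]
    simp
  refine (ENNReal.ofReal_le_ofReal h5).trans ?_
  rw [ofReal_integral_eq_lintegral_ofReal]
  · exact (hcont.norm.pow 2).integrableOn_Icc.mono_set Ioo_subset_Icc_self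
  · exact Eventually.of_forall fun x => by positivity

lemma ball_mean_sq {f : ℂ → ℂ} {c : ℂ} (hf : DifferentiableOn ℂ f (Metric.ball c 2)) :
    ENNReal.ofReal (Real.pi * ‖f c‖ ^ 2) ≤
      ∫⁻ w in Metric.ball c 1, ENNReal.ofReal (‖f w‖ ^ 2) := by
  classical
  set F : ℂ → ℂ := (Metric.ball c 2).piecewise f 0 with hF
  have hFm : Measurable F :=
    ContinuousOn.measurable_piecewise hf.continuousOn continuousOn_const measurableSet_ball
  have hFe : ∀ w ∈ Metric.ball c 2, F w = f w := fun w hw => piecewise_eq_of_mem _ _ _ hw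
  have hsub : Metric.ball c 1 ⊆ Metric.ball c 2 := Metric.ball_subset_ball (by norm_num)
  set G : ℂ → ENNReal := (Metric.ball (0:ℂ) 1).indicator fun w => ENNReal.ofReal (‖F (c + w)‖ ^ 2)
  have hGm : Measurable G := by
    refine Measurable.indicator ?_ measurableSet_ball
    exact ((hFm.comp (measurable_const_add c)).norm.pow_const 2).ennreal_ofReal
  have e1 : ∫⁻ w in Metric.ball c 1, ENNReal.ofReal (‖f w‖ ^ 2) = ∫⁻ w, G w := by
    rw [← lintegral_indicator measurableSet_ball,
      ← lintegral_add_left_eq_self (μ := (volume : Measure ℂ)) _ c]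
    refine lintegral_congr fun w => ?_
    by_cases hw : w ∈ Metric.ball (0:ℂ) 1
    · have hw2 : c + w ∈ Metric.ball c 1 := by simpa using hw
      simp only [G]
      rw [indicator_of_mem hw, indicator_of_mem hw2, hFe _ (hsub hw2)]
    · have hw2 : c + w ∉ Metric.ball c 1 := by simpa using hw
      simp only [G]
      rw [indicator_of_notMem hw, indicator_of_notMem hw2]
  rw [e1, ← Complex.lintegral_comp_polarCoord_symm]
  have hsub2 : Ioo (0:ℝ) 1 ×ˢ Ioo (-Real.pi) Real.pi ⊆ polarCoord.target := by
    rw [polarCoord_target]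
    exact prod_mono Ioo_subset_Ioi_self subset_rfl
  refine le_trans ?_ (lintegral_mono_set hsub2)
  have hms : Measurable fun p : ℝ × ℝ => ENNReal.ofReal p.1 • G (Complex.polarCoord.symm p) := by
    refine Measurable.mul (by fun_prop) (hGm.comp ?_)
    have : (fun p : ℝ × ℝ => Complex.polarCoord.symm p) =
      fun p => (p.1:ℂ) * (Real.cos p.2 + Real.sin p.2 * Complex.I) := by
      funext p; simp
    have h2 : Measurable (fun p : ℝ × ℝ => Complex.polarCoord.symm p) := by
      rw [this]
      fun_prop
    exact h2
  rw [Measure.volume_eq_prod, ← Measure.prod_restrict, lintegral_prod _ hms.aemeasurable]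
  have key : ∀ r ∈ Ioo (0:ℝ) 1, ENNReal.ofReal r * ENNReal.ofReal (2 * Real.pi * ‖f c‖ ^ 2) ≤
      ∫⁻ θ in Ioo (-Real.pi) Real.pi, ENNReal.ofReal r • G (Complex.polarCoord.symm (r, θ)) := by
    intro r hr
    have h1 := circle_mean_sq hf hr.1 (by linarith [hr.2])
    simp only [smul_eq_mul]
    rw [lintegral_const_mul' _ _ ENNReal.ofReal_ne_top]
    gcongr
    refine h1.trans (le_of_eq ?_)
    refine lintegral_congr fun θ => ?_
    have e2 : Complex.polarCoord.symm (r, θ) = r * Complex.exp (θ * Complex.I) := by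
      rw [Complex.polarCoord_symm_apply, Complex.exp_mul_I]
      simp
    have hn : ‖(r:ℂ) * Complex.exp (θ * Complex.I)‖ = r := by
      rw [norm_mul, Complex.norm_exp_ofReal_mul_I]; simp [abs_of_pos hr.1]
    have hm : Complex.polarCoord.symm (r, θ) ∈ Metric.ball (0:ℂ) 1 := by
      rw [e2, mem_ball_zero_iff, hn]; exact hr.2
    have hm2 : circleMap c r θ ∈ Metric.ball c 1 := by
      rw [circleMap, mem_ball_iff_norm, add_sub_cancel_left, hn]; exact hr.2
    simp only [G]
    rw [indicator_of_mem hm, e2, ← hFe _ (hsub hm2)]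
    rfl
  refine le_trans ?_ (setLIntegral_mono' measurableSet_Ioo key)
  rw [lintegral_mul_const' _ _ ENNReal.ofReal_ne_top]
  have h6 : ∫⁻ r in Ioo (0:ℝ) 1, ENNReal.ofReal r = ENNReal.ofReal (1/2) := by
    rw [← ofReal_integral_eq_lintegral_ofReal]
    · rw [← integral_Ioc_eq_integral_Ioo, ← intervalIntegral.integral_of_le (by norm_num)]
      simp
    · exact continuous_id.integrableOn_Icc.mono_set Ioo_subset_Icc_self
    · exact (ae_restrict_mem measurableSet_Ioo).mono fun x hx => hx.1.le
  rw [h6, ← ENNReal.ofReal_mul (by norm_num)]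
  apply ENNReal.ofReal_le_ofReal
  linarith

lemma lower_decay {f : ℂ → ℂ} {a : ℝ} (hd : DifferentiableOn ℂ f {w | w.im < -a})
    (hper : ∀ w : ℂ, w.im < -a → f (w + (2 * Real.pi : ℝ)) = f w)
    (hint : ∫⁻ w in {w : ℂ | w.im < -a ∧ w.re ∈ Icc 0 (2 * Real.pi)},
      ENNReal.ofReal (‖f w‖ ^ 2) ≠ ⊤) :
    ∀ ε > 0, ∃ L, ∀ w : ℂ, w.re ∈ Icc 0 (2 * Real.pi) → w.im < -L → ‖f w‖ < ε := by
  have hpi := Real.pi_pos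
  have hpi3 := Real.pi_gt_three
  set S : ℤ → Set ℂ := fun k =>
    {w : ℂ | w.im < -a ∧ w.re ∈ Icc (2 * Real.pi * k) (2 * Real.pi * k + 2 * Real.pi)} with hS
  have hSm : ∀ k, MeasurableSet (S k) := by
    intro k
    refine (measurableSet_lt Complex.measurable_im measurable_const).inter ?_
    exact measurableSet_Icc.preimage Complex.measurable_re
  have hstep : ∀ k, ∫⁻ w in S (k + 1), ENNReal.ofReal (‖f w‖ ^ 2) =
      ∫⁻ w in S k, ENNReal.ofReal (‖f w‖ ^ 2) := by
    intro k
    rw [← lintegral_indicator (hSm _), ← lintegral_indicator (hSm _),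
      ← lintegral_add_right_eq_self (μ := (volume : Measure ℂ)) _ ((2 * Real.pi : ℝ) : ℂ)]
    refine lintegral_congr fun w => ?_
    have hiff : w + ((2 * Real.pi : ℝ) : ℂ) ∈ S (k + 1) ↔ w ∈ S k := by
      simp only [hS, mem_ofPred_eq, mem_Icc, Complex.add_im, Complex.add_re, Complex.ofReal_re,
        Complex.ofReal_im, add_zero]
      push_cast
      constructor
      · rintro ⟨h1, h2, h3⟩
        exact ⟨h1, by linarith, by linarith⟩
      · rintro ⟨h1, h2, h3⟩
        exact ⟨h1, by linarith, by linarith⟩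
    by_cases hw : w ∈ S k
    · rw [indicator_of_mem hw, indicator_of_mem (hiff.2 hw), hper w hw.1]
    · rw [indicator_of_notMem hw, indicator_of_notMem (fun h => hw (hiff.1 h))]
  have hS0 : S 0 = {w : ℂ | w.im < -a ∧ w.re ∈ Icc 0 (2 * Real.pi)} := by
    simp [hS]
  have hfin : ∀ k ∈ ({-1, 0, 1} : Set ℤ), ∫⁻ w in S k, ENNReal.ofReal (‖f w‖ ^ 2) ≠ ⊤ := by
    have h0 : ∫⁻ w in S 0, ENNReal.ofReal (‖f w‖ ^ 2) ≠ ⊤ := by rw [hS0]; exact hint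
    rintro k (rfl | rfl | rfl)
    · have := hstep (-1)
      simp only [Int.reduceNeg, neg_add_cancel] at this
      rw [← this]; exact h0
    · exact h0
    · have := hstep 0
      simp only [zero_add] at this
      rw [this]; exact h0
  set μ : Measure ℂ := (volume.restrict (S (-1) ∪ S 0 ∪ S 1)).withDensity
    fun w => ENNReal.ofReal (‖f w‖ ^ 2) with hμ
  have hμfin : μ univ ≠ ⊤ := by
    rw [hμ, withDensity_apply _ MeasurableSet.univ, Measure.restrict_univ]
    refine ne_top_of_le_ne_top ?_ ((lintegral_union_le _ _ _).trans
      (add_le_add_left (lintegral_union_le _ _ _) _))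
    exact ENNReal.add_ne_top.2 ⟨ENNReal.add_ne_top.2 ⟨hfin _ (by simp), hfin _ (by simp)⟩,
      hfin _ (by simp)⟩
  have hTm : ∀ n : ℕ, MeasurableSet {w : ℂ | w.im < -(n:ℝ)} := fun n =>
    measurableSet_lt (by fun_prop) (by fun_prop)
  have htend : Tendsto (fun n : ℕ => μ {w : ℂ | w.im < -(n:ℝ)}) atTop
      (nhds (μ (⋂ n : ℕ, {w : ℂ | w.im < -(n:ℝ)}))) := by
    refine tendsto_measure_iInter_atTop (fun n => (hTm n).nullMeasurableSet) ?_
      ⟨0, ne_top_of_le_ne_top hμfin (measure_mono (subset_univ _))⟩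
    intro m n hmn w hw
    have : (m:ℝ) ≤ n := by exact_mod_cast hmn
    simp only [mem_ofPred_eq] at hw ⊢
    linarith
  have hemp : (⋂ n : ℕ, {w : ℂ | w.im < -(n:ℝ)}) = ∅ := by
    ext w
    simp only [mem_iInter, mem_ofPred_eq, mem_empty_iff_false, iff_false, not_forall, not_lt]
    obtain ⟨n, hn⟩ := exists_nat_gt (-w.im)
    exact ⟨n, by linarith⟩
  rw [hemp, measure_empty] at htend
  intro ε hε
  have hev := htend.eventually (gt_mem_nhds (show 0 < ENNReal.ofReal (Real.pi * ε ^ 2) by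
    rw [ENNReal.ofReal_pos]; positivity))
  obtain ⟨n, hn⟩ := hev.exists
  refine ⟨max (n + 1) (a + 2), fun w hwre hw => ?_⟩
  have hw1 : w.im < -(n+1) := by linarith [le_max_left ((n:ℝ) + 1) (a + 2)]
  have hw2 : w.im < -(a+2) := by linarith [le_max_right ((n:ℝ) + 1) (a + 2)]
  have hb : ∀ R : ℝ, ∀ v ∈ Metric.ball w R, |v.re - w.re| < R ∧ |v.im - w.im| < R := by
    intro R v hv
    rw [mem_ball_iff_norm] at hv
    have h1 := Complex.abs_re_le_norm (v - w)
    have h2 := Complex.abs_im_le_norm (v - w)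
    simp only [Complex.sub_re, Complex.sub_im] at h1 h2
    exact ⟨by linarith, by linarith⟩
  have h1 := ball_mean_sq (f := f) (c := w) (hd.mono fun v hv => by
    have := (hb 2 v hv).2
    rw [abs_lt] at this
    simp only [mem_ofPred_eq]; linarith)
  have h2 : ∫⁻ w in Metric.ball w 1, ENNReal.ofReal (‖f w‖ ^ 2) ≤ μ {w : ℂ | w.im < -(n:ℝ)} := by
    rw [hμ, withDensity_apply _ (hTm n), Measure.restrict_restrict (hTm n)]
    refine lintegral_mono_set fun v hv => ?_
    obtain ⟨h3, h4⟩ := hb 1 v hv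
    rw [abs_lt] at h3 h4
    refine ⟨by simp only [mem_ofPred_eq]; linarith, ?_⟩
    have h5 : v.im < -a := by linarith
    obtain ⟨h6, h7⟩ := hwre
    simp only [hS, mem_union, mem_ofPred_eq, h5, true_and, mem_Icc]
    push_cast
    by_cases c1 : v.re < 0
    · left; left; constructor <;> linarith
    · by_cases c2 : v.re ≤ 2 * Real.pi
      · left; right; constructor <;> linarith
      · right; constructor <;> linarith
  have h3 := (h1.trans h2).trans_lt hn
  rw [ENNReal.ofReal_lt_ofReal_iff (by positivity)] at h3
  have h4 : ‖f w‖ ^ 2 < ε ^ 2 := lt_of_mul_lt_mul_left h3 hpi.le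
  exact lt_of_pow_lt_pow_left₀ 2 hε.le h4

lemma lower_decay_deriv {f : ℂ → ℂ} {a : ℝ} (hd : DifferentiableOn ℂ f {w | w.im < -a})
    (hper : ∀ w : ℂ, w.im < -a → f (w + (2 * Real.pi : ℝ)) = f w)
    (hint : ∫⁻ w in {w : ℂ | w.im < -a ∧ w.re ∈ Icc 0 (2 * Real.pi)},
      ENNReal.ofReal (‖f w‖ ^ 2) ≠ ⊤) :
    ∀ ε > 0, ∃ L, ∀ w : ℂ, w.re ∈ Icc 0 (2 * Real.pi) → w.im < -L → ‖deriv f w‖ < ε := by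
  intro ε hε
  have hpi3 := Real.pi_gt_three
  obtain ⟨L, hL⟩ := lower_decay hd hper hint (ε / 2) (by positivity)
  refine ⟨max (L + 1) (a + 2), fun w hwre hw => ?_⟩
  have hw1 : w.im < -(L+1) := by linarith [le_max_left (L + 1) (a + 2)]
  have hw2 : w.im < -(a+2) := by linarith [le_max_right (L + 1) (a + 2)]
  have hb : ∀ v ∈ Metric.closedBall w 1, |v.re - w.re| ≤ 1 ∧ |v.im - w.im| ≤ 1 := by
    intro v hv
    rw [mem_closedBall_iff_norm] at hv
    have h1 := Complex.abs_re_le_norm (v - w)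
    have h2 := Complex.abs_im_le_norm (v - w)
    simp only [Complex.sub_re, Complex.sub_im] at h1 h2
    exact ⟨by linarith, by linarith⟩
  have hsub : Metric.closedBall w 1 ⊆ {w | w.im < -a} := by
    intro v hv
    have := (hb v hv).2
    rw [abs_le] at this
    simp only [mem_ofPred_eq]; linarith
  have h1 : ‖deriv f w‖ ≤ (ε / 2) / 1 := by
    refine Complex.norm_deriv_le_of_forall_mem_sphere_norm_le one_pos ?_ ?_
    · refine ⟨hd.mono (Metric.ball_subset_closedBall.trans hsub), ?_⟩
      exact hd.continuousOn.mono (Metric.closure_ball_subset_closedBall.trans hsub)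
    · intro v hv
      have hv' := Metric.sphere_subset_closedBall hv
      obtain ⟨h3, h4⟩ := hb v hv'
      rw [abs_le] at h3 h4
      obtain ⟨h6, h7⟩ := hwre
      by_cases c1 : v.re < 0
      · rw [← hper v (hsub hv')]
        refine (hL _ ?_ ?_).le
        · simp; constructor <;> linarith
        · simp; linarith
      · by_cases c2 : v.re ≤ 2 * Real.pi
        · exact (hL v ⟨by linarith, c2⟩ (by linarith)).le
        · have e : v - (2 * Real.pi : ℝ) + (2 * Real.pi : ℝ) = v := by ring
          rw [← e, hper]
          · refine (hL _ ?_ ?_).le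
            · simp; constructor <;> linarith
            · simp; linarith
          · have := hsub hv'
            simp only [mem_ofPred_eq] at this
            simpa using this
  linarith


lemma strip_shift (x : ℝ) : ∃ n : ℤ, x + n * (2 * Real.pi) ∈ Icc 0 (2 * Real.pi) := by
  have hp : 0 < 2 * Real.pi := by positivity
  refine ⟨-⌊x / (2 * Real.pi)⌋, ?_⟩
  have h1 := Int.floor_le (x / (2 * Real.pi))
  have h2 := Int.lt_floor_add_one (x / (2 * Real.pi))
  rw [le_div_iff₀ hp] at h1
  rw [div_lt_iff₀ hp] at h2
  push_cast
  constructor <;> nlinarith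

lemma maxprin {U : Set ℂ} (hUo : IsOpen U) (hUc : IsPreconnected U) {g : ℂ → ℂ}
    (hd : DifferentiableOn ℂ g U) {M a : ℝ} (hM : 0 ≤ M)
    (hlim : ∀ x ∈ frontier U, ∃ y, Tendsto g (nhdsWithin x U) (nhds y) ∧ ‖y‖ ≤ M)
    (hperU : ∀ w ∈ U, ∀ n : ℤ, w + ((n * (2 * Real.pi) : ℝ) : ℂ) ∈ U)
    (hper : ∀ w ∈ U, ∀ n : ℤ, g (w + ((n * (2 * Real.pi) : ℝ) : ℂ)) = g w)
    (hup : ∀ w ∈ U, w.im < a) (hlow : ∀ w : ℂ, w.im < -a → w ∈ U)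
    (hdec : ∀ ε > 0, ∃ L, ∀ w : ℂ, w.re ∈ Icc 0 (2 * Real.pi) → w.im < -L → ‖g w‖ < ε) :
    ∀ w ∈ U, ‖g w‖ ≤ M := by
  by_contra! hcon
  obtain ⟨w, hw, hwM⟩ := hcon
  obtain ⟨n, hn⟩ := strip_shift w.re
  set w0 : ℂ := w + ((n * (2 * Real.pi) : ℝ) : ℂ) with hw0
  have hw0U : w0 ∈ U := hperU w hw n
  have hw0M : M < ‖g w0‖ := by rw [hw0, hper w hw n]; exact hwM
  have hw0re : w0.re ∈ Icc 0 (2 * Real.pi) := by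
    have : w0.re = w.re + n * (2 * Real.pi) := by simp [hw0]
    rw [this]; exact hn
  obtain ⟨L, hL⟩ := hdec ‖g w0‖ (by linarith)
  set G := extendFrom U g with hG
  have hGU : ∀ x ∈ U, G x = g x := fun x hx =>
    extendFrom_eq (subset_closure hx) (hd.continuousOn x hx)
  have hGc : ContinuousOn G (closure U) := by
    refine continuousOn_extendFrom subset_rfl ?_
    intro x hx
    by_cases hxU : x ∈ U
    · exact ⟨_, hd.continuousOn x hxU⟩
    · obtain ⟨y, hy, -⟩ := hlim x ⟨hx, by rwa [hUo.interior_eq]⟩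
      exact ⟨y, hy⟩
  have hGf : ∀ x ∈ frontier U, ‖G x‖ ≤ M := by
    intro x hx
    obtain ⟨y, hy, hy2⟩ := hlim x hx
    rw [hG, extendFrom_eq hx.1 hy]; exact hy2
  set S : Set ℂ := Icc 0 (2 * Real.pi) ×ℂ Icc (-L) a with hS
  have hScomp : IsCompact S := isCompact_Icc.reProdIm isCompact_Icc
  have hK : IsCompact (closure U ∩ S) := hScomp.inter_left isClosed_closure
  have hw0K : w0 ∈ closure U ∩ S := by
    refine ⟨subset_closure hw0U, ?_⟩
    rw [hS, Complex.mem_reProdIm]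
    refine ⟨hw0re, ?_, (hup _ hw0U).le⟩
    by_contra! h
    exact lt_irrefl _ (hL w0 hw0re h)
  obtain ⟨w1, hw1, hmax⟩ := hK.exists_isMaxOn ⟨w0, hw0K⟩
    ((hGc.mono inter_subset_left).norm)
  have h01 : ‖g w0‖ ≤ ‖G w1‖ := by rw [← hGU w0 hw0U]; exact hmax hw0K
  have hw1U : w1 ∈ U := by
    by_contra h
    have := hGf w1 ⟨hw1.1, by rwa [hUo.interior_eq]⟩
    linarith
  rw [hGU w1 hw1U] at h01
  have hmaxU : IsMaxOn (norm ∘ g) U w1 := by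
    intro x hx
    obtain ⟨m, hm⟩ := strip_shift x.re
    have hxe := hper x hx m
    set x' : ℂ := x + ((m * (2 * Real.pi) : ℝ) : ℂ) with hx'
    have hxU : x' ∈ U := hperU x hx m
    have hxre : x'.re ∈ Icc 0 (2 * Real.pi) := by
      have : x'.re = x.re + m * (2 * Real.pi) := by simp [hx']
      rw [this]; exact hm
    show ‖g x‖ ≤ ‖g w1‖
    rw [← hxe]
    by_cases hi : x'.im < -L
    · exact (hL x' hxre hi).le.trans h01
    · have : x' ∈ closure U ∩ S := by
        refine ⟨subset_closure hxU, ?_⟩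
        rw [hS, Complex.mem_reProdIm]
        exact ⟨hxre, not_lt.1 hi, (hup _ hxU).le⟩
      have := hmax this
      simp only [mem_ofPred_eq] at this
      rwa [hGU _ hxU, hGU _ hw1U] at this
  have hconst := Complex.norm_eqOn_of_isPreconnected_of_isMaxOn hUc hUo hd hw1U hmaxU
  set p : ℂ := ⟨0, -(max L a) - 1⟩ with hp
  have hpU : p ∈ U := hlow p (by simp [hp]; have := le_max_right L a; linarith)
  have h1 := hconst hpU
  simp only [Function.comp, Function.const] at h1
  have h2 := hL p (by simp [hp, Real.pi_pos.le]) (by simp [hp]; have := le_max_left L a; linarith)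
  linarith


lemma uds {T : ℝ} (hT : 0 < T) : UniqueDiffOn ℝ (univ ×ˢ Icc (0:ℝ) T : Set (ℝ × ℝ)) :=
  uniqueDiffOn_univ.prod (uniqueDiffOn_Icc hT)

lemma slice_contDiff {T t : ℝ} (ht : t ∈ Icc (0:ℝ) T) {n : WithTop ℕ∞} {F : ℝ × ℝ → E2}
    (hF : ContDiffOn ℝ n F (univ ×ˢ Icc (0:ℝ) T)) : ContDiff ℝ n (fun α => F (α, t)) := by
  rw [← contDiffOn_univ]
  refine hF.comp (g := F) (f := fun α : ℝ => (α, t)) ?_ ?_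
  · exact (contDiff_id.prodMk contDiff_const).contDiffOn
  · intro x _; exact ⟨trivial, ht⟩

open scoped Pointwise in
lemma slice_bound {T t : ℝ} (hT : 0 < T) (ht : t ∈ Icc (0:ℝ) T) {n i : ℕ} {F : ℝ × ℝ → E2}
    (hF : ContDiffOn ℝ n F (univ ×ˢ Icc (0:ℝ) T)) (hi : i ≤ n) (α : ℝ) :
    ‖iteratedDeriv i (fun α => F (α, t)) α‖ ≤
      ‖iteratedFDerivWithin ℝ i F (univ ×ˢ Icc (0:ℝ) T) (α, t)‖ := by
  set S : Set (ℝ × ℝ) := univ ×ˢ Icc (0:ℝ) T with hS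
  set c : ℝ × ℝ := (0, t) with hc
  set S' : Set (ℝ × ℝ) := -c +ᵥ S with hS'
  have hmem : ∀ p : ℝ × ℝ, p ∈ S' ↔ p + c ∈ S := by
    intro p
    rw [hS', Set.mem_vadd_set_iff_neg_vadd_mem]
    simp [add_comm]
  have hSS : c +ᵥ S' = S := by simp [hS', vadd_vadd]
  have hG : ContDiffOn ℝ n (fun p => F (p + c)) S' := by
    refine hF.comp (contDiff_id.add contDiff_const).contDiffOn ?_
    intro p hp; exact (hmem p).1 hp
  have hu' : UniqueDiffOn ℝ S' := by
    have h := (uniqueDiffOn_univ (𝕜 := ℝ) (E := ℝ)).prod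
      (uniqueDiffOn_Icc (a := -t) (b := T - t) (by linarith))
    suffices e : S' = univ ×ˢ Icc (-t) (T - t) by rw [e]; exact h
    ext ⟨x, y⟩
    rw [hmem]
    simp [hS, hc]
    constructor <;> rintro ⟨h1, h2⟩ <;> constructor <;> linarith
  have hpre : (ContinuousLinearMap.inl ℝ ℝ ℝ) ⁻¹' S' = univ := by
    ext x
    rw [mem_preimage, hmem]
    simp [hS, hc]; exact ht
  have h1 := ContinuousLinearMap.iteratedFDerivWithin_comp_right (ContinuousLinearMap.inl ℝ ℝ ℝ)
    hG hu' (by rw [hpre]; exact uniqueDiffOn_univ) (x := α) (i := i)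
    (by rw [hmem]; simp [hS, hc]; exact ht) (by exact_mod_cast hi)
  rw [hpre, iteratedFDerivWithin_univ] at h1
  have h2 : ((fun p => F (p + c)) ∘ (ContinuousLinearMap.inl ℝ ℝ ℝ)) = fun α => F (α, t) := by
    funext x; simp [hc]
  rw [h2, iteratedFDerivWithin_comp_add_right, hSS] at h1
  rw [← norm_iteratedFDeriv_eq_norm_iteratedDeriv, h1]
  refine (ContinuousMultilinearMap.norm_compContinuousLinearMap_le _ _).trans ?_
  have h3 : (ContinuousLinearMap.inl ℝ ℝ ℝ) α + c = (α, t) := by simp [hc]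
  rw [h3]
  have h4 : ∏ _x : Fin i, ‖ContinuousLinearMap.inl ℝ ℝ ℝ‖ ≤ 1 := by
    refine Finset.prod_le_one (fun _ _ => norm_nonneg _) (fun _ _ => ?_)
    exact ContinuousLinearMap.norm_inl_le_one ℝ ℝ ℝ
  exact mul_le_of_le_one_right (norm_nonneg _) h4

section
variable {ρ1 ρ2 σ grav T A : ℝ}

lemma TwoFluid.z_contDiff (D : TwoFluid ρ1 ρ2 σ grav T A) {t : ℝ} (ht : t ∈ Icc (0:ℝ) T) :
    ContDiff ℝ 4 (fun α => D.z α t) := by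
  have h := slice_contDiff ht D.hz_smooth
  have h2 : ContDiff ℝ 4 (fun α : ℝ => α • xvec) := contDiff_id.smul contDiff_const
  simpa using h.add h2

lemma norm_xvec : ‖xvec‖ = 1 := by
  simp [xvec, EuclideanSpace.norm_eq, Fin.sum_univ_two]

lemma TwoFluid.z_near (D : TwoFluid ρ1 ρ2 σ grav T A) {t : ℝ} (ht : t ∈ Icc (0:ℝ) T) (α : ℝ) :
    ‖D.z α t - α • xvec‖ ≤ A := by
  have := D.hz_bound (α, t) ⟨trivial, ht⟩ 0 (by norm_num)
  simpa using this

lemma TwoFluid.z_iter_bound (D : TwoFluid ρ1 ρ2 σ grav T A) (hT : 0 < T) (hA : 1 ≤ A) {t : ℝ}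
    (ht : t ∈ Icc (0:ℝ) T) {i : ℕ} (h1 : 1 ≤ i) (h4 : i ≤ 4) (α : ℝ) :
    ‖iteratedDeriv i (fun α => D.z α t) α‖ ≤ 2 * A := by
  have hb := slice_bound hT ht (n := 4) (by exact_mod_cast D.hz_smooth) h4 α
  have hb2 := hb.trans (D.hz_bound (α, t) ⟨trivial, ht⟩ i h4)
  have hc := slice_contDiff ht D.hz_smooth
  have h2 : ContDiff ℝ 4 (fun α : ℝ => α • xvec) := contDiff_id.smul contDiff_const
  have h4' : (i : WithTop ℕ∞) ≤ 4 := by exact_mod_cast h4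
  have he : (fun α => D.z α t) = (fun α => D.z α t - α • xvec) + (fun α : ℝ => α • xvec) := by
    funext x; simp
  rw [he, iteratedDeriv_add ((hc.of_le h4').contDiffAt) ((h2.of_le h4').contDiffAt)]
  refine (norm_add_le _ _).trans ?_
  have h3 : ‖iteratedDeriv i (fun α : ℝ => α • xvec) α‖ ≤ 1 := by
    have hd : deriv (fun α : ℝ => α • xvec) = fun _ => xvec := by
      funext x
      simpa using ((hasDerivAt_id x).smul_const xvec).deriv
    obtain ⟨k, rfl⟩ : ∃ k, i = k + 1 := ⟨i - 1, by omega⟩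
    rw [iteratedDeriv_succ', hd, iteratedDeriv_const]
    split_ifs <;> simp [norm_xvec]
  linarith

lemma TwoFluid.dz_bound (D : TwoFluid ρ1 ρ2 σ grav T A) (hT : 0 < T) (hA : 1 ≤ A) {t : ℝ}
    (ht : t ∈ Icc (0:ℝ) T) (α : ℝ) : ‖deriv (fun α => D.z α t) α‖ ≤ 2 * A := by
  simpa using D.z_iter_bound hT hA ht (i := 1) le_rfl (by norm_num) α

lemma TwoFluid.ddz_bound (D : TwoFluid ρ1 ρ2 σ grav T A) (hT : 0 < T) (hA : 1 ≤ A) {t : ℝ}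
    (ht : t ∈ Icc (0:ℝ) T) (α : ℝ) :
    ‖deriv (fun β => deriv (fun α => D.z α t) β) α‖ ≤ 2 * A := by
  have := D.z_iter_bound hT hA ht (i := 2) (by norm_num) (by norm_num) α
  rwa [iteratedDeriv_succ, iteratedDeriv_one] at this

lemma TwoFluid.z_hasDeriv (D : TwoFluid ρ1 ρ2 σ grav T A) {t : ℝ} (ht : t ∈ Icc (0:ℝ) T) (α : ℝ) :
    HasDerivAt (fun α => D.z α t) (deriv (fun α => D.z α t) α) α :=
  ((D.z_contDiff ht).differentiable (by norm_num) α).hasDerivAt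

lemma TwoFluid.dz_contDiff (D : TwoFluid ρ1 ρ2 σ grav T A) {t : ℝ} (ht : t ∈ Icc (0:ℝ) T) :
    ContDiff ℝ 3 (deriv (fun α => D.z α t)) := by
  have := D.z_contDiff ht
  rw [show (4 : WithTop ℕ∞) = 3 + 1 by norm_num, contDiff_succ_iff_deriv] at this
  exact this.2.2

lemma TwoFluid.dz_hasDeriv (D : TwoFluid ρ1 ρ2 σ grav T A) {t : ℝ} (ht : t ∈ Icc (0:ℝ) T) (α : ℝ) :
    HasDerivAt (fun β => deriv (fun α => D.z α t) β)
      (deriv (fun β => deriv (fun α => D.z α t) β) α) α :=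
  ((D.dz_contDiff ht).differentiable (by norm_num) α).hasDerivAt

lemma TwoFluid.v_hasDeriv (D : TwoFluid ρ1 ρ2 σ grav T A) (hT : 0 < T) {t : ℝ}
    (ht : t ∈ Icc (0:ℝ) T) (α : ℝ) :
    ∃ v' : E2, HasDerivAt (fun α => D.u1 (D.z α t) t) v' α ∧ ‖v'‖ ≤ A := by
  have hc := slice_contDiff ht D.hv1_smooth
  refine ⟨_, (hc.differentiable (by norm_num) α).hasDerivAt, ?_⟩
  have hb := slice_bound hT ht (n := 3) (i := 1) (by exact_mod_cast D.hv1_smooth) (by norm_num) α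
  have hb2 := hb.trans (D.hv1_bound (α, t) ⟨trivial, ht⟩ 1 (by norm_num))
  simpa using hb2

lemma TwoFluid.z_time (D : TwoFluid ρ1 ρ2 σ grav T A) (hT : 0 < T) {t s : ℝ}
    (ht : t ∈ Icc (0:ℝ) T) (hs : s ∈ Icc (0:ℝ) T) (α : ℝ) :
    ‖D.z α t - D.z α s‖ ≤ A * |t - s| := by
  have h := Convex.norm_image_sub_le_of_norm_fderivWithin_le (𝕜 := ℝ) (C := A)
    (D.hz_smooth.differentiableOn (by norm_num))
    (fun p hp => by
      have := D.hz_bound p hp 1 (by norm_num)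
      rwa [norm_iteratedFDerivWithin_one _ (uds hT p hp)] at this)
    (convex_univ.prod (convex_Icc 0 T)) (x := (α, s)) (y := (α, t)) ⟨trivial, hs⟩ ⟨trivial, ht⟩
  simpa [Prod.norm_def] using h

lemma TwoFluid.z_cont (D : TwoFluid ρ1 ρ2 σ grav T A) :
    ContinuousOn (fun p : ℝ × ℝ => D.z p.1 p.2) (univ ×ˢ Icc (0:ℝ) T) := by
  have h := D.hz_smooth.continuousOn.add
    (g := fun p : ℝ × ℝ => p.1 • xvec) (by fun_prop)
  refine h.congr ?_
  intro p _; simp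

lemma TwoFluid.dz_eq (D : TwoFluid ρ1 ρ2 σ grav T A) {t : ℝ} (ht : t ∈ Icc (0:ℝ) T) (α : ℝ) :
    deriv (fun α => D.z α t) α = fderivWithin ℝ (fun p : ℝ × ℝ => D.z p.1 p.2 - p.1 • xvec)
      (univ ×ˢ Icc (0:ℝ) T) (α, t) (1, 0) + xvec := by
  have h := ((D.hz_smooth.differentiableOn (by norm_num)) (α, t) ⟨trivial, ht⟩).hasFDerivWithinAt
  have h2 : HasDerivWithinAt (fun α : ℝ => ((α, t) : ℝ × ℝ)) (1, 0) univ α :=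
    ((hasDerivAt_id α).prodMk (hasDerivAt_const α t)).hasDerivWithinAt
  have h3 := h.comp_hasDerivWithinAt (t := univ ×ˢ Icc (0:ℝ) T) α h2 (fun x _ => ⟨trivial, ht⟩)
  rw [hasDerivWithinAt_univ] at h3
  have h4 := h3.add ((hasDerivAt_id α).smul_const xvec)
  have h5 := h4.deriv
  simp only [one_smul] at h5
  rw [← h5]
  congr 1
  funext x; simp

lemma TwoFluid.dz_cont (D : TwoFluid ρ1 ρ2 σ grav T A) (hT : 0 < T) :
    ContinuousOn (fun p : ℝ × ℝ => deriv (fun α => D.z α p.2) p.1) (univ ×ˢ Icc (0:ℝ) T) := by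
  have h := D.hz_smooth.continuousOn_fderivWithin (uds hT) (by norm_num)
  have h2 : ContinuousOn (fun p : ℝ × ℝ => fderivWithin ℝ
      (fun p : ℝ × ℝ => D.z p.1 p.2 - p.1 • xvec) (univ ×ˢ Icc (0:ℝ) T) p (1, 0) + xvec)
      (univ ×ˢ Icc (0:ℝ) T) := (h.clm_apply continuousOn_const).add continuousOn_const
  refine h2.congr ?_
  rintro ⟨α, t⟩ ⟨-, ht⟩
  exact D.dz_eq ht α

lemma TwoFluid.z_time_diff (D : TwoFluid ρ1 ρ2 σ grav T A) {t : ℝ}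
    (ht : t ∈ Ioo (0:ℝ) T) (α : ℝ) : DifferentiableAt ℝ (fun s => D.z α s) t := by
  have h := (D.hz_smooth.differentiableOn (by norm_num)) (α, t) ⟨trivial, Ioo_subset_Icc_self ht⟩
  have h1 := h.differentiableAt (prod_mem_nhds univ_mem (Icc_mem_nhds ht.1 ht.2))
  have h2 : DifferentiableAt ℝ (fun s : ℝ => ((α, s) : ℝ × ℝ)) t := by fun_prop
  have h3 := (h1.comp t h2).add (differentiableAt_const (α • xvec))
  refine h3.congr_of_eventuallyEq (Eventually.of_forall fun s => ?_)
  simp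

lemma TwoFluid.dz_time_diff (D : TwoFluid ρ1 ρ2 σ grav T A) (hT : 0 < T) {t : ℝ}
    (ht : t ∈ Ioo (0:ℝ) T) (α : ℝ) :
    DifferentiableAt ℝ (fun s => deriv (fun α => D.z α s) α) t := by
  have hS : (univ ×ˢ Icc (0:ℝ) T : Set (ℝ × ℝ)) ∈ nhds (α, t) :=
    prod_mem_nhds univ_mem (Icc_mem_nhds ht.1 ht.2)
  have h := (D.hz_smooth.fderivWithin (m := 3) (uds hT) (by norm_num)).differentiableOn
    (by norm_num) (α, t) ⟨trivial, Ioo_subset_Icc_self ht⟩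
  have h1 := h.differentiableAt hS
  have h2 : DifferentiableAt ℝ (fun s : ℝ => ((α, s) : ℝ × ℝ)) t := by fun_prop
  have h3 := ((h1.comp t h2).clm_apply (differentiableAt_const ((1, 0) : ℝ × ℝ))).add
    (differentiableAt_const xvec)
  refine h3.congr_of_eventuallyEq ?_
  filter_upwards [Icc_mem_nhds ht.1 ht.2] with s hs
  exact D.dz_eq hs α

end


lemma cr_norm {L : E2 →L[ℝ] E2}
    (h1 : L (EuclideanSpace.single 0 1) 0 + L (EuclideanSpace.single 1 1) 1 = 0)
    (h2 : L (EuclideanSpace.single 0 1) 1 - L (EuclideanSpace.single 1 1) 0 = 0) (h : E2) :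
    ‖L h‖ = ‖L (EuclideanSpace.single 0 1)‖ * ‖h‖ := by
  set a := L (EuclideanSpace.single 0 1) with ha
  set b := L (EuclideanSpace.single 1 1) with hb
  have hh : h = h 0 • EuclideanSpace.single 0 1 + h 1 • EuclideanSpace.single 1 1 := by
    ext i; fin_cases i <;> simp
  have hL : L h = h 0 • a + h 1 • b := by
    conv_lhs => rw [hh]
    rw [map_add, map_smul, map_smul]
  have e : ‖L h‖ ^ 2 = (‖a‖ * ‖h‖) ^ 2 := by
    rw [mul_pow, EuclideanSpace.norm_sq_eq, EuclideanSpace.norm_sq_eq, EuclideanSpace.norm_sq_eq,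
      hL]
    simp only [Fin.sum_univ_two, Real.norm_eq_abs, sq_abs, PiLp.add_apply, PiLp.smul_apply,
      smul_eq_mul]
    have e1 : b 1 = - a 0 := by linarith
    have e2 : b 0 = a 1 := by linarith
    rw [e1, e2]; ring
  exact (sq_eq_sq₀ (norm_nonneg _) (by positivity)).1 e

lemma deriv_ext {Ω : Set E2} (hΩ : IsOpen Ω) {u : E2 → E2} (hu : ContDiffOn ℝ 3 u (closure Ω))
    {x : E2} (hx : x ∈ closure Ω) :
    ∃ L : E2 →L[ℝ] E2, HasFDerivWithinAt u L (closure Ω) x ∧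
      Tendsto (fun y => fderiv ℝ u y) (nhdsWithin x Ω) (nhds L) := by
  have h := hu x hx
  rw [show (3 : WithTop ℕ∞) = 2 + 1 by norm_num,
    contDiffWithinAt_succ_iff_hasFDerivWithinAt' (by decide)] at h
  obtain ⟨U, hU, hUs, -, f', hf', hc⟩ := h
  rw [insert_eq_of_mem hx] at hU hUs
  refine ⟨f' x, hf' x (mem_of_mem_nhdsWithin hx hU), ?_⟩
  have hc2 : Tendsto f' (nhdsWithin x Ω) (nhds (f' x)) :=
    hc.continuousWithinAt.mono_left (nhdsWithin_mono x subset_closure)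
  refine hc2.congr' ?_
  have hU2 : U ∈ nhdsWithin x Ω := nhdsWithin_mono x subset_closure hU
  filter_upwards [hU2, self_mem_nhdsWithin] with y hy hyΩ
  exact ((hf' y hy).hasFDerivAt (mem_of_superset (hΩ.mem_nhds hyΩ) subset_closure)).fderiv.symm

def phi : ℂ ≃ₗᵢ[ℝ] E2 := Complex.orthonormalBasisOneI.repr

lemma phi_0 (w : ℂ) : phi w 0 = w.re := by simp [phi, Complex.orthonormalBasisOneI_repr_apply]
lemma phi_1 (w : ℂ) : phi w 1 = w.im := by simp [phi, Complex.orthonormalBasisOneI_repr_apply]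

lemma phi_one : phi 1 = EuclideanSpace.single 0 1 := by
  ext i; fin_cases i
  · simpa using phi_0 1
  · simpa using phi_1 1

lemma phi_I : phi Complex.I = EuclideanSpace.single 1 1 := by
  ext i; fin_cases i
  · simpa using phi_0 Complex.I
  · simpa using phi_1 Complex.I

lemma transl_0 : transl 0 = 2 * Real.pi := by simp [transl]
lemma transl_1 : transl 1 = 0 := by simp [transl]

lemma phi_transl : phi ((2 * Real.pi : ℝ) : ℂ) = transl := by
  ext i; fin_cases i
  · show phi _ 0 = transl 0
    rw [phi_0, transl_0, Complex.ofReal_re]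
  · show phi _ 1 = transl 1
    rw [phi_1, transl_1, Complex.ofReal_im]

def psi : E2 →L[ℝ] ℂ :=
  (Complex.conjLIE.toLinearIsometry.toContinuousLinearMap).comp
    (phi.symm.toLinearIsometry.toContinuousLinearMap)

lemma psi_norm (v : E2) : ‖psi v‖ = ‖v‖ := by
  simp [psi]

lemma psi_apply (v : E2) : psi v = ⟨v 0, - v 1⟩ := by
  have h0 := phi_0 (phi.symm v)
  have h1 := phi_1 (phi.symm v)
  rw [phi.apply_symm_apply] at h0 h1
  apply Complex.ext
  · simp [psi, h0]
  · simp [psi, h1]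

section
variable {ρ1 ρ2 σ grav T A : ℝ}

lemma TwoFluid.u1_holo (D : TwoFluid ρ1 ρ2 σ grav T A) {t : ℝ} (ht : t ∈ Icc (0:ℝ) T)
    {w : ℂ} (hw : phi w ∈ D.Ω1 t) :
    HasDerivAt (fun w => psi (D.u1 (phi w) t))
      (psi (fderiv ℝ (fun x => D.u1 x t) (phi w) (EuclideanSpace.single 0 1))) w := by
  have hd : HasFDerivAt (fun x => D.u1 x t) (fderiv ℝ (fun x => D.u1 x t) (phi w)) (phi w) := by
    refine DifferentiableAt.hasFDerivAt ?_
    exact ((D.hu1_reg t ht).differentiableOn (by norm_num)).differentiableAt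
      (mem_of_superset ((D.hΩ1_open t ht).mem_nhds hw) subset_closure)
  have hp : HasFDerivAt (fun w : ℂ => phi w) (phi.toLinearIsometry.toContinuousLinearMap) w :=
    phi.toLinearIsometry.toContinuousLinearMap.hasFDerivAt
  have h2 := (psi.hasFDerivAt (x := D.u1 (phi w) t)).comp w (hd.comp w hp)
  have h3 := h2.complexOfReal_hasFDerivAt (by
    have e1 := D.hdiv1 t ht _ hw
    have e2 := D.hcurl1 t ht _ hw
    simp only [ContinuousLinearMap.comp_apply, LinearIsometry.coe_toContinuousLinearMap,
      LinearIsometryEquiv.coe_toLinearIsometry, phi_one, phi_I, psi_apply]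
    apply Complex.ext
    · simp; linarith
    · simp; linarith)
  have h4 := h3.hasDerivAt
  rw [← phi_one]
  exact h4

lemma TwoFluid.transl_mem (D : TwoFluid ρ1 ρ2 σ grav T A) {t : ℝ} (ht : t ∈ Icc (0:ℝ) T) (x : E2) :
    x + transl ∈ D.Ω1 t ↔ x ∈ D.Ω1 t := by
  have h := D.hper_Ω1 t ht
  constructor
  · intro hx
    rw [← h] at hx
    obtain ⟨y, hy, hyx⟩ := hx
    have : y = x := by simpa using hyx
    rwa [← this]
  · intro hx
    rw [← h]
    exact ⟨x, hx, rfl⟩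

lemma TwoFluid.grad_bound (D : TwoFluid ρ1 ρ2 σ grav T A) (hT : 0 < T) (hA : 1 ≤ A) {t : ℝ}
    (ht : t ∈ Icc (0:ℝ) T) {x : E2} (hx : x ∈ D.Ω1 t) (h : E2) :
    ‖fderiv ℝ (fun x => D.u1 x t) x h‖ ≤ A ^ 2 * ‖h‖ := by
  rw [cr_norm (D.hdiv1 t ht x hx) (D.hcurl1 t ht x hx)]
  refine mul_le_mul_of_nonneg_right ?_ (norm_nonneg _)
  set Ω := D.Ω1 t with hΩ
  have hΩo : IsOpen Ω := D.hΩ1_open t ht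
  set u : E2 → E2 := fun x => D.u1 x t with hu
  set f : ℂ → ℂ := fun w => psi (u (phi w)) with hf
  set g : ℂ → ℂ := fun w => psi (fderiv ℝ u (phi w) (EuclideanSpace.single 0 1)) with hg
  set U : Set ℂ := phi ⁻¹' Ω with hU
  have hUo : IsOpen U := hΩo.preimage phi.continuous
  have hfg : ∀ w ∈ U, HasDerivAt f (g w) w := fun w hw => D.u1_holo ht hw
  have hfd : DifferentiableOn ℂ f U := fun w hw => (hfg w hw).differentiableAt.differentiableWithinAt
  have hgd : DifferentiableOn ℂ g U :=
    (hfd.deriv hUo).congr fun w hw => (hfg w hw).deriv.symm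
  have hUc : IsPreconnected U := by
    have : U = phi.symm '' Ω := by
      rw [hU]
      exact (phi.toEquiv.image_symm_eq_preimage Ω).symm
    rw [this]
    exact (D.hΩ1_conn t ht).isPreconnected.image _ phi.symm.continuous.continuousOn
  obtain ⟨a, ha1, ha⟩ := D.hStrip
  have hup : ∀ w ∈ U, w.im < a := by
    intro w hw
    by_contra! hcon
    have : phi w ∈ D.Ω2 t := (ha t ht).2 (by simp only [mem_ofPred_eq, phi_1]; exact hcon)
    exact (D.hDisj12 t ht).le_bot ⟨hw, this⟩
  have hlow : ∀ w : ℂ, w.im < -a → w ∈ U := by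
    intro w hw
    exact (ha t ht).1 (by simp only [mem_ofPred_eq, phi_1]; exact hw.le)
  have hper1 : ∀ w : ℂ, phi (w + ((2 * Real.pi : ℝ) : ℂ)) = phi w + transl := by
    intro w; rw [map_add, phi_transl]
  have hmem1 : ∀ w : ℂ, w + ((2 * Real.pi : ℝ) : ℂ) ∈ U ↔ w ∈ U := by
    intro w
    rw [hU, mem_preimage, hper1]
    exact D.transl_mem ht _
  have hfper : ∀ w ∈ U, f (w + ((2 * Real.pi : ℝ) : ℂ)) = f w := by
    intro w hw
    simp only [hf, hper1, hu]
    rw [D.hper_u1 t ht _ hw]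
  have hgper : ∀ w ∈ U, g (w + ((2 * Real.pi : ℝ) : ℂ)) = g w := by
    intro w hw
    have h1 := hfg _ ((hmem1 w).2 hw)
    have h2 := h1.comp_add_const w _
    have h3 : HasDerivAt f (g (w + ((2 * Real.pi : ℝ) : ℂ))) w := by
      refine h2.congr_of_eventuallyEq ?_
      filter_upwards [hUo.mem_nhds hw] with y hy
      exact (hfper y hy).symm
    exact h3.unique (hfg w hw)
  have hnat : ∀ n : ℕ, ∀ w ∈ U, w + ((n * (2 * Real.pi) : ℝ) : ℂ) ∈ U ∧
      g (w + ((n * (2 * Real.pi) : ℝ) : ℂ)) = g w := by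
    intro n
    induction n with
    | zero => intro w hw; simpa using hw
    | succ k ih =>
      intro w hw
      have e : w + ((((k + 1 : ℕ) : ℝ) * (2 * Real.pi) : ℝ) : ℂ) =
        (w + ((k * (2 * Real.pi) : ℝ) : ℂ)) + ((2 * Real.pi : ℝ) : ℂ) := by push_cast; ring
      rw [e]
      obtain ⟨h1, h2⟩ := ih w hw
      exact ⟨(hmem1 _).2 h1, by rw [hgper _ h1, h2]⟩
  have hmemnat : ∀ n : ℕ, ∀ w, w + ((n * (2 * Real.pi) : ℝ) : ℂ) ∈ U → w ∈ U := by
    intro n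
    induction n with
    | zero => intro w hw; simpa using hw
    | succ k ih =>
      intro w hw
      have e : w + ((((k + 1 : ℕ) : ℝ) * (2 * Real.pi) : ℝ) : ℂ) =
        (w + ((k * (2 * Real.pi) : ℝ) : ℂ)) + ((2 * Real.pi : ℝ) : ℂ) := by push_cast; ring
      rw [e] at hw
      exact ih w ((hmem1 _).1 hw)
  have hint : ∀ n : ℤ, ∀ w ∈ U, w + ((n * (2 * Real.pi) : ℝ) : ℂ) ∈ U ∧
      g (w + ((n * (2 * Real.pi) : ℝ) : ℂ)) = g w := by
    intro n w hw
    obtain ⟨k, rfl | rfl⟩ := n.eq_nat_or_neg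
    · exact_mod_cast hnat k w hw
    · set w' := w + (((-(k:ℤ) : ℤ) * (2 * Real.pi) : ℝ) : ℂ) with hw'
      have e : w' + ((k * (2 * Real.pi) : ℝ) : ℂ) = w := by rw [hw']; push_cast; ring
      have h1 : w' ∈ U := hmemnat k w' (by rw [e]; exact hw)
      refine ⟨h1, ?_⟩
      have := (hnat k w' h1).2
      rw [e] at this
      exact this.symm
  have hdec : ∀ ε > 0, ∃ L, ∀ w : ℂ, w.re ∈ Icc 0 (2 * Real.pi) → w.im < -L → ‖g w‖ < ε := by
    intro ε hε
    obtain ⟨L, hL⟩ := lower_decay_deriv (f := f) (a := a)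
      (hfd.mono (fun w hw => hlow w hw)) (fun w hw => hfper w (hlow w hw)) (by
        have hi := D.hL2_1 t ht
        have hi2 := hi.mono_set (s := phi '' {w : ℂ | w.im < -a ∧ w.re ∈ Icc 0 (2 * Real.pi)}) (by
          rintro _ ⟨w, ⟨hw1, hw2⟩, rfl⟩
          exact ⟨hlow w hw1, by simp only [mem_ofPred_eq, phi_0]; exact hw2⟩)
        have hmp : MeasurePreserving phi := Complex.orthonormalBasisOneI.measurePreserving_repr
        have hme : MeasurableEmbedding phi := phi.toHomeomorph.measurableEmbedding
        rw [hmp.integrableOn_image hme] at hi2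
        have h3 := hi2.2
        have h4 : ∫⁻ w in {w : ℂ | w.im < -a ∧ w.re ∈ Icc 0 (2 * Real.pi)},
            ENNReal.ofReal (‖f w‖ ^ 2) < ⊤ := by
          refine lt_of_eq_of_lt ?_ h3
          refine lintegral_congr fun w => ?_
          rw [← ofReal_norm]
          simp [hf, psi_norm, hu]
        exact h4.ne) ε hε
    refine ⟨max L a, fun w hw1 hw2 => ?_⟩
    rw [← (hfg w (hlow w (by have := le_max_right L a; linarith))).deriv]
    exact hL w hw1 (by have := le_max_left L a; linarith)
  have hlim : ∀ w ∈ frontier U, ∃ y, Tendsto g (nhdsWithin w U) (nhds y) ∧ ‖y‖ ≤ A ^ 2 := by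
    intro w hw
    have hfr : phi w ∈ frontier Ω := by
      have := phi.toHomeomorph.preimage_frontier Ω
      have h2 : w ∈ phi.toHomeomorph ⁻¹' frontier Ω := by rw [this]; exact hw
      exact h2
    obtain ⟨L, hL1, hL2⟩ := deriv_ext hΩo (D.hu1_reg t ht) hfr.1
    have htend : Tendsto (fun y => fderiv ℝ u (phi y)) (nhdsWithin w U) (nhds L) := by
      refine hL2.comp ?_
      refine tendsto_nhdsWithin_of_tendsto_nhds_of_eventually_within _
        (phi.continuous.continuousAt.mono_left nhdsWithin_le_nhds) ?_
      filter_upwards [self_mem_nhdsWithin] with y hy using hy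
    have happ : ∀ v : E2, Tendsto (fun y => fderiv ℝ u (phi y) v) (nhdsWithin w U) (nhds (L v)) :=
      fun v => ((ContinuousLinearMap.apply ℝ E2 v).continuous.tendsto L).comp htend
    have hco : ∀ (v : E2) (i : Fin 2), Tendsto (fun y => fderiv ℝ u (phi y) v i)
        (nhdsWithin w U) (nhds (L v i)) := fun v i =>
      ((EuclideanSpace.proj (𝕜 := ℝ) i).continuous.tendsto (L v)).comp (happ v)
    have hne : (nhdsWithin w U).NeBot := mem_closure_iff_nhdsWithin_neBot.1 hw.1
    have c1 : L (EuclideanSpace.single 0 1) 0 + L (EuclideanSpace.single 1 1) 1 = 0 := by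
      refine tendsto_nhds_unique_of_eventuallyEq ((hco _ 0).add (hco _ 1)) tendsto_const_nhds ?_
      filter_upwards [self_mem_nhdsWithin] with y hy using D.hdiv1 t ht _ hy
    have c2 : L (EuclideanSpace.single 0 1) 1 - L (EuclideanSpace.single 1 1) 0 = 0 := by
      refine tendsto_nhds_unique_of_eventuallyEq ((hco _ 1).sub (hco _ 0)) tendsto_const_nhds ?_
      filter_upwards [self_mem_nhdsWithin] with y hy using D.hcurl1 t ht _ hy
    refine ⟨psi (L (EuclideanSpace.single 0 1)), (psi.continuous.tendsto _).comp (happ _), ?_⟩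
    rw [psi_norm]
    have hfr2 := hfr
    rw [hΩ, D.hFront1 t ht] at hfr2
    obtain ⟨α, hα⟩ := hfr2
    simp only at hα
    rw [← hα] at hL1
    have hmaps : MapsTo (fun α => D.z α t) univ (closure Ω) := by
      intro β _
      have : D.z β t ∈ frontier Ω := by rw [hΩ, D.hFront1 t ht]; exact ⟨β, rfl⟩
      exact this.1
    have hch := hL1.comp_hasDerivWithinAt α (D.z_hasDeriv ht α).hasDerivWithinAt hmaps
    rw [hasDerivWithinAt_univ] at hch
    obtain ⟨v', hv', hvA⟩ := D.v_hasDeriv hT ht α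
    have hvv : L (deriv (fun α => D.z α t) α) = v' := hch.unique hv'
    have hnn := cr_norm c1 c2 (deriv (fun α => D.z α t) α)
    rw [hvv] at hnn
    have hlo := D.hz_lower t ht α
    have h5 : ‖L (EuclideanSpace.single 0 1)‖ * A⁻¹ ≤ A := by
      calc _ ≤ ‖L (EuclideanSpace.single 0 1)‖ * ‖deriv (fun α => D.z α t) α‖ := by gcongr
        _ = ‖v'‖ := hnn.symm
        _ ≤ A := hvA
    rw [← div_eq_mul_inv, div_le_iff₀ (by linarith)] at h5
    rw [sq]; exact h5
  have key := maxprin hUo hUc hgd (M := A ^ 2) (a := a) (by positivity) hlim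
    (fun w hw n => (hint n w hw).1) (fun w hw n => (hint n w hw).2) hup hlow hdec
  have := key (phi.symm x) (by rw [hU, mem_preimage, phi.apply_symm_apply]; exact hx)
  simpa only [hg, phi.apply_symm_apply, psi_norm] using this

end


lemma inner2 (x y : E2) : inner ℝ x y = x 0 * y 0 + x 1 * y 1 := by
  simp [PiLp.inner_apply, Fin.sum_univ_two, mul_comm]

lemma normsq2 (x : E2) : ‖x‖ ^ 2 = x 0 ^ 2 + x 1 ^ 2 := by
  rw [EuclideanSpace.norm_sq_eq]; simp [Fin.sum_univ_two]

lemma perpv_0 (w : E2) : perpv w 0 = -(w 1) := by simp [perpv]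
lemma perpv_1 (w : E2) : perpv w 1 = w 0 := by simp [perpv]

lemma perpv_norm (w : E2) : ‖perpv w‖ = ‖w‖ := by
  have : ‖perpv w‖ ^ 2 = ‖w‖ ^ 2 := by rw [normsq2, normsq2, perpv_0, perpv_1]; ring
  exact (sq_eq_sq₀ (norm_nonneg _) (norm_nonneg _)).1 this

lemma perpv_inner (w : E2) : inner ℝ (perpv w) w = 0 := by
  rw [inner2, perpv_0, perpv_1]; ring

lemma ext2 {x y : E2} (h0 : x 0 = y 0) (h1 : x 1 = y 1) : x = y := by
  ext i; fin_cases i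
  · exact h0
  · exact h1

def perpL : E2 →L[ℝ] E2 := LinearMap.toContinuousLinearMap
  { toFun := perpv
    map_add' := fun x y => by
      apply ext2 <;> simp [perpv_0, perpv_1]; ring
    map_smul' := fun c x => by
      apply ext2 <;> simp [perpv_0, perpv_1] }

lemma perpL_apply (w : E2) : perpL w = perpv w := rfl

lemma decomp {n x : E2} (hn : ‖n‖ = 1) {v : E2} (hv : v ≠ 0) (hnv : inner ℝ n v = 0)
    (hx : inner ℝ x v = 0) : x = (inner ℝ x n : ℝ) • n := by
  have h1 := normsq2 n
  rw [hn] at h1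
  rw [inner2] at hnv hx
  have hv2 : 0 < v 0 ^ 2 + v 1 ^ 2 := by rw [← normsq2]; positivity
  rw [inner2]
  apply ext2
  · simp only [PiLp.smul_apply, smul_eq_mul]
    have : (v 0 ^ 2 + v 1 ^ 2) * (x 0 - (x 0 * n 0 + x 1 * n 1) * n 0) = 0 := by
      have e1 : x 0 * n 1 - x 1 * n 0 = 0 := by
        have ha : (x 0 * n 1 - x 1 * n 0) * v 0 = 0 := by linear_combination n 1 * hx - x 1 * hnv
        have hb : (x 0 * n 1 - x 1 * n 0) * v 1 = 0 := by linear_combination (-n 0) * hx + x 0 * hnv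
        have : (x 0 * n 1 - x 1 * n 0) * (v 0 ^ 2 + v 1 ^ 2) = 0 := by
          linear_combination v 0 * ha + v 1 * hb
        rcases mul_eq_zero.1 this with h | h
        · exact h
        · exact absurd h hv2.ne'
      linear_combination (v 0 ^ 2 + v 1 ^ 2) * (n 1 * e1 + x 0 * h1)
    rcases mul_eq_zero.1 this with h | h
    · exact absurd h hv2.ne'
    · linarith
  · simp only [PiLp.smul_apply, smul_eq_mul]
    have e1 : x 0 * n 1 - x 1 * n 0 = 0 := by
      have ha : (x 0 * n 1 - x 1 * n 0) * v 0 = 0 := by linear_combination n 1 * hx - x 1 * hnv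
      have hb : (x 0 * n 1 - x 1 * n 0) * v 1 = 0 := by linear_combination (-n 0) * hx + x 0 * hnv
      have : (x 0 * n 1 - x 1 * n 0) * (v 0 ^ 2 + v 1 ^ 2) = 0 := by
        linear_combination v 0 * ha + v 1 * hb
      rcases mul_eq_zero.1 this with h | h
      · exact h
      · exact absurd h hv2.ne'
    linear_combination (-n 0) * e1 + x 1 * h1

lemma ball_iff {p q n : E2} {r : ℝ} (hn : ‖n‖ = 1) (hr : 0 < r) :
    q ∈ Metric.ball (p + r • n) r ↔ ‖q - p‖ ^ 2 - 2 * r * inner ℝ (q - p) n < 0 := by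
  rw [Metric.mem_ball, dist_eq_norm, ← abs_of_pos hr, ← abs_norm (q - _), ← sq_lt_sq,
    abs_of_pos hr]
  rw [show q - (p + r • n) = (q - p) - r • n by abel, norm_sub_sq_real, inner_smul_right,
    norm_smul, hn, Real.norm_eq_abs, mul_one, sq_abs]
  constructor <;> intro h <;> linarith

lemma taylor2 {f : ℝ → E2} {B : ℝ} (hf : ContDiff ℝ 2 f)
    (hB : ∀ x, ‖deriv (deriv f) x‖ ≤ B) (a b : ℝ) :
    ‖f b - f a - (b - a) • deriv f a‖ ≤ B * (b - a) ^ 2 := by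
  have hd : Differentiable ℝ f := hf.differentiable (by norm_num)
  have hf' : ContDiff ℝ 1 (deriv f) := by
    rw [show (2 : WithTop ℕ∞) = 1 + 1 by norm_num, contDiff_succ_iff_deriv] at hf
    exact hf.2.2
  have hd2 : Differentiable ℝ (deriv f) := hf'.differentiable (by norm_num)
  have hlip : ∀ x y, ‖deriv f y - deriv f x‖ ≤ B * ‖y - x‖ := fun x y =>
    Convex.norm_image_sub_le_of_norm_deriv_le (fun z _ => hd2 z) (fun z _ => hB z) convex_univ
      (mem_univ x) (mem_univ y)
  have hB0 : 0 ≤ B := (norm_nonneg _).trans (hB 0)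
  set G : ℝ → E2 := fun x => f x - x • deriv f a with hG
  have hGd : ∀ x, HasDerivAt G (deriv f x - deriv f a) x := by
    intro x
    have := (hd x).hasDerivAt.sub ((hasDerivAt_id x).smul_const (deriv f a))
    simp only [one_smul] at this
    exact this
  have h := Convex.norm_image_sub_le_of_norm_hasDerivWithin_le (f := G) (C := B * |b - a|)
    (s := uIcc a b) (fun x _ => (hGd x).hasDerivWithinAt) (fun x hx => by
      refine (hlip a x).trans ?_
      gcongr
      rw [Real.norm_eq_abs]
      exact abs_sub_left_of_mem_uIcc hx) (convex_uIcc a b)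
    left_mem_uIcc right_mem_uIcc
  have e : G b - G a = f b - f a - (b - a) • deriv f a := by
    simp only [hG, sub_smul]; abel
  rw [e, Real.norm_eq_abs] at h
  refine h.trans_eq ?_
  rw [mul_assoc, ← sq, sq_abs]

section
variable {ρ1 ρ2 σ grav T A : ℝ}

def TwoFluid.dz (D : TwoFluid ρ1 ρ2 σ grav T A) (α t : ℝ) : E2 := deriv (fun a => D.z a t) α

def TwoFluid.N (D : TwoFluid ρ1 ρ2 σ grav T A) (s α t : ℝ) : E2 :=
  (s * ‖D.dz α t‖⁻¹) • perpv (D.dz α t)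

def TwoFluid.g (D : TwoFluid ρ1 ρ2 σ grav T A) (s r α β t : ℝ) : ℝ :=
  ‖D.z β t - D.z α t‖ ^ 2 - 2 * r * inner ℝ (D.z β t - D.z α t) (D.N s α t)

def TwoFluid.c (D : TwoFluid ρ1 ρ2 σ grav T A) (s r α t : ℝ) : E2 :=
  D.z α t + r • D.N s α t

lemma TwoFluid.dz_pos (D : TwoFluid ρ1 ρ2 σ grav T A) (hA : 1 ≤ A) {t : ℝ}
    (ht : t ∈ Icc (0:ℝ) T) (α : ℝ) : 0 < ‖D.dz α t‖ :=
  lt_of_lt_of_le (by positivity) (D.hz_lower t ht α)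

lemma TwoFluid.dz_ne (D : TwoFluid ρ1 ρ2 σ grav T A) (hA : 1 ≤ A) {t : ℝ}
    (ht : t ∈ Icc (0:ℝ) T) (α : ℝ) : D.dz α t ≠ 0 := norm_pos_iff.1 (D.dz_pos hA ht α)

lemma TwoFluid.N_norm (D : TwoFluid ρ1 ρ2 σ grav T A) (hA : 1 ≤ A) {t : ℝ}
    (ht : t ∈ Icc (0:ℝ) T) {s : ℝ} (hs : |s| = 1) (α : ℝ) : ‖D.N s α t‖ = 1 := by
  have := D.dz_pos hA ht α
  rw [TwoFluid.N, norm_smul, perpv_norm, norm_mul, Real.norm_eq_abs, hs, norm_inv, norm_norm]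
  field_simp

lemma TwoFluid.N_inner (D : TwoFluid ρ1 ρ2 σ grav T A) (s α t : ℝ) :
    inner ℝ (D.N s α t) (D.dz α t) = 0 := by
  rw [TwoFluid.N, inner_smul_left, perpv_inner, mul_zero]

lemma TwoFluid.taylor (D : TwoFluid ρ1 ρ2 σ grav T A) (hT : 0 < T) (hA : 1 ≤ A) {t : ℝ}
    (ht : t ∈ Icc (0:ℝ) T) (α β : ℝ) :
    ‖D.z β t - D.z α t - (β - α) • D.dz α t‖ ≤ 2 * A * (β - α) ^ 2 :=
  taylor2 ((D.z_contDiff ht).of_le (by norm_num)) (fun x => D.ddz_bound hT hA ht x) α β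

lemma TwoFluid.chord_local (D : TwoFluid ρ1 ρ2 σ grav T A) (hT : 0 < T) (hA : 1 ≤ A) {t : ℝ}
    (ht : t ∈ Icc (0:ℝ) T) {α β : ℝ} (h : |β - α| ≤ 1 / (100 * A ^ 2)) :
    (1 / (2 * A)) * |β - α| ≤ ‖D.z β t - D.z α t‖ := by
  have h1 := D.taylor hT hA ht α β
  have h2 : A⁻¹ ≤ ‖D.dz α t‖ := D.hz_lower t ht α
  have h3 : ‖(β - α) • D.dz α t‖ ≤ ‖D.z β t - D.z α t‖ +
      ‖D.z β t - D.z α t - (β - α) • D.dz α t‖ := by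
    have := norm_sub_le (D.z β t - D.z α t) (D.z β t - D.z α t - (β - α) • D.dz α t)
    simpa using this
  rw [norm_smul, Real.norm_eq_abs] at h3
  have h4 : |β - α| * A⁻¹ ≤ |β - α| * ‖D.dz α t‖ := by gcongr
  have h5 : 2 * A * (β - α) ^ 2 ≤ (1 / (2 * A)) * |β - α| := by
    rw [← sq_abs, sq, ← mul_assoc]
    refine mul_le_mul_of_nonneg_right ?_ (abs_nonneg _)
    calc 2 * A * |β - α| ≤ 2 * A * (1 / (100 * A ^ 2)) := by gcongr
      _ ≤ 1 / (2 * A) := by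
        have : A ≠ 0 := by positivity
        rw [show 2 * A * (1 / (100 * A ^ 2)) = (1 / 50) * (1 / A) by field_simp; norm_num,
          show 1 / (2 * A) = (1 / 2) * (1 / A) by field_simp]
        gcongr; norm_num
  have h6 : |β - α| * A⁻¹ = 2 * ((1 / (2 * A)) * |β - α|) := by field_simp
  linarith

lemma TwoFluid.g_local (D : TwoFluid ρ1 ρ2 σ grav T A) (hT : 0 < T) (hA : 1 ≤ A) {t : ℝ}
    (ht : t ∈ Icc (0:ℝ) T) {s r : ℝ} (hs : |s| = 1) (hr0 : 0 ≤ r) (hr : r ≤ 1 / (1000 * A ^ 3))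
    {α β : ℝ} (hne : α ≠ β) (h : |α - β| ≤ 1 / (100 * A ^ 2)) : 0 < D.g s r α β t := by
  rw [abs_sub_comm] at h
  have h1 := D.taylor hT hA ht α β
  have h2 := D.chord_local hT hA ht h
  have hp : 0 < |β - α| := abs_pos.2 (sub_ne_zero.2 hne.symm)
  have h3 : inner ℝ (D.z β t - D.z α t) (D.N s α t) ≤ 2 * A * (β - α) ^ 2 := by
    have e : inner ℝ (D.z β t - D.z α t) (D.N s α t) =
        inner ℝ (D.z β t - D.z α t - (β - α) • D.dz α t) (D.N s α t) := by
      rw [inner_sub_left (D.z β t - D.z α t), inner_smul_left,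
        real_inner_comm, real_inner_comm (D.N s α t) (D.dz α t), D.N_inner]
      simp
    rw [e]
    refine (real_inner_le_norm _ _).trans ?_
    rw [D.N_norm hA ht hs, mul_one]; exact h1
  have h4 : ((1 / (2 * A)) * |β - α|) ^ 2 ≤ ‖D.z β t - D.z α t‖ ^ 2 := by gcongr
  rw [mul_pow, sq_abs] at h4
  have h5 : 2 * r * inner ℝ (D.z β t - D.z α t) (D.N s α t) ≤
      2 * (1 / (1000 * A ^ 3)) * (2 * A * (β - α) ^ 2) := by
    calc _ ≤ 2 * r * (2 * A * (β - α) ^ 2) := by gcongr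
      _ ≤ _ := by gcongr
  have h6 : 2 * (1 / (1000 * A ^ 3)) * (2 * A * (β - α) ^ 2) < (1 / (2 * A)) ^ 2 * (β - α) ^ 2 := by
    have : 0 < (β - α) ^ 2 := by rw [← sq_abs]; positivity
    rw [← mul_assoc]
    refine mul_lt_mul_of_pos_right ?_ this
    rw [show 2 * (1 / (1000 * A ^ 3)) * (2 * A) = (1 / 250) * (1 / A) ^ 2 by field_simp; norm_num,
      show (1 / (2 * A)) ^ 2 = (1 / 4) * (1 / A) ^ 2 by field_simp; norm_num]
    refine mul_lt_mul_of_pos_right (by norm_num) (by positivity)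
  unfold TwoFluid.g
  linarith

lemma TwoFluid.mem_ball_iff (D : TwoFluid ρ1 ρ2 σ grav T A) (hA : 1 ≤ A) {t : ℝ}
    (ht : t ∈ Icc (0:ℝ) T) {s r : ℝ} (hs : |s| = 1) (hr : 0 < r) (α β : ℝ) :
    D.z β t ∈ Metric.ball (D.c s r α t) r ↔ D.g s r α β t < 0 :=
  ball_iff (D.N_norm hA ht hs α) hr

end


lemma open_aux {Ω Ω' : ℝ → Set E2} {z : ℝ → ℝ → E2} {T A t0 : ℝ} (hA : 1 ≤ A)
    (ht0 : t0 ∈ Icc (0:ℝ) T) (ho : ∀ t ∈ Icc (0:ℝ) T, IsOpen (Ω t))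
    (ho' : ∀ t ∈ Icc (0:ℝ) T, IsOpen (Ω' t))
    (hc : IsConnected (Ω t0)) {b : E2} (hb : ∀ t ∈ Icc (0:ℝ) T, b ∈ Ω t)
    (hu : ∀ t ∈ Icc (0:ℝ) T, ∀ x, x ∉ range (fun α => z α t) → x ∈ Ω t ∪ Ω' t)
    (hdis : ∀ t ∈ Icc (0:ℝ) T, Disjoint (Ω t) (Ω' t))
    (hdΓ : ∀ t ∈ Icc (0:ℝ) T, ∀ α, z α t ∉ Ω t)
    (hz : ∀ t ∈ Icc (0:ℝ) T, ∀ s ∈ Icc (0:ℝ) T, ∀ α, ‖z α t - z α s‖ ≤ A * |t - s|)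
    {x0 : E2} (hx0 : x0 ∈ Ω t0) :
    ∃ η > 0, ∀ x ∈ Metric.ball x0 η, ∀ t ∈ Icc (0:ℝ) T, |t - t0| < η → x ∈ Ω t := by
  have hpc := ((ho t0 ht0).isConnected_iff_isPathConnected).1 hc
  obtain ⟨γ, hγ⟩ := hpc.joinedIn x0 hx0 b (hb t0 ht0)
  have hK : IsCompact (range γ) := isCompact_range γ.continuous
  obtain ⟨δ, hδ, hsub⟩ := hK.exists_thickening_subset_open (ho t0 ht0)
    (by rintro _ ⟨s, rfl⟩; exact hγ s)
  have hA1 : (0:ℝ) < A + 1 := by linarith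
  refine ⟨δ / (2 * (A + 1)), by positivity, ?_⟩
  intro x hx t ht htt
  set η := δ / (2 * (A + 1)) with hη
  have hη0 : 0 < η := by positivity
  have e1 : η * (2 * (A + 1)) = δ := by rw [hη]; field_simp
  set K' : Set E2 := range γ ∪ segment ℝ x0 x with hK'
  have hx0γ : x0 ∈ range γ := ⟨0, γ.source⟩
  have hbγ : b ∈ range γ := ⟨1, γ.target⟩
  have hconn : IsPreconnected K' :=
    IsPreconnected.union x0 hx0γ (left_mem_segment ℝ x0 x) (isPreconnected_range γ.continuous)
      (convex_segment x0 x).isPreconnected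
  have hnear : ∀ y ∈ K', ∃ k ∈ range γ, ‖y - k‖ < η := by
    rintro y (hy | hy)
    · exact ⟨y, hy, by simpa using hη0⟩
    · refine ⟨x0, hx0γ, ?_⟩
      have := (convex_ball x0 η).segment_subset (Metric.mem_ball_self hη0) hx hy
      rwa [Metric.mem_ball, dist_eq_norm] at this
  have havoid : ∀ y ∈ K', y ∉ range (fun α => z α t) := by
    rintro y hy ⟨α, rfl⟩
    obtain ⟨k, hk, hk2⟩ := hnear _ hy
    simp only at hk2
    refine hdΓ t0 ht0 α (hsub ?_)
    rw [Metric.mem_thickening_iff]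
    refine ⟨k, hk, ?_⟩
    rw [dist_eq_norm]
    have h1 := hz t0 ht0 t ht α
    have h2 : ‖z α t0 - k‖ ≤ ‖z α t0 - z α t‖ + ‖z α t - k‖ := norm_sub_le_norm_sub_add_norm_sub _ _ _
    rw [abs_sub_comm] at h1
    have h3 : A * |t - t0| ≤ A * η := by gcongr
    nlinarith
  have hsub2 : K' ⊆ Ω t :=
    IsPreconnected.subset_left_of_subset_union (ho t ht) (ho' t ht) (hdis t ht)
      (fun y hy => hu t ht y (havoid y hy)) ⟨b, Or.inl hbγ, hb t ht⟩ hconn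
  exact hsub2 (Or.inr (right_mem_segment ℝ x0 x))

section
variable {ρ1 ρ2 σ grav T A : ℝ}

lemma TwoFluid.not_Γ (D : TwoFluid ρ1 ρ2 σ grav T A) {t : ℝ} (ht : t ∈ Icc (0:ℝ) T) {x : E2}
    (hx : x ∉ range (fun α => D.z α t)) : x ∈ D.Ω1 t ∪ D.Ω2 t := by
  have : x ∈ D.Ω1 t ∪ D.Ω2 t ∪ range (fun α => D.z α t) := by rw [D.hUnion t ht]; trivial
  exact this.resolve_right hx

lemma TwoFluid.z_not1 (D : TwoFluid ρ1 ρ2 σ grav T A) {t : ℝ} (ht : t ∈ Icc (0:ℝ) T) (α : ℝ) :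
    D.z α t ∉ D.Ω1 t := fun h => (D.hDisj1Γ t ht).le_bot ⟨h, α, rfl⟩

lemma TwoFluid.z_not2 (D : TwoFluid ρ1 ρ2 σ grav T A) {t : ℝ} (ht : t ∈ Icc (0:ℝ) T) (α : ℝ) :
    D.z α t ∉ D.Ω2 t := fun h => (D.hDisj2Γ t ht).le_bot ⟨h, α, rfl⟩

lemma TwoFluid.open1 (D : TwoFluid ρ1 ρ2 σ grav T A) (hT : 0 < T) (hA : 1 ≤ A) {t0 : ℝ}
    (ht0 : t0 ∈ Icc (0:ℝ) T) {x0 : E2} (hx0 : x0 ∈ D.Ω1 t0) :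
    ∃ η > 0, ∀ x ∈ Metric.ball x0 η, ∀ t ∈ Icc (0:ℝ) T, |t - t0| < η → x ∈ D.Ω1 t := by
  obtain ⟨a, -, ha⟩ := D.hStrip
  exact open_aux hA ht0 D.hΩ1_open D.hΩ2_open (D.hΩ1_conn t0 ht0) (b := vec2 0 (-a))
    (fun t ht => (ha t ht).1 (by simp [vec2])) (fun t ht x hx => D.not_Γ ht hx) D.hDisj12
    (fun t ht α => D.z_not1 ht α) (fun t ht s hs α => D.z_time hT ht hs α) hx0

lemma TwoFluid.open2 (D : TwoFluid ρ1 ρ2 σ grav T A) (hT : 0 < T) (hA : 1 ≤ A) {t0 : ℝ}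
    (ht0 : t0 ∈ Icc (0:ℝ) T) {x0 : E2} (hx0 : x0 ∈ D.Ω2 t0) :
    ∃ η > 0, ∀ x ∈ Metric.ball x0 η, ∀ t ∈ Icc (0:ℝ) T, |t - t0| < η → x ∈ D.Ω2 t := by
  obtain ⟨a, -, ha⟩ := D.hStrip
  exact open_aux hA ht0 D.hΩ2_open D.hΩ1_open (D.hΩ2_conn t0 ht0) (b := vec2 0 a)
    (fun t ht => (ha t ht).2 (by simp [vec2]))
    (fun t ht x hx => (D.not_Γ ht hx).symm) (fun t ht => (D.hDisj12 t ht).symm)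
    (fun t ht α => D.z_not2 ht α) (fun t ht s hs α => D.z_time hT ht hs α) hx0

lemma TwoFluid.N_cont (D : TwoFluid ρ1 ρ2 σ grav T A) (hT : 0 < T) (hA : 1 ≤ A) (s : ℝ) :
    ContinuousOn (fun p : ℝ × ℝ => D.N s p.1 p.2) (univ ×ˢ Icc (0:ℝ) T) := by
  have h := D.dz_cont hT
  have h2 : ContinuousOn (fun p : ℝ × ℝ => ‖D.dz p.1 p.2‖⁻¹) (univ ×ˢ Icc (0:ℝ) T) :=
    ContinuousOn.inv₀ h.norm (fun p hp => (D.dz_pos hA hp.2 p.1).ne')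
  exact (continuousOn_const.mul h2).smul (perpL.continuous.comp_continuousOn h)

lemma TwoFluid.c_cont (D : TwoFluid ρ1 ρ2 σ grav T A) (hT : 0 < T) (hA : 1 ≤ A) (s : ℝ)
    {r : ℝ → ℝ} (hr : Continuous r) :
    ContinuousOn (fun p : ℝ × ℝ => D.c s (r p.2) p.1 p.2) (univ ×ˢ Icc (0:ℝ) T) :=
  D.z_cont.add ((hr.comp continuous_snd).continuousOn.smul (D.N_cont hT hA s))

lemma TwoFluid.g_cont (D : TwoFluid ρ1 ρ2 σ grav T A) (hT : 0 < T) (hA : 1 ≤ A) (s : ℝ)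
    {r : ℝ → ℝ} (hr : Continuous r) :
    ContinuousOn (fun p : ℝ × ℝ × ℝ => D.g s (r p.2.2) p.1 p.2.1 p.2.2)
      (univ ×ˢ (univ ×ˢ Icc (0:ℝ) T)) := by
  have h1 : ContinuousOn (fun p : ℝ × ℝ × ℝ => D.z p.1 p.2.2) (univ ×ˢ (univ ×ˢ Icc (0:ℝ) T)) :=
    D.z_cont.comp (f := fun p : ℝ × ℝ × ℝ => (p.1, p.2.2)) (by fun_prop)
      (fun p hp => ⟨trivial, hp.2.2⟩)
  have h2 : ContinuousOn (fun p : ℝ × ℝ × ℝ => D.z p.2.1 p.2.2) (univ ×ˢ (univ ×ˢ Icc (0:ℝ) T)) :=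
    D.z_cont.comp (f := fun p : ℝ × ℝ × ℝ => (p.2.1, p.2.2)) (by fun_prop)
      (fun p hp => ⟨trivial, hp.2.2⟩)
  have h3 : ContinuousOn (fun p : ℝ × ℝ × ℝ => D.N s p.1 p.2.2) (univ ×ˢ (univ ×ˢ Icc (0:ℝ) T)) :=
    (D.N_cont hT hA s).comp (f := fun p : ℝ × ℝ × ℝ => (p.1, p.2.2)) (by fun_prop)
      (fun p hp => ⟨trivial, hp.2.2⟩)
  have h4 : ContinuousOn (fun p : ℝ × ℝ × ℝ => r p.2.2) (univ ×ˢ (univ ×ˢ Icc (0:ℝ) T)) :=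
    (hr.comp (by fun_prop)).continuousOn
  exact ((h2.sub h1).norm.pow 2).sub ((continuousOn_const.mul h4).mul (((h2.sub h1).inner h3)))

lemma TwoFluid.z_shift (D : TwoFluid ρ1 ρ2 σ grav T A) {t : ℝ} (ht : t ∈ Icc (0:ℝ) T) (n : ℤ) :
    ∀ α : ℝ, D.z (α + n * (2 * Real.pi)) t = D.z α t + (n : ℝ) • transl := by
  induction n using Int.induction_on with
  | zero => intro α; simp
  | succ k ih =>
    intro α
    have := D.hper_z t ht (α + k * (2 * Real.pi))
    push_cast at ih ⊢
    rw [show α + ((k:ℝ) + 1) * (2 * Real.pi) = α + k * (2 * Real.pi) + 2 * Real.pi by ring, this,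
      ih, add_smul, one_smul, add_assoc]
  | pred k ih =>
    intro α
    have := D.hper_z t ht (α + (-(k:ℝ) - 1) * (2 * Real.pi))
    push_cast at ih ⊢
    rw [show α + (-(k:ℝ) - 1) * (2 * Real.pi) + 2 * Real.pi = α + (-(k:ℝ)) * (2 * Real.pi) by ring,
      ih] at this
    rw [sub_smul, one_smul, ← add_sub_assoc, this]; abel

lemma TwoFluid.dz_shift (D : TwoFluid ρ1 ρ2 σ grav T A) {t : ℝ} (ht : t ∈ Icc (0:ℝ) T) (n : ℤ)
    (α : ℝ) : D.dz (α + n * (2 * Real.pi)) t = D.dz α t := by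
  have h1 := (D.z_hasDeriv ht (α + n * (2 * Real.pi))).comp_add_const α (n * (2 * Real.pi))
  have h2 : (fun x => D.z (x + n * (2 * Real.pi)) t) = fun x => D.z x t + (n : ℝ) • transl := by
    funext x; exact D.z_shift ht n x
  rw [h2] at h1
  exact h1.unique ((D.z_hasDeriv ht α).add_const _)

lemma TwoFluid.g_shift (D : TwoFluid ρ1 ρ2 σ grav T A) {t : ℝ} (ht : t ∈ Icc (0:ℝ) T) (n : ℤ)
    (s r α β : ℝ) :
    D.g s r (α + n * (2 * Real.pi)) (β + n * (2 * Real.pi)) t = D.g s r α β t := by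
  simp only [TwoFluid.g, TwoFluid.N, D.z_shift ht, D.dz_shift ht, add_sub_add_right_eq_sub]

lemma TwoFluid.z_far (D : TwoFluid ρ1 ρ2 σ grav T A) {t : ℝ} (ht : t ∈ Icc (0:ℝ) T) (α β : ℝ) :
    |β - α| - 2 * A ≤ ‖D.z β t - D.z α t‖ := by
  have h1 := D.z_near ht α
  have h2 := D.z_near ht β
  have h3 : ‖(β - α) • xvec‖ ≤ ‖D.z β t - D.z α t‖ + ‖D.z α t - α • xvec‖ + ‖D.z β t - β • xvec‖ := by
    have : (β - α) • xvec = (D.z β t - D.z α t) + (D.z α t - α • xvec) - (D.z β t - β • xvec) := by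
      rw [sub_smul]; abel
    rw [this]
    exact (norm_sub_le _ _).trans (by gcongr; exact norm_add_le _ _)
  rw [norm_smul, norm_xvec, Real.norm_eq_abs, mul_one] at h3
  linarith

lemma TwoFluid.ball_dich (D : TwoFluid ρ1 ρ2 σ grav T A) {t : ℝ} (ht : t ∈ Icc (0:ℝ) T) {S : Set E2}
    (hS : IsPreconnected S) (hΓ : ∀ α, D.z α t ∉ S) : S ⊆ D.Ω1 t ∨ S ⊆ D.Ω2 t := by
  have hsub : S ⊆ D.Ω1 t ∪ D.Ω2 t := by
    intro x hx
    refine D.not_Γ ht ?_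
    rintro ⟨α, rfl⟩
    exact hΓ α hx
  rcases S.eq_empty_or_nonempty with rfl | ⟨x, hx⟩
  · left; exact empty_subset _
  · rcases hsub hx with h | h
    · left
      exact hS.subset_left_of_subset_union (D.hΩ1_open t ht) (D.hΩ2_open t ht) (D.hDisj12 t ht)
        hsub ⟨x, hx, h⟩
    · right
      exact hS.subset_right_of_subset_union (D.hΩ1_open t ht) (D.hΩ2_open t ht) (D.hDisj12 t ht)
        hsub ⟨x, hx, h⟩

lemma TwoFluid.not_both (D : TwoFluid ρ1 ρ2 σ grav T A) {t : ℝ} (ht : t ∈ Icc (0:ℝ) T) {x : E2}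
    (h1 : x ∈ D.Ω1 t) (h2 : x ∈ D.Ω2 t) : False := (D.hDisj12 t ht).le_bot ⟨h1, h2⟩

end


def rr (A t : ℝ) : ℝ := 1 / (1000 * A ^ 3) * Real.exp (-(A ^ 2 + 1) * t)

lemma rr_cont (A : ℝ) : Continuous (rr A) := by unfold rr; fun_prop
lemma rr_pos {A : ℝ} (hA : 1 ≤ A) (t : ℝ) : 0 < rr A t := by unfold rr; positivity
lemma rr_le {A : ℝ} (hA : 1 ≤ A) {t : ℝ} (ht : 0 ≤ t) : rr A t ≤ 1 / (1000 * A ^ 3) := by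
  unfold rr
  refine mul_le_of_le_one_right (by positivity) ?_
  rw [Real.exp_le_one_iff]
  nlinarith [sq_nonneg A]
lemma rr_deriv (A t : ℝ) : HasDerivAt (rr A) (-(A ^ 2 + 1) * rr A t) t := by
  unfold rr
  have h := ((hasDerivAt_id t).const_mul (-(A ^ 2 + 1))).exp.const_mul (1 / (1000 * A ^ 3))
  exact h.congr_deriv (by simp only [id, mul_one]; ring)

section
variable {ρ1 ρ2 σ grav T A : ℝ}

def TwoFluid.Good (D : TwoFluid ρ1 ρ2 σ grav T A) (s t : ℝ) : Prop :=
  ∀ α β : ℝ, 1 / (100 * A ^ 2) ≤ |α - β| → 0 < D.g s (rr A t) α β t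

lemma TwoFluid.good_all (D : TwoFluid ρ1 ρ2 σ grav T A) (hT : 0 < T) (hA : 1 ≤ A) {t : ℝ}
    (ht : t ∈ Icc (0:ℝ) T) {s : ℝ} (hs : |s| = 1) (hg : D.Good s t) {α β : ℝ} (hne : α ≠ β) :
    0 < D.g s (rr A t) α β t := by
  rcases le_total (1 / (100 * A ^ 2)) |α - β| with h | h
  · exact hg α β h
  · exact D.g_local hT hA ht hs (rr_pos hA t).le (rr_le hA ht.1) hne h

lemma TwoFluid.good_ball (D : TwoFluid ρ1 ρ2 σ grav T A) (hT : 0 < T) (hA : 1 ≤ A) {t : ℝ}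
    (ht : t ∈ Icc (0:ℝ) T) {s : ℝ} (hs : |s| = 1) (hg : D.Good s t) (α γ : ℝ) :
    D.z γ t ∉ Metric.ball (D.c s (rr A t) α t) (rr A t) := by
  rw [D.mem_ball_iff hA ht hs (rr_pos hA t), not_lt]
  by_cases h : α = γ
  · subst h; simp [TwoFluid.g]
  · exact (D.good_all hT hA ht hs hg h).le

lemma TwoFluid.good_zero (D : TwoFluid ρ1 ρ2 σ grav T A) (hT : 0 < T) (hA : 1 ≤ A) {s : ℝ}
    (hs : |s| = 1) : D.Good s 0 := by
  intro α β h
  have ht : (0:ℝ) ∈ Icc (0:ℝ) T := ⟨le_rfl, hT.le⟩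
  have hp : 0 < |α - β| := lt_of_lt_of_le (by positivity) h
  have hne : α ≠ β := by
    rintro rfl; simp at hp
  have h0 := D.hchord0 α β
  rw [chordArcT, if_neg hne, le_div_iff₀ hp] at h0
  have h1 : A⁻¹ * (1 / (100 * A ^ 2)) ≤ ‖D.z α 0 - D.z β 0‖ :=
    le_trans (by gcongr) h0
  rw [norm_sub_rev] at h1
  have h2 : A⁻¹ * (1 / (100 * A ^ 2)) = 10 * (1 / (1000 * A ^ 3)) := by field_simp; norm_num
  have h3 := rr_le hA (le_refl (0:ℝ))
  have h4 := rr_pos hA 0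
  have h5 := real_inner_le_norm (D.z β 0 - D.z α 0) (D.N s α 0)
  rw [D.N_norm hA ht hs, mul_one] at h5
  unfold TwoFluid.g
  set X := ‖D.z β 0 - D.z α 0‖
  have hX : 10 * rr A 0 ≤ X := by linarith
  have : 2 * rr A 0 * inner ℝ (D.z β 0 - D.z α 0) (D.N s α 0) ≤ 2 * rr A 0 * X := by gcongr
  nlinarith

lemma TwoFluid.sign_zero (D : TwoFluid ρ1 ρ2 σ grav T A) (hT : 0 < T) (hA : 1 ≤ A) :
    ∃ s : ℝ, |s| = 1 ∧ ∀ α, Metric.ball (D.c s (rr A 0) α 0) (rr A 0) ⊆ D.Ω1 0 := by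
  have ht : (0:ℝ) ∈ Icc (0:ℝ) T := ⟨le_rfl, hT.le⟩
  have hr := rr_pos hA 0
  have key : ∃ s : ℝ, |s| = 1 ∧ ∃ γ, D.c s (rr A 0) γ 0 ∈ D.Ω1 0 := by
    have hfr : D.z 0 0 ∈ frontier (D.Ω1 0) := by rw [D.hFront1 0 ht]; exact ⟨0, rfl⟩
    obtain ⟨x, hx, hxd⟩ := Metric.mem_closure_iff.1 hfr.1 (rr A 0) hr
    have hcl : IsClosed (range (fun α => D.z α 0)) := by
      rw [← D.hFront1 0 ht]; exact isClosed_frontier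
    obtain ⟨y, ⟨γ, rfl⟩, hy⟩ := hcl.exists_infDist_eq_dist ⟨D.z 0 0, 0, rfl⟩ x
    simp only at hy
    have hmin : ∀ β, ‖x - D.z γ 0‖ ^ 2 ≤ ‖x - D.z β 0‖ ^ 2 := by
      intro β
      have := Metric.infDist_le_dist_of_mem (x := x) (show D.z β 0 ∈ range (fun α => D.z α 0) from ⟨β, rfl⟩)
      rw [hy, dist_eq_norm, dist_eq_norm] at this
      gcongr
    have hder : HasDerivAt (fun β => ‖x - D.z β 0‖ ^ 2)
        (2 * inner ℝ (x - D.z γ 0) (-(D.dz γ 0))) γ := by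
      have := ((D.z_hasDeriv ht γ).const_sub x).norm_sq
      exact this
    have hz : 2 * inner ℝ (x - D.z γ 0) (-(D.dz γ 0)) = 0 :=
      IsLocalMin.hasDerivAt_eq_zero (Eventually.of_forall hmin) hder
    have hperp : inner ℝ (x - D.z γ 0) (D.dz γ 0) = 0 := by
      rw [inner_neg_right] at hz; linarith
    have hdist : ‖x - D.z γ 0‖ < rr A 0 := by
      have := Metric.infDist_le_dist_of_mem (x := x) (show D.z 0 0 ∈ range (fun α => D.z α 0) from ⟨0, rfl⟩)
      rw [hy, dist_eq_norm] at this
      rw [dist_comm] at hxd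
      linarith
    have hxne : x - D.z γ 0 ≠ 0 := by
      intro h
      rw [sub_eq_zero] at h
      exact D.z_not1 ht γ (h ▸ hx)
    have main : ∀ s : ℝ, |s| = 1 → 0 < inner ℝ (x - D.z γ 0) (D.N s γ 0) →
        ∃ s : ℝ, |s| = 1 ∧ ∃ γ, D.c s (rr A 0) γ 0 ∈ D.Ω1 0 := by
      intro s hs hpos
      refine ⟨s, hs, γ, ?_⟩
      have hd := decomp (D.N_norm hA ht hs γ) (D.dz_ne hA ht γ) (D.N_inner s γ 0) hperp
      set k : ℝ := inner ℝ (x - D.z γ 0) (D.N s γ 0) with hk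
      have hnk : ‖x - D.z γ 0‖ = k := by
        rw [hd, norm_smul, D.N_norm hA ht hs, mul_one, Real.norm_eq_abs, abs_of_pos hpos]
      have hxball : x ∈ Metric.ball (D.c s (rr A 0) γ 0) (rr A 0) := by
        unfold TwoFluid.c
        rw [ball_iff (D.N_norm hA ht hs γ) hr, hnk, ← hk]
        rw [hnk] at hdist
        nlinarith
      rcases D.ball_dich ht (convex_ball _ _).isPreconnected
        (fun β => D.good_ball hT hA ht hs (D.good_zero hT hA hs) γ β) with h | h
      · exact h (Metric.mem_ball_self hr)
      · exact (D.not_both ht hx (h hxball)).elim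
    have hNneg : D.N (-1) γ 0 = - D.N 1 γ 0 := by simp [TwoFluid.N]
    have h1 : |(1:ℝ)| = 1 := by norm_num
    have hd := decomp (D.N_norm hA ht h1 γ) (D.dz_ne hA ht γ) (D.N_inner 1 γ 0) hperp
    rcases lt_trichotomy (inner ℝ (x - D.z γ 0) (D.N 1 γ 0)) 0 with h | h | h
    · refine main (-1) (by norm_num) ?_
      rw [hNneg, inner_neg_right]; linarith
    · rw [h, zero_smul] at hd
      exact absurd hd hxne
    · exact main 1 h1 h
  obtain ⟨s, hs, γ, hγ⟩ := key
  refine ⟨s, hs, fun α => ?_⟩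
  have hg := D.good_zero hT hA hs
  have hcont : Continuous (fun α => D.c s (rr A 0) α 0) := by
    rw [← continuousOn_univ]
    exact (D.c_cont hT hA s (rr_cont A)).comp (f := fun α : ℝ => (α, (0:ℝ))) (by fun_prop)
      (fun p _ => ⟨trivial, ht⟩)
  have hall : range (fun α => D.c s (rr A 0) α 0) ⊆ D.Ω1 0 := by
    rcases D.ball_dich ht (isPreconnected_range hcont) (by
      rintro β ⟨α, hα⟩
      simp only at hα
      refine D.good_ball hT hA ht hs hg α β ?_
      rw [← hα]
      exact Metric.mem_ball_self hr) with h | h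
    · exact h
    · exact (D.not_both ht hγ (h ⟨γ, rfl⟩)).elim
  rcases D.ball_dich ht (convex_ball _ _).isPreconnected
        (fun β => D.good_ball hT hA ht hs hg α β) with h | h
  · exact h
  · exact (D.not_both ht (hall ⟨α, rfl⟩) (h (Metric.mem_ball_self hr))).elim

def TwoFluid.Balls (D : TwoFluid ρ1 ρ2 σ grav T A) (s t : ℝ) : Prop :=
  ∀ α, Metric.ball (D.c s (rr A t) α t) (rr A t) ⊆ D.Ω1 t

open Classical in
lemma TwoFluid.balls_of_good (D : TwoFluid ρ1 ρ2 σ grav T A) (hT : 0 < T) (hA : 1 ≤ A) {s : ℝ}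
    (hs : |s| = 1) {t0 : ℝ} (ht0T : t0 ≤ T) (h0 : D.Balls s 0)
    (hg : ∀ t ∈ Ico 0 t0, D.Good s t) : ∀ t ∈ Ico 0 t0, D.Balls s t := by
  intro t1 ht1 α
  have hI : ∀ t ∈ Ico 0 t0, t ∈ Icc (0:ℝ) T := fun t ht => ⟨ht.1, by linarith [ht.2]⟩
  have hmem : ∀ t ∈ Ico 0 t0, D.c s (rr A t) α t ∈ D.Ω1 t ∪ D.Ω2 t := by
    intro t ht
    refine D.not_Γ (hI t ht) ?_
    rintro ⟨β, hβ⟩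
    simp only at hβ
    refine D.good_ball hT hA (hI t ht) hs (hg t ht) α β ?_
    rw [hβ]
    exact Metric.mem_ball_self (rr_pos hA t)
  have hcc : ContinuousOn (fun t => D.c s (rr A t) α t) (Ico 0 t0) :=
    (D.c_cont hT hA s (rr_cont A)).comp (f := fun t : ℝ => (α, t)) (by fun_prop)
      (fun p hp => ⟨trivial, hI p hp⟩)
  set f : ℝ → Bool := fun t => decide (D.c s (rr A t) α t ∈ D.Ω1 t) with hf
  have hfc : ContinuousOn f (Ico 0 t0) := by
    intro t ht
    have hev : f =ᶠ[nhdsWithin t (Ico 0 t0)] fun _ => f t := by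
      rcases hmem t ht with h | h
      · obtain ⟨η, hη, hη2⟩ := D.open1 hT hA (hI t ht) h
        have h1 := (hcc t ht) (Metric.ball_mem_nhds _ hη)
        have h2 : ∀ᶠ t' in nhdsWithin t (Ico 0 t0), |t' - t| < η :=
          mem_nhdsWithin_of_mem_nhds (Metric.ball_mem_nhds t hη)
        filter_upwards [h1, h2, self_mem_nhdsWithin] with t' a1 a2 a3
        have : D.c s (rr A t') α t' ∈ D.Ω1 t' := hη2 _ a1 t' (hI t' a3) a2
        simp [hf, this, h]
      · obtain ⟨η, hη, hη2⟩ := D.open2 hT hA (hI t ht) h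
        have h1 := (hcc t ht) (Metric.ball_mem_nhds _ hη)
        have h2 : ∀ᶠ t' in nhdsWithin t (Ico 0 t0), |t' - t| < η :=
          mem_nhdsWithin_of_mem_nhds (Metric.ball_mem_nhds t hη)
        filter_upwards [h1, h2, self_mem_nhdsWithin] with t' a1 a2 a3
        have b1 : D.c s (rr A t') α t' ∈ D.Ω2 t' := hη2 _ a1 t' (hI t' a3) a2
        have b2 : D.c s (rr A t') α t' ∉ D.Ω1 t' := fun h => D.not_both (hI t' a3) h b1
        have b3 : D.c s (rr A t) α t ∉ D.Ω1 t := fun h' => D.not_both (hI t ht) h' h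
        simp [hf, b2, b3]
    exact (continuousWithinAt_const (b := f t)).congr_of_eventuallyEq hev rfl
  have hconst := isPreconnected_Ico.constant hfc ht1 (⟨le_rfl, ht1.1.trans_lt ht1.2⟩ : (0:ℝ) ∈ Ico 0 t0)
  have hc0 : D.c s (rr A 0) α 0 ∈ D.Ω1 0 := h0 α (Metric.mem_ball_self (rr_pos hA 0))
  have hc1 : D.c s (rr A t1) α t1 ∈ D.Ω1 t1 := by
    have : f 0 = true := by simp [hf, hc0]
    rw [this] at hconst
    simpa [hf] using hconst
  rcases D.ball_dich (hI t1 ht1) (convex_ball _ _).isPreconnected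
        (fun β => D.good_ball hT hA (hI t1 ht1) hs (hg t1 ht1) α β) with h | h
  · exact h
  · exact (D.not_both (hI t1 ht1) hc1 (h (Metric.mem_ball_self (rr_pos hA t1)))).elim

lemma TwoFluid.balls_limit (D : TwoFluid ρ1 ρ2 σ grav T A) (hT : 0 < T) (hA : 1 ≤ A) {s : ℝ}
    {t0 : ℝ} (ht0 : 0 < t0) (ht0T : t0 ≤ T)
    (hb : ∀ t ∈ Ico 0 t0, D.Balls s t) : D.Balls s t0 := by
  have hI : t0 ∈ Icc (0:ℝ) T := ⟨ht0.le, ht0T⟩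
  intro α
  have hno : ∀ y ∈ Metric.ball (D.c s (rr A t0) α t0) (rr A t0), y ∉ D.Ω2 t0 := by
    intro y hy hy2
    obtain ⟨η, hη, hη2⟩ := D.open2 hT hA hI hy2
    have hcc : ContinuousOn (fun t => D.c s (rr A t) α t) (Icc 0 T) :=
      (D.c_cont hT hA s (rr_cont A)).comp (f := fun t : ℝ => (α, t)) (by fun_prop)
        (fun p hp => ⟨trivial, hp⟩)
    have hd : ContinuousOn (fun t => rr A t - dist y (D.c s (rr A t) α t)) (Ico 0 t0 ∪ {t0}) := by
      refine ContinuousOn.mono ?_ (t := Ico 0 t0 ∪ {t0}) (s := Icc 0 T) ?_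
      · exact (rr_cont A).continuousOn.sub ((continuous_const.dist continuous_id : Continuous (fun q : E2 => dist y q)).comp_continuousOn hcc)
      · rintro x (hx | hx)
        · exact ⟨hx.1, by linarith [hx.2]⟩
        · rw [mem_singleton_iff.1 hx]; exact hI
    have h1 := (hd t0 (Or.inr rfl)).mono_left (nhdsWithin_mono t0 (subset_union_left (t := {t0})))
    have h2 : 0 < rr A t0 - dist y (D.c s (rr A t0) α t0) := by
      rw [Metric.mem_ball] at hy; linarith
    have h3 := h1.eventually (lt_mem_nhds h2)
    have h4 : ∀ᶠ t' in nhdsWithin t0 (Ico 0 t0), |t' - t0| < η :=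
          mem_nhdsWithin_of_mem_nhds (Metric.ball_mem_nhds t0 hη)
    have hne : (nhdsWithin t0 (Ico 0 t0)).NeBot := by
      rw [← mem_closure_iff_nhdsWithin_neBot, closure_Ico ht0.ne]
      exact ⟨ht0.le, le_rfl⟩
    obtain ⟨t', a1, a2, a3⟩ := (h3.and (h4.and self_mem_nhdsWithin)).exists
    have hI' : t' ∈ Icc (0:ℝ) T := ⟨a3.1, by linarith [a3.2]⟩
    refine D.not_both hI' (hb t' a3 α ?_) (hη2 y (Metric.mem_ball_self hη) t' hI' a2)
    rw [Metric.mem_ball]; linarith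
  intro x hx
  by_contra hx1
  by_cases hΓ : x ∈ range (fun α => D.z α t0)
  · rw [← D.hFront2 t0 hI] at hΓ
    obtain ⟨y, hy1, hy2⟩ := mem_closure_iff.1 hΓ.1 _ Metric.isOpen_ball hx
    exact hno y hy1 hy2
  · exact hno x hx ((D.not_Γ hI hΓ).resolve_left hx1)

end


section
variable {ρ1 ρ2 σ grav T A : ℝ}

lemma TwoFluid.z_proper (D : TwoFluid ρ1 ρ2 σ grav T A) {t : ℝ} (ht : t ∈ Icc (0:ℝ) T) :
    IsProperMap (fun α => D.z α t) := by
  rw [isProperMap_iff_tendsto_cocompact]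
  refine ⟨(D.z_contDiff ht).continuous, ?_⟩
  rw [← Metric.cobounded_eq_cocompact (α := E2), ← tendsto_norm_atTop_iff_cobounded]
  have h1 : Tendsto (fun α : ℝ => ‖α‖ - A) (cocompact ℝ) atTop :=
    tendsto_atTop_add_const_right _ _ (tendsto_norm_cocompact_atTop)
  refine tendsto_atTop_mono (fun α => ?_) h1
  have h2 := D.z_near ht α
  have h3 : ‖α • xvec‖ = ‖α‖ := by rw [norm_smul, norm_xvec, mul_one]
  have h4 := norm_sub_norm_le (α • xvec) (D.z α t)
  rw [norm_sub_rev] at h4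
  linarith

lemma xvec_0 : xvec 0 = 1 := by simp [xvec]
lemma xvec_1 : xvec 1 = 0 := by simp [xvec]
lemma vec2_0 (x y : ℝ) : vec2 x y 0 = x := by simp [vec2]
lemma vec2_1 (x y : ℝ) : vec2 x y 1 = y := by simp [vec2]
lemma abs0_le (x : E2) : |x 0| ≤ ‖x‖ := PiLp.norm_apply_le x 0
lemma abs1_le (x : E2) : |x 1| ≤ ‖x‖ := PiLp.norm_apply_le x 1

lemma TwoFluid.no_pinch (D : TwoFluid ρ1 ρ2 σ grav T A) {t : ℝ} (ht : t ∈ Icc (0:ℝ) T)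
    {α β γ0 : ℝ} (hab : α < β) (hp : D.z α t = D.z β t)
    (h0 : ∀ γ, γ ≤ α ∨ β ≤ γ → D.z γ t ≠ D.z γ0 t) : False := by
  have hzc : Continuous (fun α => D.z α t) := (D.z_contDiff ht).continuous
  set Γ' : Set E2 := (fun α => D.z α t) '' (Iic α ∪ Ici β) with hΓ'
  have hcl : IsClosed Γ' := (D.z_proper ht).isClosedMap _ (isClosed_Iic.union isClosed_Ici)
  have hnot : D.z γ0 t ∈ Γ'ᶜ := by
    rintro ⟨γ, hγ, h⟩
    exact h0 γ hγ h
  obtain ⟨η, hη, hB⟩ := Metric.isOpen_iff.1 hcl.isOpen_compl _ hnot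
  obtain ⟨a, ha1, ha⟩ := D.hStrip
  have hf1 : D.z γ0 t ∈ closure (D.Ω1 t) := by
    have : D.z γ0 t ∈ frontier (D.Ω1 t) := by rw [D.hFront1 t ht]; exact ⟨γ0, rfl⟩
    exact this.1
  have hf2 : D.z γ0 t ∈ closure (D.Ω2 t) := by
    have : D.z γ0 t ∈ frontier (D.Ω2 t) := by rw [D.hFront2 t ht]; exact ⟨γ0, rfl⟩
    exact this.1
  obtain ⟨p1, hp1, hd1⟩ := Metric.mem_closure_iff.1 hf1 η hη
  obtain ⟨p2, hp2, hd2⟩ := Metric.mem_closure_iff.1 hf2 η hη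
  set B := Metric.ball (D.z γ0 t) η with hBdef
  have hBp : IsPathConnected B := (convex_ball _ _).isPathConnected ⟨_, Metric.mem_ball_self hη⟩
  have hO1 : IsPathConnected (D.Ω1 t) :=
    ((D.hΩ1_open t ht).isConnected_iff_isPathConnected).1 (D.hΩ1_conn t ht)
  have hO2 : IsPathConnected (D.Ω2 t) :=
    ((D.hΩ2_open t ht).isConnected_iff_isPathConnected).1 (D.hΩ2_conn t ht)
  have hU1 : IsPathConnected (D.Ω1 t ∪ B) := hO1.union hBp ⟨p1, hp1, by
    rw [hBdef, Metric.mem_ball, dist_comm]; exact hd1⟩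
  have hU : IsPathConnected (D.Ω1 t ∪ B ∪ D.Ω2 t) := hU1.union hO2 ⟨p2, Or.inr (by
    rw [hBdef, Metric.mem_ball, dist_comm]; exact hd2), hp2⟩
  set a' := max a (A + 1) with ha'
  have hx : vec2 0 (-a') ∈ D.Ω1 t := (ha t ht).1 (by
    change vec2 0 (-a') 1 ≤ -a
    rw [vec2_1]; linarith [le_max_left a (A + 1)])
  have hy : vec2 0 a' ∈ D.Ω2 t := (ha t ht).2 (by
    change a ≤ vec2 0 a' 1
    rw [vec2_1]; exact le_max_left a (A + 1))
  obtain ⟨P, hP⟩ := hU.joinedIn (vec2 0 (-a')) (Or.inl (Or.inl hx)) (vec2 0 a') (Or.inr hy)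
  have hext : ∀ s, P.extend s ∈ D.Ω1 t ∪ B ∪ D.Ω2 t := by
    intro s
    have : P.extend s ∈ range P := by rw [← Path.extend_range]; exact ⟨s, rfl⟩
    obtain ⟨x, hx⟩ := this
    rw [← hx]; exact hP x
  have hbd : ∃ K, ∀ s, |P.extend s 0| ≤ K := by
    have hc : IsCompact (range P) := isCompact_range P.continuous
    obtain ⟨K, hK⟩ := hc.isBounded.exists_norm_le
    refine ⟨K, fun s => ?_⟩
    have : P.extend s ∈ range P := by rw [← Path.extend_range]; exact ⟨s, rfl⟩
    exact (abs0_le _).trans (hK _ this)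
  obtain ⟨K, hK⟩ := hbd
  have hK0 : 0 ≤ K := (abs_nonneg _).trans (hK 0)
  set Q : ℝ → E2 := fun γ => if γ ≤ α then D.z γ t else D.z (γ + (β - α)) t with hQ
  have hQc : Continuous Q := by
    refine Continuous.if_le hzc (hzc.comp (by fun_prop : Continuous fun γ : ℝ => γ + (β - α))) continuous_id
      continuous_const ?_
    intro x hx
    subst hx
    simp [hp]
  have hQm : ∀ γ, Q γ ∈ Γ' := by
    intro γ
    by_cases h : γ ≤ α
    · simp only [hQ, if_pos h]; exact ⟨γ, Or.inl h, rfl⟩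
    · simp only [hQ, if_neg h]; exact ⟨γ + (β - α), Or.inr (by simp only [mem_Ici]; linarith), rfl⟩
  have hz1 : ∀ γ, |D.z γ t 1| ≤ A := by
    intro γ
    have := (abs1_le _).trans (D.z_near ht γ)
    simpa [xvec_1] using this
  have hz0 : ∀ γ, |D.z γ t 0 - γ| ≤ A := by
    intro γ
    have := (abs0_le _).trans (D.z_near ht γ)
    simpa [xvec_0] using this
  have hQ1 : ∀ γ, |Q γ 1| ≤ A := by
    intro γ
    by_cases h : γ ≤ α
    · simp only [hQ, if_pos h]; exact hz1 _
    · simp only [hQ, if_neg h]; exact hz1 _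
  set M := K + A + 1 + |α| with hM
  have hA' := (abs_nonneg _).trans (hz0 0)
  have hphi0 : ∀ x : E2, (phi.symm x).re = x 0 := fun x => by rw [← phi_0, phi.apply_symm_apply]
  have hphi1 : ∀ x : E2, (phi.symm x).im = x 1 := fun x => by rw [← phi_1, phi.apply_symm_apply]
  obtain ⟨s, τ, hst⟩ := crossing (p := fun s => phi.symm (P.extend s))
    (q := fun τ => phi.symm (Q (-M + 2 * M * τ)))
    (phi.symm.continuous.comp P.continuous_extend)
    (phi.symm.continuous.comp (hQc.comp (by fun_prop))) (by
      intro s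
      simp only [hphi0]
      have h1 : (-M + 2 * M * 0) ≤ α := by linarith [neg_abs_le α]
      simp only [hQ, if_pos h1]
      have := abs_le.1 (hz0 (-M + 2 * M * 0))
      have h2 := abs_le.1 (hK s)
      linarith [abs_nonneg α]) (by
      intro s
      simp only [hphi0]
      have h1 : ¬ (-M + 2 * M * 1) ≤ α := by linarith [le_abs_self α]
      simp only [hQ, if_neg h1]
      have := abs_le.1 (hz0 (-M + 2 * M * 1 + (β - α)))
      have h2 := abs_le.1 (hK s)
      linarith [abs_nonneg α]) (by
      intro τ
      simp only [hphi1, Path.extend_zero, vec2_1]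
      have := abs_le.1 (hQ1 (-M + 2 * M * τ))
      linarith [le_max_right a (A + 1)]) (by
      intro τ
      simp only [hphi1, Path.extend_one, vec2_1]
      have := abs_le.1 (hQ1 (-M + 2 * M * τ))
      linarith [le_max_right a (A + 1)])
  have heq := phi.symm.injective hst
  have h1 := hext s
  rw [heq] at h1
  have h2 := hQm (-M + 2 * M * τ)
  rcases h1 with (h1 | h1) | h1
  · obtain ⟨γ, -, hγ⟩ := h2
    exact D.z_not1 ht γ (by rw [← hγ] at h1; exact h1)
  · exact hB h1 h2
  · obtain ⟨γ, -, hγ⟩ := h2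
    exact D.z_not2 ht γ (by rw [← hγ] at h1; exact h1)

end


section
variable {ρ1 ρ2 σ grav T A : ℝ}

lemma TwoFluid.N_pm (D : TwoFluid ρ1 ρ2 σ grav T A) (hA : 1 ≤ A) {t : ℝ}
    (ht : t ∈ Icc (0:ℝ) T) {s : ℝ} (hs : |s| = 1) {α β : ℝ}
    (h : inner ℝ (D.N s α t) (D.dz β t) = 0) :
    D.N s β t = D.N s α t ∨ D.N s β t = - D.N s α t := by
  have hd := decomp (D.N_norm hA ht hs α) (D.dz_ne hA ht β) h (D.N_inner s β t)
  set k : ℝ := inner ℝ (D.N s β t) (D.N s α t)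
  have h1 := congrArg norm hd
  rw [norm_smul, D.N_norm hA ht hs, D.N_norm hA ht hs, mul_one, Real.norm_eq_abs] at h1
  rcases eq_or_eq_neg_of_abs_eq h1.symm with h2 | h2
  · left; rw [hd, h2, one_smul]
  · right; rw [hd, h2, neg_one_smul]

lemma TwoFluid.plus (D : TwoFluid ρ1 ρ2 σ grav T A) (hT : 0 < T) (hA : 1 ≤ A) {s : ℝ}
    (hs : |s| = 1) {t0 : ℝ} (ht0 : 0 < t0) (ht0T : t0 ≤ T) (hg : ∀ t ∈ Ico 0 t0, D.Good s t)
    {α β : ℝ} (hne : α ≠ β) (hz : D.z α t0 = D.z β t0) (hN : D.N s β t0 = D.N s α t0) : False := by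
  have hI : t0 ∈ Icc (0:ℝ) T := ⟨ht0.le, ht0T⟩
  have hApos : 0 < A := by linarith
  set c : ℝ := inner ℝ (D.dz α t0) (D.dz β t0) with hc
  have hc0 : c ≠ 0 := by
    intro h
    have h1 : inner ℝ (D.N s α t0) (D.dz β t0) = 0 := by rw [← hN]; exact D.N_inner s β t0
    have h2 := decomp (D.N_norm hA hI hs α) (D.dz_ne hA hI α) (D.N_inner s α t0)
      (x := D.dz β t0) (by rw [real_inner_comm]; exact h)
    rw [real_inner_comm, h1, zero_smul] at h2
    exact D.dz_ne hA hI β h2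
  have hzβ : ContinuousOn (fun p : ℝ × ℝ => D.z β p.2) (univ ×ˢ Icc (0:ℝ) T) :=
    D.z_cont.comp (f := fun p : ℝ × ℝ => (β, p.2)) (by fun_prop) (fun p hp => ⟨trivial, hp.2⟩)
  have hNβ : ContinuousOn (fun p : ℝ × ℝ => D.N s β p.2) (univ ×ˢ Icc (0:ℝ) T) :=
    (D.N_cont hT hA s).comp (f := fun p : ℝ × ℝ => (β, p.2)) (by fun_prop) (fun p hp => ⟨trivial, hp.2⟩)
  have hF : ContinuousOn (fun p : ℝ × ℝ => rr A p.2 - ‖D.z p.1 p.2 - D.z β p.2‖)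
      (univ ×ˢ Icc (0:ℝ) T) :=
    ((rr_cont A).comp continuous_snd).continuousOn.sub (D.z_cont.sub hzβ).norm
  have hG : ContinuousOn (fun p : ℝ × ℝ => (inner ℝ (D.N s β p.2) (D.N s p.1 p.2) : ℝ))
      (univ ×ˢ Icc (0:ℝ) T) := hNβ.inner (D.N_cont hT hA s)
  have e1 := (hF (α, t0) ⟨trivial, hI⟩).eventually (lt_mem_nhds (a := 0) (by
    simp only [hz, sub_self, norm_zero, sub_zero]; exact rr_pos hA t0))
  have e2 := (hG (α, t0) ⟨trivial, hI⟩).eventually (lt_mem_nhds (a := 1/2) (by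
    simp only [hN, real_inner_self_eq_norm_sq, D.N_norm hA hI hs]; norm_num))
  obtain ⟨η, hη, hb⟩ := Metric.mem_nhdsWithin_iff.1 (e1.and e2)
  have hba : 0 < |β - α| := abs_pos.2 (sub_ne_zero.2 hne.symm)
  have hcp : 0 < |c| := abs_pos.2 hc0
  obtain ⟨δ, hδ, hδ1, hδ2, hδ3⟩ : ∃ δ > 0, δ < η ∧ δ < |β - α| ∧ 4 * A ^ 2 * δ < |c| := by
    refine ⟨min (η / 2) (min (|β - α| / 2) (|c| / (8 * A ^ 2))), by positivity, ?_, ?_, ?_⟩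
    · linarith [min_le_left (η / 2) (min (|β - α| / 2) (|c| / (8 * A ^ 2)))]
    · linarith [min_le_right (η / 2) (min (|β - α| / 2) (|c| / (8 * A ^ 2))),
        min_le_left (|β - α| / 2) (|c| / (8 * A ^ 2))]
    · have := (min_le_right (η / 2) (min (|β - α| / 2) (|c| / (8 * A ^ 2)))).trans
        (min_le_right (|β - α| / 2) (|c| / (8 * A ^ 2)))
      calc _ ≤ 4 * A ^ 2 * (|c| / (8 * A ^ 2)) := by gcongr
        _ = |c| / 2 := by field_simp; norm_num
        _ < |c| := by linarith
  have hdzβ : ‖D.dz β t0‖ ≤ 2 * A := D.dz_bound hT hA hI β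
  have hest : ∀ a, |inner ℝ (D.z a t0 - D.z β t0) (D.dz β t0) - (a - α) * c| ≤ 4 * A ^ 2 * (a - α) ^ 2 := by
    intro a
    have h1 := D.taylor hT hA hI α a
    have h2 := abs_real_inner_le_norm (D.z a t0 - D.z α t0 - (a - α) • D.dz α t0) (D.dz β t0)
    rw [inner_sub_left, inner_smul_left] at h2
    simp only [conj_trivial] at h2
    rw [← hz]
    calc _ ≤ _ := h2
      _ ≤ 2 * A * (a - α) ^ 2 * (2 * A) := by gcongr
      _ = _ := by ring
  have hp : 0 < c * inner ℝ (D.z (α + δ) t0 - D.z β t0) (D.dz β t0) := by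
    have h1 := hest (α + δ)
    rw [add_sub_cancel_left] at h1
    set X : ℝ := inner ℝ (D.z (α + δ) t0 - D.z β t0) (D.dz β t0)
    have h2 : |c * (X - δ * c)| ≤ |c| * (4 * A ^ 2 * δ ^ 2) := by
      rw [abs_mul]; gcongr
    have h3 := (abs_le.1 h2).1
    have h4 : c * c = |c| * |c| := (abs_mul_abs_self c).symm
    have h5 : 0 < |c| * δ * (|c| - 4 * A ^ 2 * δ) := by
      apply mul_pos (by positivity); linarith
    nlinarith
  have hm : c * inner ℝ (D.z (α - δ) t0 - D.z β t0) (D.dz β t0) < 0 := by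
    have h1 := hest (α - δ)
    rw [sub_sub_cancel_left, neg_sq] at h1
    set X : ℝ := inner ℝ (D.z (α - δ) t0 - D.z β t0) (D.dz β t0)
    have h2 : |c * (X - -δ * c)| ≤ |c| * (4 * A ^ 2 * δ ^ 2) := by
      rw [abs_mul]; gcongr
    have h3 := (abs_le.1 h2).2
    have h4 : c * c = |c| * |c| := (abs_mul_abs_self c).symm
    have h5 : 0 < |c| * δ * (|c| - 4 * A ^ 2 * δ) := by
      apply mul_pos (by positivity); linarith
    nlinarith
  have hct : ∀ a, ContinuousOn (fun t => c * inner ℝ (D.z a t - D.z β t) (D.dz β t)) (Icc 0 T) := by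
    intro a
    have q : ∀ a, ContinuousOn (fun t => D.z a t) (Icc 0 T) := fun a =>
      D.z_cont.comp (f := fun t : ℝ => (a, t)) (by fun_prop) (fun p hp => ⟨trivial, hp⟩)
    have q2 : ContinuousOn (fun t => D.dz β t) (Icc 0 T) :=
      (D.dz_cont hT).comp (f := fun t : ℝ => (β, t)) (by fun_prop) (fun p hp => ⟨trivial, hp⟩)
    exact continuousOn_const.mul (((q a).sub (q β)).inner q2)
  have hmono : nhdsWithin t0 (Ico 0 t0) ≤ nhdsWithin t0 (Icc 0 T) :=
    nhdsWithin_mono _ (fun x hx => ⟨hx.1, by linarith [hx.2]⟩)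
  have e3 := ((hct (α + δ) t0 hI).eventually (lt_mem_nhds hp)).filter_mono hmono
  have e4 := ((hct (α - δ) t0 hI).eventually (gt_mem_nhds hm)).filter_mono hmono
  have e5 : ∀ᶠ t' in nhdsWithin t0 (Ico 0 t0), |t' - t0| < η :=
    mem_nhdsWithin_of_mem_nhds (Metric.ball_mem_nhds t0 hη)
  have hneb : (nhdsWithin t0 (Ico 0 t0)).NeBot := by
    rw [← mem_closure_iff_nhdsWithin_neBot, closure_Ico ht0.ne]
    exact ⟨ht0.le, le_rfl⟩
  obtain ⟨t, a1, a2, a3, a4⟩ := (e3.and (e4.and (e5.and self_mem_nhdsWithin))).exists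
  have hIt : t ∈ Icc (0:ℝ) T := ⟨a4.1, by linarith [a4.2]⟩
  have hca : ContinuousOn (fun a => c * inner ℝ (D.z a t - D.z β t) (D.dz β t)) (Icc (α - δ) (α + δ)) := by
    have := (D.z_contDiff hIt).continuous
    exact (continuous_const.mul ((this.sub continuous_const).inner continuous_const)).continuousOn
  obtain ⟨a, ha, ha0⟩ := intermediate_value_Icc (by linarith) hca ⟨a2.le, a1.le⟩
  simp only at ha0
  have ha1 : |a - α| ≤ δ := abs_le.2 ⟨by linarith [ha.1], by linarith [ha.2]⟩
  have haβ : a ≠ β := by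
    rintro rfl; linarith
  have hperp := (mul_eq_zero.1 ha0).resolve_left hc0
  have hmem : (a, t) ∈ Metric.ball (α, t0) η ∩ univ ×ˢ Icc 0 T := by
    refine ⟨?_, trivial, hIt⟩
    rw [Metric.mem_ball, Prod.dist_eq]
    exact max_lt (lt_of_le_of_lt ha1 hδ1) a3
  obtain ⟨b1, b2⟩ := hb hmem
  simp only at b1 b2
  have g1 := D.good_all hT hA hIt hs (hg t a4) haβ
  have g2 := D.good_all hT hA hIt hs (hg t a4) haβ.symm
  unfold TwoFluid.g at g1 g2
  have hd := decomp (D.N_norm hA hIt hs β) (D.dz_ne hA hIt β) (D.N_inner s β t) hperp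
  set k : ℝ := inner ℝ (D.z a t - D.z β t) (D.N s β t) with hk
  have hnk : ‖D.z a t - D.z β t‖ = |k| := by
    rw [hd, norm_smul, D.N_norm hA hIt hs, mul_one, Real.norm_eq_abs]
  have hin : inner ℝ (D.z β t - D.z a t) (D.N s a t) = - k * inner ℝ (D.N s β t) (D.N s a t) := by
    rw [← neg_sub, hd, ← neg_smul, inner_smul_left]; simp
  rw [norm_sub_rev, hnk, sq_abs, hin] at g1
  rw [hnk, sq_abs] at g2
  rw [hnk] at b1
  have hr := rr_pos hA t
  set m : ℝ := inner ℝ (D.N s β t) (D.N s a t)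
  have hk1 : |k| < rr A t := by linarith
  have hk2 := abs_lt.1 hk1
  have hkneg : k < 0 := by
    by_contra h
    push Not at h
    nlinarith
  nlinarith [mul_pos hr (neg_pos.2 hkneg)]

end


section
variable {ρ1 ρ2 σ grav T A : ℝ}

lemma TwoFluid.taylor_inner (D : TwoFluid ρ1 ρ2 σ grav T A) (hT : 0 < T) (hA : 1 ≤ A) {t : ℝ}
    (ht : t ∈ Icc (0:ℝ) T) (α β : ℝ) {e : E2} {K : ℝ} (he : ‖e‖ ≤ K) :
    |inner ℝ (D.z β t - D.z α t) e - (β - α) * inner ℝ (D.dz α t) e| ≤ 2 * A * (β - α) ^ 2 * K := by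
  have h1 := D.taylor hT hA ht α β
  have h2 := abs_real_inner_le_norm (D.z β t - D.z α t - (β - α) • D.dz α t) e
  rw [inner_sub_left, inner_smul_left] at h2
  simp only [conj_trivial] at h2
  have : 0 ≤ ‖e‖ := norm_nonneg _
  calc _ ≤ _ := h2
    _ ≤ 2 * A * (β - α) ^ 2 * K := by gcongr

lemma TwoFluid.dz_opp (D : TwoFluid ρ1 ρ2 σ grav T A) (hA : 1 ≤ A) {t : ℝ}
    (ht : t ∈ Icc (0:ℝ) T) {s : ℝ} (hs : |s| = 1) {α β : ℝ}
    (h : D.N s β t = - D.N s α t) : inner ℝ (D.dz β t) (D.dz α t) < 0 := by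
  have h1 : inner ℝ (D.N s β t) (D.N s α t) = (-1:ℝ) := by
    rw [h, inner_neg_left, real_inner_self_eq_norm_sq, D.N_norm hA ht hs]; norm_num
  have h2 : inner ℝ (perpv (D.dz β t)) (perpv (D.dz α t)) = (inner ℝ (D.dz β t) (D.dz α t) : ℝ) := by
    rw [inner2, inner2, perpv_0, perpv_1, perpv_0, perpv_1]; ring
  unfold TwoFluid.N at h1
  rw [inner_smul_left, inner_smul_right, h2] at h1
  simp only [conj_trivial] at h1
  have hs2 : s * s = 1 := by rw [← abs_mul_abs_self, hs]; norm_num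
  have p1 := inv_pos.2 (D.dz_pos hA ht α)
  have p2 := inv_pos.2 (D.dz_pos hA ht β)
  have h3 : (‖D.dz β t‖⁻¹ * ‖D.dz α t‖⁻¹) * inner ℝ (D.dz β t) (D.dz α t) = -1 := by
    rw [← h1]; linear_combination -(‖D.dz β t‖⁻¹ * ‖D.dz α t‖⁻¹ * inner ℝ (D.dz β t) (D.dz α t)) * hs2
  by_contra h4
  push Not at h4
  have := mul_nonneg (mul_pos p2 p1).le h4
  linarith

lemma TwoFluid.minus (D : TwoFluid ρ1 ρ2 σ grav T A) (hT : 0 < T) (hA : 1 ≤ A) {s : ℝ}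
    (hs : |s| = 1) {t : ℝ} (ht : t ∈ Icc (0:ℝ) T)
    (hno : ∀ α β, α ≠ β → D.z α t = D.z β t → D.N s β t = - D.N s α t)
    {α β : ℝ} (hab : α < β) (hz : D.z α t = D.z β t) : False := by
  have hApos : 0 < A := by linarith
  have hN := hno α β hab.ne hz
  have htri : ∀ γ, γ ≠ α → γ ≠ β → D.z γ t ≠ D.z α t := by
    intro γ h1 h2 h3
    have e1 := hno α γ h1.symm h3.symm
    have e2 := hno β γ h2.symm (h3.trans hz).symm
    rw [e1, hN, neg_neg] at e2
    have e3 : D.N s α t = 0 := by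
      have : (2:ℝ) • D.N s α t = 0 := by rw [two_smul]; nth_rewrite 1 [← e2]; simp
      exact (smul_eq_zero.1 this).resolve_left (by norm_num)
    have e4 := D.N_norm hA ht hs α
    rw [e3, norm_zero] at e4
    norm_num at e4
  have hc := D.dz_opp hA ht hs hN
  set c : ℝ := inner ℝ (D.dz β t) (D.dz α t)
  have hq := pow_pos (D.dz_pos hA ht α) 2
  set q := ‖D.dz α t‖ ^ 2 with hqdef
  have hdz : ‖D.dz α t‖ ≤ 2 * A := D.dz_bound hT hA ht α
  obtain ⟨ε, hε, hε1, hε2, hε3⟩ : ∃ ε > 0, 2 * ε ≤ 1 / (100 * A ^ 2) ∧ 4 * A ^ 2 * ε ≤ -c ∧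
      4 * A ^ 2 * ε ≤ q := by
    have p1 : 0 < 1 / (200 * A ^ 2) := by positivity
    have p2 : 0 < -c / (4 * A ^ 2) := div_pos (by linarith) (by positivity)
    have p3 : 0 < q / (4 * A ^ 2) := div_pos (by linarith) (by positivity)
    refine ⟨min (1 / (200 * A ^ 2)) (min (-c / (4 * A ^ 2)) (q / (4 * A ^ 2))),
      lt_min p1 (lt_min p2 p3), ?_, ?_, ?_⟩
    · calc _ ≤ 2 * (1 / (200 * A ^ 2)) := by gcongr; exact min_le_left _ _
        _ = _ := by field_simp; norm_num
    · calc _ ≤ 4 * A ^ 2 * (-c / (4 * A ^ 2)) := by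
            gcongr; exact (min_le_right _ _).trans (min_le_left _ _)
        _ = _ := by field_simp
    · calc _ ≤ 4 * A ^ 2 * (q / (4 * A ^ 2)) := by
            gcongr; exact (min_le_right _ _).trans (min_le_right _ _)
        _ = _ := by field_simp
  have hcl : IsClosed ((fun α => D.z α t) '' (Iic (α - ε) ∪ Ici (β + ε))) :=
    (D.z_proper ht).isClosedMap _ (isClosed_Iic.union isClosed_Ici)
  have hzc : Continuous (fun α => D.z α t) := (D.z_contDiff ht).continuous
  have hop := hcl.isOpen_compl.preimage hzc
  obtain ⟨η, hη, hb⟩ := Metric.isOpen_iff.1 hop α (by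
    rintro ⟨γ, hγ, h⟩
    rcases hγ with hγ | hγ
    · simp only [mem_Iic] at hγ
      exact htri γ (by linarith) (by linarith) h
    · simp only [mem_Ici] at hγ
      exact htri γ (by linarith) (by linarith) h)
  obtain ⟨h, hh, hh1, hh2⟩ : ∃ h > 0, h < η ∧ h < ε := ⟨min η ε / 2, by positivity,
    by linarith [min_le_left η ε], by linarith [min_le_right η ε]⟩
  refine D.no_pinch ht (γ0 := α + h) hab hz ?_
  intro γ hγ heq
  have hnot := hb (show α + h ∈ Metric.ball α η by
    rw [Metric.mem_ball, Real.dist_eq, add_sub_cancel_left, abs_of_pos hh]; exact hh1)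
  have hγC : γ ∉ Iic (α - ε) ∪ Ici (β + ε) := fun hm => hnot ⟨γ, hm, heq⟩
  simp only [mem_union, mem_Iic, mem_Ici, not_or, not_le] at hγC
  rcases hγ with hγ | hγ
  · have := D.chord_local hT hA ht (α := γ) (β := α + h) (by
      rw [abs_of_pos (by linarith)]; linarith)
    rw [heq, sub_self, norm_zero, abs_of_pos (by linarith)] at this
    have h2 : 0 < 1 / (2 * A) * (α + h - γ) := mul_pos (by positivity) (by linarith)
    linarith
  · have t1 := (abs_le.1 (D.taylor_inner hT hA ht β γ hdz)).2
    have t2 := (abs_le.1 (D.taylor_inner hT hA ht α (α + h) hdz)).1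
    rw [heq, ← hz] at t1
    rw [add_sub_cancel_left] at t2
    have hself : inner ℝ (D.dz α t) (D.dz α t) = q := real_inner_self_eq_norm_sq _
    rw [hself] at t2
    set X : ℝ := inner ℝ (D.z (α + h) t - D.z α t) (D.dz α t)
    have k0 : 4 * A ^ 2 * (γ - β) ≤ 4 * A ^ 2 * ε := by gcongr; linarith
    have k0' : 4 * A ^ 2 * h < 4 * A ^ 2 * ε := by gcongr
    have k1 : 0 ≤ (γ - β) * (-c - 4 * A ^ 2 * (γ - β)) :=
      mul_nonneg (by linarith) (by linarith)
    have k2 : 0 < h * (q - 4 * A ^ 2 * h) := mul_pos hh (by linarith)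
    nlinarith

lemma TwoFluid.inj (D : TwoFluid ρ1 ρ2 σ grav T A) (hT : 0 < T) (hA : 1 ≤ A) {s : ℝ}
    (hs : |s| = 1) {t0 : ℝ} (ht0 : 0 < t0) (ht0T : t0 ≤ T) (hg : ∀ t ∈ Ico 0 t0, D.Good s t)
    (hb : D.Balls s t0) {α β : ℝ} (hz : D.z α t0 = D.z β t0) : α = β := by
  have ht : t0 ∈ Icc (0:ℝ) T := ⟨ht0.le, ht0T⟩
  have hno : ∀ α β, α ≠ β → D.z α t0 = D.z β t0 → D.N s β t0 = - D.N s α t0 := by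
    intro α β hne hz
    have hg0 : ∀ γ, 0 ≤ D.g s (rr A t0) α γ t0 := by
      intro γ
      by_contra h
      push Not at h
      exact D.z_not1 ht γ (hb α ((D.mem_ball_iff hA ht hs (rr_pos hA t0) α γ).2 h))
    have hgβ : D.g s (rr A t0) α β t0 = 0 := by simp [TwoFluid.g, hz]
    have hd0 : HasDerivAt (fun γ => D.z γ t0 - D.z α t0) (D.dz β t0) β :=
      (D.z_hasDeriv ht β).sub_const _
    have hd : HasDerivAt (fun γ => D.g s (rr A t0) α γ t0)
        (2 * inner ℝ (D.z β t0 - D.z α t0) (D.dz β t0) -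
          2 * rr A t0 * (inner ℝ (D.z β t0 - D.z α t0) 0 + inner ℝ (D.dz β t0) (D.N s α t0))) β :=
      hd0.norm_sq.sub ((hd0.inner ℝ (hasDerivAt_const β (D.N s α t0))).const_mul _)
    have hmin : IsLocalMin (fun γ => D.g s (rr A t0) α γ t0) β :=
      Eventually.of_forall (fun γ => by simp only [hgβ]; exact hg0 γ)
    have h0 := hmin.hasDerivAt_eq_zero hd
    rw [hz, sub_self, inner_zero_left, inner_zero_left] at h0
    have h1 : inner ℝ (D.N s α t0) (D.dz β t0) = 0 := by
      rw [real_inner_comm]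
      have : rr A t0 * inner ℝ (D.dz β t0) (D.N s α t0) = 0 := by linarith
      exact (mul_eq_zero.1 this).resolve_left (rr_pos hA t0).ne'
    rcases D.N_pm hA ht hs h1 with h | h
    · exact (D.plus hT hA hs ht0 ht0T hg hne hz h).elim
    · exact h
  by_contra hne
  rcases lt_or_gt_of_ne hne with h | h
  · exact D.minus hT hA hs ht hno h hz
  · exact D.minus hT hA hs ht hno h hz.symm

end


lemma N_diff {v : ℝ → E2} {x s : ℝ} (hv : DifferentiableAt ℝ v x) (h0 : v x ≠ 0) :
    DifferentiableAt ℝ (fun y => (s * ‖v y‖⁻¹) • perpv (v y)) x := by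
  have h1 : DifferentiableAt ℝ (fun y => ‖v y‖⁻¹) x := (hv.norm ℝ h0).inv (norm_ne_zero_iff.2 h0)
  have h2 : DifferentiableAt ℝ (fun y => perpv (v y)) x := perpL.differentiableAt.comp x hv
  exact (h1.const_mul s).smul h2

lemma unit_deriv {n : ℝ → E2} {n' : E2} {x : ℝ} (hn : ∀ᶠ y in nhds x, ‖n y‖ = 1)
    (h : HasDerivAt n n' x) : inner ℝ (n x) n' = 0 := by
  have h1 := h.norm_sq
  have h2 : HasDerivAt (fun y => ‖n y‖ ^ 2) 0 x :=
    (hasDerivAt_const x (1:ℝ)).congr_of_eventuallyEq (by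
      filter_upwards [hn] with y hy
      simp [hy])
  have := h1.unique h2
  linarith

section
variable {ρ1 ρ2 σ grav T A : ℝ}

lemma TwoFluid.u_lip (D : TwoFluid ρ1 ρ2 σ grav T A) (hT : 0 < T) (hA : 1 ≤ A) {t : ℝ}
    (ht : t ∈ Icc (0:ℝ) T) {p n : E2} {r : ℝ} (hn : ‖n‖ = 1) (hr : 0 < r)
    (hb : Metric.ball (p + r • n) r ⊆ D.Ω1 t) :
    -(A ^ 2 * (2 * r)) ≤ inner ℝ (D.u1 (p + (2 * r) • n) t - D.u1 p t) n := by
  set φ : ℝ → ℝ := fun τ => inner ℝ (D.u1 (p + τ • ((2 * r) • n)) t) n with hφ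
  have hin : ∀ τ ∈ Ioo (0:ℝ) 1, p + τ • ((2 * r) • n) ∈ D.Ω1 t := by
    intro τ hτ
    apply hb
    rw [ball_iff hn hr, add_sub_cancel_left, smul_smul, norm_smul, hn, inner_smul_left,
      real_inner_self_eq_norm_sq, hn, mul_one, Real.norm_eq_abs, sq_abs]
    simp only [conj_trivial]
    have : 0 < τ * (1 - τ) * r ^ 2 := mul_pos (mul_pos hτ.1 (by linarith [hτ.2])) (by positivity)
    nlinarith
  have hline : Continuous (fun τ : ℝ => p + τ • ((2 * r) • n)) := by fun_prop
  have hcl : ∀ τ ∈ Icc (0:ℝ) 1, p + τ • ((2 * r) • n) ∈ closure (D.Ω1 t) := by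
    intro τ hτ
    have h1 : closure (Ioo (0:ℝ) 1) ⊆ (fun τ : ℝ => p + τ • ((2 * r) • n)) ⁻¹' closure (D.Ω1 t) :=
      closure_minimal (fun τ hτ => subset_closure (hin τ hτ)) (isClosed_closure.preimage hline)
    rw [closure_Ioo (by norm_num)] at h1
    exact h1 hτ
  have hcont : ContinuousOn φ (Icc 0 1) :=
    ((D.hu1_reg t ht).continuousOn.comp hline.continuousOn hcl).inner continuousOn_const
  have hder : ∀ τ ∈ Ioo (0:ℝ) 1, HasDerivAt φ (inner ℝ (fderiv ℝ (fun x => D.u1 x t)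
      (p + τ • ((2 * r) • n)) ((2 * r) • n)) n) τ := by
    intro τ hτ
    have hd : DifferentiableAt ℝ (fun x => D.u1 x t) (p + τ • ((2 * r) • n)) :=
      (((D.hu1_reg t ht).mono subset_closure).contDiffAt
        ((D.hΩ1_open t ht).mem_nhds (hin τ hτ))).differentiableAt (by norm_num)
    have hl : HasDerivAt (fun τ : ℝ => p + τ • ((2 * r) • n)) ((2 * r) • n) τ := by
      have := ((hasDerivAt_id τ).smul_const ((2 * r) • n)).const_add p
      rw [one_smul] at this
      exact this
    have h1 := hd.hasFDerivAt.comp_hasDerivAt τ hl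
    have h2 := h1.inner ℝ (hasDerivAt_const τ n)
    rw [inner_zero_right, zero_add] at h2
    exact h2
  obtain ⟨τ, hτ, hs⟩ := exists_hasDerivAt_eq_slope φ _ (by norm_num : (0:ℝ) < 1) hcont hder
  have hb1 := D.grad_bound hT hA ht (hin τ hτ) ((2 * r) • n)
  have hb2 := abs_real_inner_le_norm (fderiv ℝ (fun x => D.u1 x t)
      (p + τ • ((2 * r) • n)) ((2 * r) • n)) n
  rw [norm_smul, hn, mul_one, Real.norm_eq_abs, abs_of_pos (by linarith : 0 < 2 * r)] at hb1
  rw [hn, mul_one, hs] at hb2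
  have hb3 := (abs_le.1 (hb2.trans hb1)).1
  simp only [hφ, one_smul, zero_smul, add_zero, sub_zero, div_one] at hb3
  rw [inner_sub_left]
  exact hb3

lemma TwoFluid.good_step (D : TwoFluid ρ1 ρ2 σ grav T A) (hT : 0 < T) (hA : 1 ≤ A) {s : ℝ}
    (hs : |s| = 1) {t0 : ℝ} (ht0 : 0 < t0) (ht0T : t0 < T) (hg : ∀ t ∈ Ico 0 t0, D.Good s t)
    (hb : D.Balls s t0) : D.Good s t0 := by
  intro α β hab
  have ht : t0 ∈ Icc (0:ℝ) T := ⟨ht0.le, ht0T.le⟩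
  have hApos : 0 < A := by linarith
  have hr := rr_pos hA t0
  have hne : α ≠ β := by
    rintro rfl
    rw [sub_self, abs_zero] at hab
    have : 0 < 1 / (100 * A ^ 2) := by positivity
    linarith
  have hg0 : ∀ α γ, 0 ≤ D.g s (rr A t0) α γ t0 := by
    intro α γ
    by_contra h
    push Not at h
    exact D.z_not1 ht γ (hb α ((D.mem_ball_iff hA ht hs (rr_pos hA t0) α γ).2 h))
  by_contra hcon
  have hz0 : D.g s (rr A t0) α β t0 = 0 := le_antisymm (not_lt.1 hcon) (hg0 α β)
  set w := D.z β t0 - D.z α t0 with hw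
  have hw0 : w ≠ 0 := fun h => hne (D.inj hT hA hs ht0 ht0T.le hg hb (sub_eq_zero.1 h).symm)
  set n := D.N s α t0 with hn
  have hn1 : ‖n‖ = 1 := D.N_norm hA ht hs α
  -- derivative in β
  have hdβ : inner ℝ w (D.dz β t0) - rr A t0 * inner ℝ (D.dz β t0) n = 0 := by
    have hd0 : HasDerivAt (fun γ => D.z γ t0 - D.z α t0) (D.dz β t0) β :=
      (D.z_hasDeriv ht β).sub_const _
    have hd : HasDerivAt (fun γ => D.g s (rr A t0) α γ t0)
        (2 * inner ℝ w (D.dz β t0) -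
          2 * rr A t0 * (inner ℝ w 0 + inner ℝ (D.dz β t0) n)) β :=
      hd0.norm_sq.sub ((hd0.inner ℝ (hasDerivAt_const β n)).const_mul _)
    have hmin : IsLocalMin (fun γ => D.g s (rr A t0) α γ t0) β :=
      Eventually.of_forall (fun γ => by simp only [hz0]; exact hg0 α γ)
    have h0 := hmin.hasDerivAt_eq_zero hd
    rw [inner_zero_right] at h0
    linarith
  -- derivative in α
  have hdα : inner ℝ w (D.dz α t0) = 0 := by
    have hNd : DifferentiableAt ℝ (fun a => D.N s a t0) α :=
      N_diff (v := fun a => D.dz a t0) (D.dz_hasDeriv ht α).differentiableAt (D.dz_ne hA ht α)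
    set n' := deriv (fun a => D.N s a t0) α
    have hN' : HasDerivAt (fun a => D.N s a t0) n' α := hNd.hasDerivAt
    have hnn : inner ℝ n n' = 0 :=
      unit_deriv (Eventually.of_forall fun a => D.N_norm hA ht hs a) hN'
    have hdd := hN'.inner ℝ (D.dz_hasDeriv ht α)
    set z2 := deriv (fun β => deriv (fun α => D.z α t0) β) α
    have hdd0 : inner ℝ n z2 + inner ℝ n' (D.dz α t0) = 0 := by
      refine hdd.unique ((hasDerivAt_const α (0:ℝ)).congr_of_eventuallyEq ?_)
      exact Eventually.of_forall fun a => D.N_inner s a t0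
    have hd0 : HasDerivAt (fun γ => D.z β t0 - D.z γ t0) (-D.dz α t0) α :=
      (D.z_hasDeriv ht α).const_sub _
    have hd : HasDerivAt (fun γ => D.g s (rr A t0) γ β t0)
        (2 * inner ℝ w (-D.dz α t0) -
          2 * rr A t0 * (inner ℝ w n' + inner ℝ (-D.dz α t0) n)) α :=
      hd0.norm_sq.sub ((hd0.inner ℝ hN').const_mul _)
    have hmin : IsLocalMin (fun γ => D.g s (rr A t0) γ β t0) α :=
      Eventually.of_forall (fun γ => by simp only [hz0]; exact hg0 γ β)
    have h0 := hmin.hasDerivAt_eq_zero hd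
    have hnd : inner ℝ (D.dz α t0) n = 0 := by rw [real_inner_comm]; exact D.N_inner s α t0
    rw [inner_neg_right, inner_neg_left, hnd] at h0
    have hL := D.dz_pos hA ht α
    have hL1 : A⁻¹ ≤ ‖D.dz α t0‖ := D.hz_lower t0 ht α
    set l := ‖D.dz α t0‖ with hl
    set e := l⁻¹ • D.dz α t0 with he
    have he1 : ‖e‖ = 1 := by
      rw [he, norm_smul, norm_inv, norm_norm]; exact inv_mul_cancel₀ hL.ne'
    have hde : D.dz α t0 = l • e := by
      rw [he, smul_smul, mul_inv_cancel₀ hL.ne', one_smul]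
    have hn0 : n ≠ 0 := by rw [← norm_ne_zero_iff, hn1]; norm_num
    have hdec := decomp (n := e) (x := n') he1 hn0 (by rw [he, inner_smul_left, hnd, mul_zero])
      (by rw [real_inner_comm]; exact hnn)
    set κ : ℝ := inner ℝ n' e with hκ
    have hκl : l * κ = - inner ℝ n z2 := by
      rw [hde, inner_smul_right] at hdd0; linarith
    have hz2 : ‖z2‖ ≤ 2 * A := D.ddz_bound hT hA ht α
    have hκb : |l * κ| ≤ 2 * A := by
      rw [hκl, abs_neg]
      refine (abs_real_inner_le_norm n z2).trans ?_
      rw [hn1, one_mul]; exact hz2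
    rw [hdec, inner_smul_right, hde, inner_smul_right] at h0
    have hfac : (inner ℝ w e : ℝ) * (l + rr A t0 * κ) = 0 := by linarith
    have hpos : l + rr A t0 * κ ≠ 0 := by
      have hrl := rr_le hA ht.1
      have h5 : rr A t0 * |l * κ| ≤ 1 / (1000 * A ^ 3) * (2 * A) := by gcongr
      have h6 : 1 / (1000 * A ^ 3) * (2 * A) = (1/500) * (A⁻¹) ^ 2 := by field_simp; norm_num
      have h7 : A⁻¹ ^ 2 ≤ l ^ 2 := by
        have : 0 < A⁻¹ := by positivity
        gcongr
      have h8 : 0 < l * (l + rr A t0 * κ) := by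
        have := neg_abs_le (l * κ)
        have h9 : rr A t0 * -|l * κ| ≤ rr A t0 * (l * κ) := by gcongr
        nlinarith
      intro h; rw [h, mul_zero] at h8; exact lt_irrefl _ h8
    have := (mul_eq_zero.1 hfac).resolve_right hpos
    rw [hde, inner_smul_right, this, mul_zero]
  have hdec := decomp hn1 (D.dz_ne hA ht α) (D.N_inner s α t0) hdα
  set k : ℝ := inner ℝ w n with hk
  have hg1 : D.g s (rr A t0) α β t0 = ‖w‖ ^ 2 - 2 * rr A t0 * k := rfl
  have hwk : ‖w‖ ^ 2 = k ^ 2 := by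
    rw [hdec, norm_smul, hn1, mul_one, Real.norm_eq_abs, sq_abs]
  have hk2 : k = 2 * rr A t0 := by
    rw [hz0, hwk] at hg1
    have h1 : k * (k - 2 * rr A t0) = 0 := by linarith
    rcases mul_eq_zero.1 h1 with h | h
    · rw [h, zero_smul] at hdec; exact absurd hdec hw0
    · linarith
  rw [hk2] at hdec
  have hperp : inner ℝ n (D.dz β t0) = 0 := by
    rw [hdec, inner_smul_left, real_inner_comm (D.dz β t0) n] at hdβ
    simp only [conj_trivial] at hdβ
    have hdβ' : rr A t0 * inner ℝ n (D.dz β t0) = 0 := by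
      rw [real_inner_comm]
      linarith
    exact (mul_eq_zero.1 hdβ').resolve_left hr.ne'
  have htI : t0 ∈ Ioo (0:ℝ) T := ⟨ht0, ht0T⟩
  have hkin : ∀ γ, inner ℝ (deriv (fun s => D.z γ s) t0) (D.N s γ t0) =
      (inner ℝ (D.u1 (D.z γ t0) t0) (D.N s γ t0) : ℝ) := by
    intro γ
    have h1 := D.hkin1 t0 ht γ
    unfold rinner at h1
    rw [← sub_eq_zero, ← inner_sub_left]
    unfold TwoFluid.N
    rw [inner_smul_right]
    exact mul_eq_zero_of_right _ h1
  have hkα := hkin α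
  have hkβ : inner ℝ (deriv (fun s => D.z β s) t0) n = (inner ℝ (D.u1 (D.z β t0) t0) n : ℝ) := by
    have h1 := hkin β
    rcases D.N_pm hA ht hs hperp with h | h
    · rw [h] at h1; exact h1
    · rw [h, inner_neg_right, inner_neg_right] at h1; linarith
  set zt : E2 := deriv (fun s => D.z β s) t0 - deriv (fun s => D.z α s) t0 with hzt
  have hwt : HasDerivAt (fun t => D.z β t - D.z α t) zt t0 :=
    (D.z_time_diff htI β).hasDerivAt.sub (D.z_time_diff htI α).hasDerivAt
  have hNt : DifferentiableAt ℝ (fun t => D.N s α t) t0 :=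
    N_diff (v := fun t => D.dz α t) (D.dz_time_diff hT htI α) (D.dz_ne hA ht α)
  set nt := deriv (fun t => D.N s α t) t0
  have hNt' : HasDerivAt (fun t => D.N s α t) nt t0 := hNt.hasDerivAt
  have hnnt : inner ℝ n nt = 0 := by
    refine unit_deriv ?_ hNt'
    filter_upwards [Ioo_mem_nhds ht0 ht0T] with t hti
    exact D.N_norm hA ⟨hti.1.le, hti.2.le⟩ hs α
  have hgt : HasDerivAt (fun t => D.g s (rr A t) α β t)
      (2 * inner ℝ w zt - ((2 * (-(A ^ 2 + 1) * rr A t0)) * inner ℝ w n +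
        2 * rr A t0 * (inner ℝ w nt + inner ℝ zt n))) t0 :=
    hwt.norm_sq.sub (((rr_deriv A t0).const_mul 2).mul (hwt.inner ℝ hNt'))
  have hL := D.u_lip hT hA ht hn1 hr (hb α)
  have hzβ : D.z α t0 + (2 * rr A t0) • n = D.z β t0 := by rw [← hdec, hw]; abel
  rw [hzβ, inner_sub_left, ← hkβ] at hL
  change _ ≤ _ - inner ℝ (D.u1 (D.z α t0) t0) (D.N s α t0) at hL
  rw [← hkα, ← inner_sub_left] at hL
  have hval : 0 < 2 * inner ℝ w zt - ((2 * (-(A ^ 2 + 1) * rr A t0)) * inner ℝ w n +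
        2 * rr A t0 * (inner ℝ w nt + inner ℝ zt n)) := by
    rw [hdec, inner_smul_left, inner_smul_left, inner_smul_left, hnnt, real_inner_self_eq_norm_sq, hn1,
      real_inner_comm zt n]
    simp only [conj_trivial]
    change -(A ^ 2 * (2 * rr A t0)) ≤ inner ℝ zt n at hL
    set X : ℝ := inner ℝ zt n
    have := mul_le_mul_of_nonneg_left hL hr.le
    nlinarith [pow_pos hr 2]
  have hev := hgt.tendsto_slope.eventually (lt_mem_nhds hval)
  have hmono : nhdsWithin t0 (Iio t0) ≤ nhdsWithin t0 {t0}ᶜ :=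
    nhdsWithin_mono _ (fun x hx => ne_of_lt hx)
  have hev2 := hev.filter_mono hmono
  have hev3 : ∀ᶠ t in nhdsWithin t0 (Iio t0), 0 < t := mem_nhdsWithin_of_mem_nhds (lt_mem_nhds ht0)
  obtain ⟨t, h1, h2, h3⟩ := (hev2.and (hev3.and self_mem_nhdsWithin)).exists
  rw [slope_def_field, hz0, sub_zero] at h1
  have h4 := hg t ⟨h2.le, h3⟩ α β hab
  have h5 : t - t0 < 0 := sub_neg.2 h3
  exact absurd h1 (not_lt.2 (div_nonpos_of_nonneg_of_nonpos h4.le h5.le))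

end


section
variable {ρ1 ρ2 σ grav T A : ℝ}

lemma TwoFluid.bad_norm (D : TwoFluid ρ1 ρ2 σ grav T A) (hA : 1 ≤ A) {s : ℝ}
    (hs : |s| = 1) {t : ℝ} (ht : t ∈ Icc (0:ℝ) T) (hbad : ¬ D.Good s t) :
    ∃ α ∈ Icc (0:ℝ) (2 * Real.pi), ∃ β ∈ Icc (-(2 * A + 1)) (2 * Real.pi + (2 * A + 1)),
      1 / (100 * A ^ 2) ≤ |α - β| ∧ D.g s (rr A t) α β t ≤ 0 := by
  unfold TwoFluid.Good at hbad
  push Not at hbad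
  obtain ⟨α, β, hab, hg⟩ := hbad
  obtain ⟨n, hn⟩ := strip_shift α
  refine ⟨_, hn, β + n * (2 * Real.pi), ?_, ?_, ?_⟩
  · have hr := rr_pos hA t
    have hrl := rr_le hA ht.1
    have hr2 : 1 / (1000 * A ^ 3) ≤ 1 / 1000 := by
      have : 1 ≤ A ^ 3 := one_le_pow₀ hA
      apply one_div_le_one_div_of_le (by norm_num); linarith
    have h1 := D.z_far ht α β
    have h2 := real_inner_le_norm (D.z β t - D.z α t) (D.N s α t)
    rw [D.N_norm hA ht hs, mul_one] at h2
    unfold TwoFluid.g at hg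
    set X := ‖D.z β t - D.z α t‖ with hX
    have hX0 : 0 ≤ X := norm_nonneg _
    have h3 : X ≤ 2 * rr A t := by
      by_contra h
      push Not at h
      have : 2 * rr A t * inner ℝ (D.z β t - D.z α t) (D.N s α t) ≤ 2 * rr A t * X := by gcongr
      nlinarith
    have h4 : |β - α| ≤ 2 * A + 1 := by linarith
    have h5 := abs_le.1 h4
    exact ⟨by linarith [hn.1], by linarith [hn.2]⟩
  · rw [add_sub_add_right_eq_sub]; exact hab
  · rw [D.g_shift ht]; exact hg

lemma TwoFluid.good_Ico (D : TwoFluid ρ1 ρ2 σ grav T A) (hT : 0 < T) (hA : 1 ≤ A) {s : ℝ}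
    (hs : |s| = 1) (h0 : D.Balls s 0) : ∀ t ∈ Ico 0 T, D.Good s t := by
  intro t1 ht1
  by_contra hbad
  set K : Set (ℝ × ℝ × ℝ) := Icc (0:ℝ) (2 * Real.pi) ×ˢ
    (Icc (-(2 * A + 1)) (2 * Real.pi + (2 * A + 1)) ×ˢ Icc (0:ℝ) T) with hK
  have hKc : IsCompact K := isCompact_Icc.prod (isCompact_Icc.prod isCompact_Icc)
  set S : Set (ℝ × ℝ × ℝ) := (K ∩ (fun p : ℝ × ℝ × ℝ => D.g s (rr A p.2.2) p.1 p.2.1 p.2.2) ⁻¹' Iic 0) ∩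
    {p | 1 / (100 * A ^ 2) ≤ |p.1 - p.2.1|} with hS
  have hgc : ContinuousOn (fun p : ℝ × ℝ × ℝ => D.g s (rr A p.2.2) p.1 p.2.1 p.2.2) K :=
    (D.g_cont hT hA s (rr_cont A)).mono (fun p hp => ⟨trivial, trivial, hp.2.2⟩)
  have hScl : IsClosed S := (hgc.preimage_isClosed_of_isClosed hKc.isClosed isClosed_Iic).inter
    (isClosed_le continuous_const (by fun_prop))
  have hSc : IsCompact S := hKc.of_isClosed_subset hScl (fun p hp => hp.1.1)
  have himg : IsCompact ((fun p : ℝ × ℝ × ℝ => p.2.2) '' S) := hSc.image (by fun_prop)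
  have hmem : ∀ t ∈ Icc (0:ℝ) T, ¬ D.Good s t → t ∈ (fun p : ℝ × ℝ × ℝ => p.2.2) '' S := by
    intro t ht hb
    obtain ⟨α, hα, β, hβ, h1, h2⟩ := D.bad_norm hA hs ht hb
    exact ⟨(α, β, t), ⟨⟨⟨hα, hβ, ht⟩, h2⟩, h1⟩, rfl⟩
  obtain ⟨ts, hts, hmin⟩ := himg.exists_isLeast ⟨t1, hmem t1 ⟨ht1.1, ht1.2.le⟩ hbad⟩
  have hle : ts ≤ t1 := hmin (hmem t1 ⟨ht1.1, ht1.2.le⟩ hbad)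
  obtain ⟨⟨α, β, t⟩, ⟨⟨hk, hg⟩, hab⟩, rfl⟩ := hts
  simp only at hle hmin
  have ht : t ∈ Icc (0:ℝ) T := hk.2.2
  have hnG : ¬ D.Good s t := fun h => not_le.2 (h α β hab) hg
  have hgood : ∀ t' ∈ Ico 0 t, D.Good s t' := by
    intro t' ht'
    by_contra hb
    exact not_le.2 ht'.2 (hmin (hmem t' ⟨ht'.1, by linarith [ht'.2, ht.2]⟩ hb))
  rcases ht.1.eq_or_lt with h | h
  · exact hnG (h ▸ D.good_zero hT hA hs)
  · exact hnG (D.good_step hT hA hs h (by linarith [ht1.2]) hgood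
      (D.balls_limit hT hA h ht.2 (D.balls_of_good hT hA hs ht.2 h0 hgood)))

lemma TwoFluid.main_balls (D : TwoFluid ρ1 ρ2 σ grav T A) (hT : 0 < T) (hA : 1 ≤ A) {t : ℝ}
    (ht : t ∈ Icc (0:ℝ) T) : ∃ s : ℝ, |s| = 1 ∧ (∀ α β, D.z α t = D.z β t → α = β) ∧
      ∀ α, Metric.ball (D.c s (rr A T) α t) (rr A T) ⊆ D.Ω1 t := by
  obtain ⟨s, hs, h0⟩ := D.sign_zero hT hA
  have hG := D.good_Ico hT hA hs h0
  have hshrink : D.Balls s t → ∀ α, Metric.ball (D.c s (rr A T) α t) (rr A T) ⊆ D.Ω1 t := by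
    intro hb α x hx
    have hle : rr A T ≤ rr A t := by
      unfold rr
      have : -(A ^ 2 + 1) * T ≤ -(A ^ 2 + 1) * t := by nlinarith [ht.2, sq_nonneg A]
      gcongr
    refine hb α ?_
    unfold TwoFluid.c at hx ⊢
    rw [ball_iff (D.N_norm hA ht hs α) (rr_pos hA _)] at hx ⊢
    set q : ℝ := inner ℝ (x - D.z α t) (D.N s α t)
    have hT' := rr_pos hA T
    have hq : 0 < q := by
      by_contra h
      push Not at h
      nlinarith [sq_nonneg ‖x - D.z α t‖]
    nlinarith
  rcases ht.1.eq_or_lt with h | h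
  · subst h
    refine ⟨s, hs, ?_, hshrink h0⟩
    intro α β hz
    by_contra hne
    have := D.good_all hT hA ht hs (hG 0 ⟨le_rfl, hT⟩) hne
    simp [TwoFluid.g, hz] at this
  · have hg : ∀ t' ∈ Ico 0 t, D.Good s t' := fun t' ht' => hG t' ⟨ht'.1, by linarith [ht'.2, ht.2]⟩
    have hb := D.balls_limit hT hA h ht.2 (D.balls_of_good hT hA hs ht.2 h0 hg)
    exact ⟨s, hs, fun α β hz => D.inj hT hA hs h ht.2 hg hb hz, hshrink hb⟩

end


lemma inv_iter_bound (B c : ℝ) (hB : 1 ≤ B) (hc : 0 < c) : ∃ M : ℝ, 1 ≤ M ∧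
    ∀ (W : ℝ → ℝ) (J : Set ℝ), IsOpen J → ContDiff ℝ 3 W →
      (∀ i, i ≤ 3 → ∀ h, |iteratedDeriv i W h| ≤ B) → (∀ h ∈ J, c ≤ W h) →
      ContDiffOn ℝ 3 (fun h => (W h)⁻¹) J ∧ 
      ∀ i, i ≤ 3 → ∀ h ∈ J, ‖iteratedFDerivWithin ℝ i (fun h => (W h)⁻¹) J h‖ ≤ M := by
  set K : ℝ := max 1 c⁻¹ with hK
  have hK1 : 1 ≤ K := le_max_left _ _
  refine ⟨6 * (6 * K ^ 4) * B ^ 3, ?_, ?_⟩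
  · have : 1 ≤ K^4 := one_le_pow₀ hK1
    have : 1 ≤ B^3 := one_le_pow₀ hB
    nlinarith
  intro W J hJ hW hWB hWc
  have hmaps : MapsTo W J (Ioi (c/2)) := fun h hh => by
    have := hWc h hh
    show c/2 < W h
    linarith
  have hinv : ContDiffOn ℝ 3 (fun x : ℝ => x⁻¹) (Ioi (c/2)) := by
    intro x hx
    have : x ≠ 0 := by
      have : c/2 < x := hx
      intro h; linarith
    exact (contDiffAt_inv ℝ this).contDiffWithinAt
  refine ⟨hinv.comp hW.contDiffOn hmaps, ?_⟩
  intro i hi h hh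
  have key := norm_iteratedFDerivWithin_comp_le (n := i) (x := h) (C := 6 * K^4) (D := B) hinv hW.contDiffOn
    (by exact_mod_cast hi) (isOpen_Ioi.uniqueDiffOn) hJ.uniqueDiffOn hmaps hh ?_ ?_
  · refine key.trans ?_
    have h1 : (i.factorial : ℝ) ≤ 6 := by
      exact_mod_cast (Nat.factorial_le hi)
    have h2 : B^i ≤ B^3 := pow_le_pow_right₀ hB hi
    have h3 : 0 ≤ B^i := by positivity
    gcongr
  · intro k hk
    have hk3 : k ≤ 3 := hk.trans hi
    have hpos : W h ∈ Ioi (c/2) := hmaps hh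
    rw [iteratedFDerivWithin_of_isOpen k isOpen_Ioi hpos, norm_iteratedFDeriv_eq_norm_iteratedDeriv,
      iteratedDeriv_eq_iterate]
    have := iter_deriv_inv k (W h)
    rw [show (fun x : ℝ => x⁻¹) = Inv.inv from rfl, this, norm_mul, norm_mul, norm_pow]
    simp only [norm_neg, norm_one, one_pow, one_mul]
    have hw := hWc h hh
    have hw0 : 0 < W h := by linarith
    have h1 : (k.factorial : ℝ) ≤ 6 := by
      exact_mod_cast (Nat.factorial_le hk3)
    have h2 : ‖W h ^ (-1 - (k:ℤ))‖ ≤ K ^ 4 := by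
      rw [show (-1 - (k:ℤ)) = -((k+1 : ℕ) : ℤ) by push_cast; ring, zpow_neg, zpow_natCast, norm_inv, norm_pow, ← inv_pow]
      have : ‖W h‖⁻¹ ≤ K := by
        rw [Real.norm_of_nonneg hw0.le]
        exact (inv_anti₀ hc hw).trans (le_max_right _ _)
      calc (‖W h‖⁻¹)^(k+1) ≤ K^(k+1) := by gcongr
        _ ≤ K^4 := pow_le_pow_right₀ hK1 (by omega)
    have h3 : ‖(k.factorial : ℝ)‖ ≤ 6 := by simpa using h1
    gcongr
  · intro k hk1 hk
    rw [iteratedFDerivWithin_of_isOpen k hJ hh, norm_iteratedFDeriv_eq_norm_iteratedDeriv]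
    exact (hWB k (hk.trans hi) h).trans (by
      calc B = B^1 := by ring
        _ ≤ B^k := pow_le_pow_right₀ hB hk1)

lemma inv_bound (B c : ℝ) (hB : 1 ≤ B) (hc : 0 < c) : ∃ E : ℝ, 1 ≤ E ∧ ∀ (X : ℝ → ℝ) (h0 κ : ℝ),
    ContDiff ℝ 4 X → (∀ i, 1 ≤ i → i ≤ 4 → ∀ h, |iteratedDeriv i X h| ≤ B) → X 0 = 0 → 0 < κ →
    κ < c * h0 → (∀ h, |h| ≤ h0 → c ≤ deriv X h) →
    ∃ b : ℝ → ℝ, (∀ ρ ∈ Ioo (-κ) κ, |b ρ| ≤ |ρ| / c ∧ |b ρ| < h0 ∧ X (b ρ) = ρ ∧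
        HasDerivAt b (deriv X (b ρ))⁻¹ ρ) ∧ b 0 = 0 ∧ ContDiffOn ℝ 4 b (Ioo (-κ) κ) ∧
      ∀ ρ ∈ Ioo (-κ) κ, ∀ i, 1 ≤ i → i ≤ 4 → ‖iteratedFDerivWithin ℝ i b (Ioo (-κ) κ) ρ‖ ≤ E ^ i := by
  obtain ⟨M, hM1, hM⟩ := inv_iter_bound B c hB hc
  refine ⟨6 * M, by linarith, ?_⟩
  intro X h0 κ hX hXB hX0 hκ hκh hXc
  have hh0 : 0 < h0 := by
    by_contra h; push Not at h; nlinarith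
  have hXd : ∀ h, HasDerivAt X (deriv X h) h := fun h =>
    ((hX.differentiable (by norm_num)) h).hasDerivAt
  -- slope lower bound
  have hslope : ∀ x y, |x| ≤ h0 → |y| ≤ h0 → x ≤ y → c * (y - x) ≤ X y - X x := by
    intro x y hx hy hxy
    rw [abs_le] at hx hy
    refine Convex.mul_sub_le_image_sub_of_le_deriv (D := Icc (-h0) h0) (convex_Icc _ _)
      hX.continuous.continuousOn (hX.differentiable (by norm_num)).differentiableOn ?_ x hx y hy hxy
    intro w hw
    have h2 : w ∈ Icc (-h0) h0 := interior_subset hw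
    exact hXc w (abs_le.2 h2)
  have hex : ∀ ρ, ρ ∈ Ioo (-κ) κ → ∃ h, |h| ≤ h0 ∧ X h = ρ := by
    intro ρ hρ
    have h1 := hslope 0 h0 (by simp [hh0.le]) (by rw [abs_of_pos hh0]) hh0.le
    have h2 := hslope (-h0) 0 (by rw [abs_neg, abs_of_pos hh0]) (by simp [hh0.le])  (by linarith)
    rw [hX0] at h1 h2
    obtain ⟨h, hh, e⟩ := intermediate_value_Icc (a := -h0) (b := h0) (by linarith) hX.continuous.continuousOn
      (show ρ ∈ Icc _ _ from ⟨by linarith [hρ.1], by linarith [hρ.2]⟩)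
    exact ⟨h, abs_le.2 hh, e⟩
  classical
  let b : ℝ → ℝ := fun ρ => if h : ρ ∈ Ioo (-κ) κ then (hex ρ h).choose else 0
  have hb1 : ∀ ρ ∈ Ioo (-κ) κ, |b ρ| ≤ h0 ∧ X (b ρ) = ρ := by
    intro ρ hρ
    simp only [b, dif_pos hρ]
    exact (hex ρ hρ).choose_spec
  have hlip : ∀ x y, |x| ≤ h0 → |y| ≤ h0 → c * |y - x| ≤ |X y - X x| := by
    intro x y hx hy
    rcases le_total x y with h | h
    · rw [abs_of_nonneg (by linarith : 0 ≤ y - x)]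
      exact (hslope x y hx hy h).trans (le_abs_self _)
    · rw [abs_sub_comm, abs_of_nonneg (by linarith : 0 ≤ x - y), abs_sub_comm (X y)]
      exact (hslope y x hy hx h).trans (le_abs_self _)
  have hb2 : ∀ ρ ∈ Ioo (-κ) κ, |b ρ| ≤ |ρ| / c := by
    intro ρ hρ
    have := hlip 0 (b ρ) (by simp [hh0.le]) (hb1 ρ hρ).1
    rw [hX0, (hb1 ρ hρ).2, sub_zero, sub_zero] at this
    rw [le_div_iff₀ hc]; linarith
  have hb3 : ∀ ρ ∈ Ioo (-κ) κ, |b ρ| < h0 := by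
    intro ρ hρ
    have h1 := hb2 ρ hρ
    have h2 : |ρ| < κ := abs_lt.2 hρ
    have h3 : |ρ|/c < h0 := by rw [div_lt_iff₀ hc]; linarith
    linarith
  have hI : IsOpen (Ioo (-κ) κ) := isOpen_Ioo
  have h0I : (0:ℝ) ∈ Ioo (-κ) κ := ⟨by linarith, hκ⟩
  have hb0 : b 0 = 0 := by
    have := hb2 0 h0I
    simp only [abs_zero, zero_div] at this
    exact abs_eq_zero.1 (le_antisymm this (abs_nonneg _))
  have hbc : ∀ ρ ∈ Ioo (-κ) κ, ContinuousAt b ρ := by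
    intro ρ hρ
    have hev : ∀ᶠ y in nhds ρ, dist (b y) (b ρ) ≤ |y - ρ| / c := by
      filter_upwards [hI.mem_nhds hρ] with y hy
      have := hlip (b ρ) (b y) (hb1 ρ hρ).1 (hb1 y hy).1
      rw [(hb1 ρ hρ).2, (hb1 y hy).2] at this
      rw [Real.dist_eq, le_div_iff₀ hc]; linarith
    have ht : Tendsto (fun y => |y - ρ| / c) (nhds ρ) (nhds 0) := by
      have : Continuous (fun y : ℝ => |y - ρ| / c) := by fun_prop
      have := this.tendsto ρ
      simpa using this
    exact tendsto_iff_dist_tendsto_zero.2 (squeeze_zero' (Eventually.of_forall fun _ => dist_nonneg) hev ht)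
  have hbd : ∀ ρ ∈ Ioo (-κ) κ, HasDerivAt b (deriv X (b ρ))⁻¹ ρ := by
    intro ρ hρ
    refine HasDerivAt.of_local_left_inverse (hbc ρ hρ) (hXd (b ρ)) ?_ ?_
    · have := hXc _ (hb1 ρ hρ).1
      intro h; linarith
    · filter_upwards [hI.mem_nhds hρ] with y hy using (hb1 y hy).2
  set I := Ioo (-κ) κ with hIdef
  set J := Ioo (-h0) h0 with hJdef
  have hmaps : MapsTo b I J := fun ρ hρ => abs_lt.1 (hb3 ρ hρ)
  have hXderiv : ContDiff ℝ 3 (deriv X) := ((contDiff_succ_iff_deriv (n := 3)).1 (by exact_mod_cast hX)).2.2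
  obtain ⟨hφ, hφb⟩ := hM (deriv X) J isOpen_Ioo hXderiv (by
      intro i hi h
      rw [← iteratedDeriv_succ']
      exact hXB (i+1) (by omega) (by omega) h) (fun h hh => hXc h (abs_lt.2 hh).le)
  set φ : ℝ → ℝ := fun h => (deriv X h)⁻¹ with hφdef
  have hder : ∀ ρ ∈ I, deriv b ρ = (φ ∘ b) ρ := fun ρ hρ => (hbd ρ hρ).deriv
  have hdiff : DifferentiableOn ℝ b I := fun ρ hρ => (hbd ρ hρ).differentiableAt.differentiableWithinAt
  have step : ∀ n : ℕ, n ≤ 3 → ContDiffOn ℝ n b I → ContDiffOn ℝ (n+1 : ℕ) b I := by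
    intro n hn hb
    push_cast
    rw [contDiffOn_succ_iff_deriv_of_isOpen hI]
    refine ⟨hdiff, by simp, ?_⟩
    exact ((hφ.of_le (by exact_mod_cast hn)).comp hb hmaps).congr hder
  have hb4 : ContDiffOn ℝ 4 b I := by
    have c0 : ContDiffOn ℝ (0:ℕ) b I := by
      simpa using (contDiffOn_zero (𝕜 := ℝ)).2 (fun ρ hρ => (hbc ρ hρ).continuousWithinAt)
    have c4 := step 3 (by norm_num) (step 2 (by norm_num) (step 1 (by norm_num) (step 0 (by norm_num) c0)))
    exact_mod_cast c4
  refine ⟨b, fun ρ hρ => ⟨hb2 ρ hρ, hb3 ρ hρ, (hb1 ρ hρ).2, hbd ρ hρ⟩, hb0, hb4, ?_⟩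
  intro ρ hρ i
  induction i using Nat.strong_induction_on with
  | _ i ih =>
    intro hi1 hi4
    obtain ⟨j, rfl⟩ : ∃ j, i = j + 1 := ⟨i - 1, by omega⟩
    rw [norm_iteratedFDerivWithin_eq_norm_iteratedDerivWithin, iteratedDerivWithin_succ']
    have hc2 : EqOn (derivWithin b I) (φ ∘ b) I := by
      intro x hx
      rw [derivWithin_of_isOpen hI hx, hder x hx]
    rw [iteratedDerivWithin_congr hc2 hρ, ← norm_iteratedFDerivWithin_eq_norm_iteratedDerivWithin]
    have key := norm_iteratedFDerivWithin_comp_le (n := j) (x := ρ) (C := M) (D := 6 * M) hφ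
      (hb4.of_le (by norm_num)) (by exact_mod_cast (show j ≤ 3 by omega)) isOpen_Ioo.uniqueDiffOn hI.uniqueDiffOn hmaps hρ
      (fun k hk => hφb k (by omega) _ (hmaps hρ)) (fun k hk1 hk => ih k (by omega) hk1 (by omega))
    refine key.trans ?_
    have h1 : (j.factorial : ℝ) ≤ 6 := by
      exact_mod_cast (Nat.factorial_le (show j ≤ 3 by omega))
    rw [pow_succ, mul_comm ((6*M)^j)]
    have : 0 ≤ (6*M)^j := by positivity
    gcongr


lemma ortho_decomp {e n : E2} (he : ‖e‖ = 1) (hn : ‖n‖ = 1) (hen : inner ℝ e n = 0) (x : E2) :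
    x = (inner ℝ e x : ℝ) • e + (inner ℝ n x : ℝ) • n := by
  have hne : inner ℝ n e = 0 := by rw [real_inner_comm]; exact hen
  have hv : e ≠ 0 := by intro h; simp [h] at he
  have h := decomp hn (x := x - (inner ℝ e x : ℝ) • e) hv hne (by
    rw [inner_sub_left, real_inner_smul_left, real_inner_self_eq_norm_sq, he, real_inner_comm]; ring)
  rw [inner_sub_left, real_inner_smul_left, hen, mul_zero, sub_zero, real_inner_comm n x] at h
  rw [← h, real_inner_comm x e]; abel

lemma coord_bound {ζ : ℝ → E2} {B : ℝ} (hζ : ContDiff ℝ 4 ζ)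
    (hB : ∀ i, 1 ≤ i → i ≤ 4 → ∀ h, ‖iteratedDeriv i ζ h‖ ≤ B) {e : E2} (he : ‖e‖ = 1) (k : ℝ) :
    ContDiff ℝ 4 (fun h => k + inner ℝ e (ζ h)) ∧
    (∀ h, HasDerivAt (fun h => k + inner ℝ e (ζ h)) (inner ℝ e (deriv ζ h)) h) ∧
    (∀ i, 1 ≤ i → i ≤ 4 → ∀ h, |iteratedDeriv i (fun h => k + inner ℝ e (ζ h)) h| ≤ B) := by
  have hc : ContDiff ℝ 4 ((innerSL ℝ e) ∘ ζ) := (innerSL ℝ e).contDiff.comp hζ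
  refine ⟨contDiff_const.add hc, ?_, ?_⟩
  · intro h
    have h1 : HasDerivAt ζ (deriv ζ h) h := (hζ.differentiable (by norm_num) h).hasDerivAt
    have h2 := ((innerSL ℝ e).hasFDerivAt.comp_hasDerivAt h h1).const_add k
    exact h2
  · intro i hi1 hi4 h
    rw [iteratedDeriv_const_add (f := fun h => inner ℝ e (ζ h)) hi1]
    have h1 := (innerSL ℝ e).norm_iteratedFDeriv_comp_left (x := h) (n := i) hζ.contDiffAt (by exact_mod_cast hi4)
    rw [norm_iteratedFDeriv_eq_norm_iteratedDeriv, norm_iteratedFDeriv_eq_norm_iteratedDeriv,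
      innerSL_apply_norm, he, one_mul] at h1
    exact h1.trans (hB i hi1 hi4 h)

lemma graph_lemma (A : ℝ) (hA : 1 ≤ A) : ∃ E : ℝ, 1 ≤ E ∧ ∀ (ζ : ℝ → E2), ContDiff ℝ 4 ζ →
    (∀ i, 1 ≤ i → i ≤ 4 → ∀ h, ‖iteratedDeriv i ζ h‖ ≤ 2 * A) → ∀ m e n : E2, ‖e‖ = 1 → ‖n‖ = 1 →
    inner ℝ e n = 0 → inner ℝ e (ζ 0 - m) = 0 → A⁻¹ ≤ inner ℝ e (deriv ζ 0) →
    inner ℝ n (deriv ζ 0) = 0 → |inner ℝ n (ζ 0 - m)| ≤ 1 → ∀ κ : ℝ, 0 < κ → κ < 1 / (8 * A ^ 3) →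
    ∃ b f : ℝ → ℝ, (∀ ρ ∈ Ioo (-κ) κ, |b ρ| ≤ 2 * A * |ρ| ∧ ζ (b ρ) = m + ρ • e + f ρ • n ∧
        |f ρ - f 0| ≤ 8 * A ^ 3 * ρ ^ 2 ∧ 1 / (2 * A) ≤ derivWithin b (Ioo (-κ) κ) ρ ∧
        derivWithin b (Ioo (-κ) κ) ρ ≤ 2 * A) ∧ b 0 = 0 ∧ f 0 = inner ℝ n (ζ 0 - m) ∧
      derivWithin f (Ioo (-κ) κ) 0 = 0 ∧ ContDiffOn ℝ 4 f (Ioo (-κ) κ) ∧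
      ContDiffOn ℝ 4 b (Ioo (-κ) κ) ∧ ∀ ρ ∈ Ioo (-κ) κ, ∀ i, i ≤ 4 →
        |iteratedDerivWithin i f (Ioo (-κ) κ) ρ| ≤ E ∧ |iteratedDerivWithin i b (Ioo (-κ) κ) ρ| ≤ E := by
  obtain ⟨E, hE1, hE⟩ := inv_bound (2 * A) (1 / (2 * A)) (by linarith) (by positivity)
  refine ⟨24 * (2 * A + 1) * E ^ 4, ?_, ?_⟩
  · have := one_le_pow₀ (n := 4) hE1
    nlinarith
  intro ζ hζ hB m e n he hn hen h0e hde hdn h0n κ hκ hκ2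
  obtain ⟨X1, X2, X3⟩ := coord_bound hζ hB he (-(inner ℝ e m))
  obtain ⟨Y1, Y2, Y3⟩ := coord_bound hζ hB hn (-(inner ℝ n m))
  set X : ℝ → ℝ := fun h => -(inner ℝ e m) + inner ℝ e (ζ h) with hX
  set Y : ℝ → ℝ := fun h => -(inner ℝ n m) + inner ℝ n (ζ h) with hY
  have hdd : ∀ h, ‖deriv (deriv ζ) h‖ ≤ 2 * A := by
    intro h
    have := hB 2 (by norm_num) (by norm_num) h
    rwa [iteratedDeriv_succ, iteratedDeriv_one] at this
  have hd1 : ∀ h, ‖deriv ζ h‖ ≤ 2 * A := by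
    intro h
    have := hB 1 (by norm_num) (by norm_num) h
    rwa [iteratedDeriv_one] at this
  have hζ3 : ContDiff ℝ 3 (deriv ζ) := ((contDiff_succ_iff_deriv (n := 3)).1 (by exact_mod_cast hζ)).2.2
  have hlip : ∀ h, ‖deriv ζ h - deriv ζ 0‖ ≤ 2 * A * |h| := by
    intro h
    have := Convex.norm_image_sub_le_of_norm_deriv_le (f := deriv ζ) (s := univ) (C := 2 * A) (x := 0) (y := h)
      (fun x _ => (hζ3.differentiable (by norm_num)) x) (fun x _ => hdd x) convex_univ (mem_univ _) (mem_univ _)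
    simpa using this
  have hA3 : (0:ℝ) < A ^ 3 := by positivity
  obtain ⟨b, hb, hb0, hbC, hbE⟩ := hE X (1 / (4 * A ^ 2)) κ X1 X3 (by
      simp only [hX]; rw [inner_sub_right] at h0e; linarith) hκ (by
      refine hκ2.trans_eq ?_
      field_simp; norm_num) (by
      intro h hh
      rw [(X2 h).deriv]
      have h1 : inner ℝ e (deriv ζ h) = inner ℝ e (deriv ζ 0) + inner ℝ e (deriv ζ h - deriv ζ 0) := by
        rw [inner_sub_right]; ring
      have h2 := abs_le.1 ((abs_real_inner_le_norm e (deriv ζ h - deriv ζ 0)))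
      rw [he, one_mul] at h2
      have h3 := hlip h
      have h4 : 2 * A * |h| ≤ 1 / (2 * A) := by
        calc 2 * A * |h| ≤ 2 * A * (1 / (4 * A^2)) := by gcongr
          _ = _ := by field_simp; norm_num
      have h5 : A⁻¹ = 1 / (2 * A) + 1 / (2 * A) := by field_simp; norm_num
      linarith [h2.1])
  set I := Ioo (-κ) κ with hI
  have hIo : IsOpen I := isOpen_Ioo
  have h0I : (0:ℝ) ∈ I := ⟨by linarith, hκ⟩
  have hYbound : ∀ h, |h| ≤ 1 → |Y h| ≤ 2 * A + 1 := by
    intro h hh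
    have h1 := Convex.norm_image_sub_le_of_norm_deriv_le (f := ζ) (s := univ) (C := 2 * A) (x := 0) (y := h)
      (fun x _ => (hζ.differentiable (by norm_num)) x) (fun x _ => hd1 x) convex_univ (mem_univ _) (mem_univ _)
    rw [sub_zero, Real.norm_eq_abs] at h1
    have h2 := abs_real_inner_le_norm n (ζ h - ζ 0)
    rw [hn, one_mul] at h2
    have h3 : Y h = inner ℝ n (ζ h - ζ 0) + inner ℝ n (ζ 0 - m) := by
      simp only [hY, inner_sub_right]; ring
    rw [h3]
    refine (abs_add_le _ _).trans ?_
    have : 2 * A * |h| ≤ 2 * A := by nlinarith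
    linarith
  have hb1 : ∀ ρ ∈ I, |b ρ| ≤ 1 := by
    intro ρ hρ
    refine (hb ρ hρ).2.1.le.trans ?_
    rw [div_le_one (by positivity)]
    nlinarith
  have hf0 : Y (b 0) = inner ℝ n (ζ 0 - m) := by
    rw [hb0]; simp only [hY, inner_sub_right]; ring
  have hbr : ∀ ρ ∈ I, |b ρ| ≤ 2 * A * |ρ| := by
    intro ρ hρ
    refine (hb ρ hρ).1.trans_eq ?_
    field_simp
  refine ⟨b, Y ∘ b, ?_, hb0, hf0, ?_, Y1.comp_contDiffOn hbC, hbC, ?_⟩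
  · intro ρ hρ
    obtain ⟨q1, q2, q3, q4⟩ := hb ρ hρ
    refine ⟨hbr ρ hρ, ?_, ?_, ?_⟩
    · have := ortho_decomp he hn hen (ζ (b ρ) - m)
      have e1 : inner ℝ e (ζ (b ρ) - m) = ρ := by
        rw [inner_sub_right]
        have : -inner ℝ e m + inner ℝ e (ζ (b ρ)) = ρ := q3
        linarith
      have e2 : inner ℝ n (ζ (b ρ) - m) = (Y ∘ b) ρ := by
        simp only [hY, inner_sub_right, Function.comp]; ring
      rw [e1, e2] at this
      rw [add_assoc, ← this]; abel
    · have h1 := taylor2 (hζ.of_le (by norm_num)) hdd 0 (b ρ)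
      have h2 := abs_real_inner_le_norm n (ζ (b ρ) - ζ 0 - (b ρ - 0) • deriv ζ 0)
      rw [inner_sub_right, real_inner_smul_right, hdn, mul_zero, sub_zero, hn, one_mul] at h2
      have h3 : (Y ∘ b) ρ - (Y ∘ b) 0 = inner ℝ n (ζ (b ρ) - ζ 0) := by
        simp only [Function.comp, hY, hb0, inner_sub_right]; ring
      rw [h3]
      refine h2.trans (h1.trans ?_)
      have h4 : (b ρ)^2 ≤ (2 * A * |ρ|)^2 := by
        rw [← sq_abs]; exact pow_le_pow_left₀ (abs_nonneg _) (hbr ρ hρ) 2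
      rw [mul_pow, sq_abs] at h4
      rw [sub_zero]
      nlinarith
    · rw [derivWithin_of_isOpen hIo hρ, q4.deriv, (X2 _).deriv]
      have k1 : 1 / (2 * A) ≤ inner ℝ e (deriv ζ (b ρ)) := by
        have h1 : inner ℝ e (deriv ζ (b ρ)) = inner ℝ e (deriv ζ 0) + inner ℝ e (deriv ζ (b ρ) - deriv ζ 0) := by
          rw [inner_sub_right]; ring
        have h2 := abs_le.1 ((abs_real_inner_le_norm e (deriv ζ (b ρ) - deriv ζ 0)))
        rw [he, one_mul] at h2
        have h3 := hlip (b ρ)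
        have h4 : 2 * A * |b ρ| ≤ 1 / (2 * A) := by
          calc 2 * A * |b ρ| ≤ 2 * A * (1 / (4 * A^2)) := by gcongr
            _ = _ := by field_simp; norm_num
        have h5 : A⁻¹ = 1 / (2 * A) + 1 / (2 * A) := by field_simp; norm_num
        linarith [h2.1]
      have k2 : inner ℝ e (deriv ζ (b ρ)) ≤ 2 * A := by
        refine (real_inner_le_norm _ _).trans ?_
        rw [he, one_mul]; exact hd1 _
      have kp : 0 < inner ℝ e (deriv ζ (b ρ)) := lt_of_lt_of_le (by positivity) k1
      constructor
      · rw [one_div]; exact inv_anti₀ kp k2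
      · have := inv_anti₀ (by positivity) k1
        simpa using this
  · rw [derivWithin_of_isOpen hIo h0I]
    have h1 := (hb 0 h0I).2.2.2
    have h2 : HasDerivAt Y (inner ℝ n (deriv ζ (b 0))) (b 0) := Y2 (b 0)
    have h3 := (h2.comp 0 h1).deriv
    rw [h3, hb0, hdn, zero_mul]
  · have hE4 : 1 ≤ E^4 := one_le_pow₀ hE1
    intro ρ hρ i hi
    constructor
    · rw [← Real.norm_eq_abs, ← norm_iteratedFDerivWithin_eq_norm_iteratedDerivWithin]
      have key := norm_iteratedFDerivWithin_comp_le (n := i) (x := ρ) (C := 2 * A + 1) (D := E) Y1.contDiffOn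
        hbC (by exact_mod_cast hi) uniqueDiffOn_univ hIo.uniqueDiffOn (mapsTo_univ _ _) hρ ?_
        (fun k hk1 hk => hbE ρ hρ k hk1 (hk.trans hi))
      · refine key.trans ?_
        have h1 : (i.factorial : ℝ) ≤ 24 := by
          exact_mod_cast (Nat.factorial_le hi)
        have h2 : E^i ≤ E^4 := pow_le_pow_right₀ hE1 hi
        gcongr
      · intro k hk
        rw [iteratedFDerivWithin_univ, norm_iteratedFDeriv_eq_norm_iteratedDeriv]
        rcases Nat.eq_zero_or_pos k with rfl | hk0
        · rw [iteratedDeriv_zero]; exact hYbound _ (hb1 ρ hρ)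
        · have := Y3 k hk0 (hk.trans hi) (b ρ)
          rw [Real.norm_eq_abs]; linarith
    · have hgoal : E^4 ≤ 24 * (2 * A + 1) * E^4 := by nlinarith
      refine le_trans ?_ hgoal
      rcases Nat.eq_zero_or_pos i with rfl | hi0
      · rw [iteratedDerivWithin_zero]; exact (hb1 ρ hρ).trans hE4
      · rw [← Real.norm_eq_abs, ← norm_iteratedFDerivWithin_eq_norm_iteratedDerivWithin]
        exact (hbE ρ hρ i hi0 hi).trans (pow_le_pow_right₀ hE1 hi)

section
variable {ρ1 ρ2 σ grav T A : ℝ}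

lemma TwoFluid.N_close (D : TwoFluid ρ1 ρ2 σ grav T A) (hT : 0 < T) (hA : 1 ≤ A) {t : ℝ}
    (ht : t ∈ Icc (0:ℝ) T) {s : ℝ} (hs : |s| = 1) {α β : ℝ} (h : |β - α| ≤ 1 / (2 * A ^ 2)) :
    1 / 2 ≤ inner ℝ (D.N s α t) (D.N s β t) := by
  have ha := D.dz_pos hA ht α
  have hb := D.dz_pos hA ht β
  have ha' : A⁻¹ ≤ ‖D.dz α t‖ := D.hz_lower t ht α
  have hb' : A⁻¹ ≤ ‖D.dz β t‖ := D.hz_lower t ht β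
  have hs2 : s * s = 1 := by
    have := sq_abs s
    rw [hs] at this; nlinarith
  have hlip : ‖D.dz α t - D.dz β t‖ ≤ 2 * A * |β - α| := by
    have := Convex.norm_image_sub_le_of_norm_deriv_le (f := fun x => D.dz x t) (s := univ) (C := 2 * A) (x := β) (y := α)
      (fun x _ => (D.dz_hasDeriv ht x).differentiableAt) (fun x _ => D.ddz_bound hT hA ht x) convex_univ (mem_univ _) (mem_univ _)
    rw [Real.norm_eq_abs, abs_sub_comm] at this
    exact this
  have hApos : 0 < A := by linarith
  have hl2 : ‖D.dz α t - D.dz β t‖ ≤ A⁻¹ := by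
    refine hlip.trans ?_
    calc 2 * A * |β - α| ≤ 2 * A * (1 / (2 * A ^ 2)) := by gcongr
      _ = A⁻¹ := by field_simp
  have hin := norm_sub_sq_real (D.dz α t) (D.dz β t)
  have hperp : inner ℝ (perpv (D.dz α t)) (perpv (D.dz β t)) = inner ℝ (D.dz α t) (D.dz β t) := by
    rw [inner2, inner2, perpv_0, perpv_1, perpv_0, perpv_1]; ring
  unfold TwoFluid.N
  rw [real_inner_smul_left, real_inner_smul_right, hperp]
  have e1 : s * ‖D.dz α t‖⁻¹ * (s * ‖D.dz β t‖⁻¹ * inner ℝ (D.dz α t) (D.dz β t)) =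
      inner ℝ (D.dz α t) (D.dz β t) / (‖D.dz α t‖ * ‖D.dz β t‖) := by
    field_simp
    linear_combination (inner ℝ (D.dz α t) (D.dz β t)) * hs2
  rw [e1, le_div_iff₀ (by positivity)]
  have h1 : ‖D.dz α t - D.dz β t‖ ^ 2 ≤ ‖D.dz α t‖ * ‖D.dz β t‖ := by
    rw [sq]
    exact mul_le_mul (hl2.trans ha') (hl2.trans hb') (norm_nonneg _) ha.le
  nlinarith [sq_nonneg (‖D.dz α t‖ - ‖D.dz β t‖)]

lemma TwoFluid.crit (D : TwoFluid ρ1 ρ2 σ grav T A) {t : ℝ}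
    (ht : t ∈ Icc (0:ℝ) T) {a b ε : ℝ} (hε : 0 < ε) (hε1 : ε ≤ 1/2) (hab : |a - b| ∈ Icc (2 * ε) (ε⁻¹ / 2))
    (hmin : ∀ x, |x - b| ∈ Icc ε ε⁻¹ → ‖D.z a t - D.z b t‖ ≤ ‖D.z x t - D.z b t‖) :
    inner ℝ (D.z a t - D.z b t) (D.dz a t) = 0 := by
  have hd : HasDerivAt (fun x => ‖D.z x t - D.z b t‖ ^ 2) (2 * inner ℝ (D.z a t - D.z b t) (D.dz a t)) a :=
    ((D.z_hasDeriv ht a).sub_const (D.z b t)).norm_sq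
  have hinv : 2 ≤ ε⁻¹ := by
    rw [le_inv_comm₀ (by norm_num) hε]; linarith
  have hm : IsLocalMin (fun x => ‖D.z x t - D.z b t‖ ^ 2) a := by
    filter_upwards [Metric.ball_mem_nhds a hε] with x hx
    rw [Metric.mem_ball, Real.dist_eq] at hx
    have h1 : |a - b| ≤ |x - a| + |x - b| := by
      rw [abs_sub_comm x a]; exact abs_sub_le a x b
    have h2 : |x - b| ≤ |x - a| + |a - b| := abs_sub_le x a b
    have := hmin x ⟨by linarith [hab.1], by linarith [hab.2]⟩
    gcongr
  have := hm.hasDerivAt_eq_zero hd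
  linarith

lemma TwoFluid.d_small (D : TwoFluid ρ1 ρ2 σ grav T A) (hT : 0 < T) (hA : 1 ≤ A) {t : ℝ}
    (ht : t ∈ Icc (0:ℝ) T) {d ε4 : ℝ} (hε4 : 0 < ε4) (hε : 2 * ε4 ≤ 1 / (2 * A))
    (hinf : (⨅ p : ℝ × ℝ, chordArcT D.z p.1 p.2 t) ≤ ε4)
    (hmin : ∀ a b, |a - b| ∈ Icc (1 / (100 * A ^ 2)) (1 / (100 * A ^ 2))⁻¹ → d ≤ ‖D.z a t - D.z b t‖) :
    d ≤ 200 * A ^ 2 * ε4 := by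
  have hApos : 0 < A := by linarith
  obtain ⟨⟨a, b⟩, hp⟩ := exists_lt_of_ciInf_lt (show (⨅ p : ℝ × ℝ, chordArcT D.z p.1 p.2 t) < 2 * ε4 by linarith)
  simp only [chordArcT] at hp
  have hA2 : 1 / (2 * A) ≤ A⁻¹ := by
    rw [one_div]; exact inv_anti₀ hApos (by linarith)
  have hA3 : 1 / (2 * A) ≤ 1 / 2 := by
    rw [div_le_div_iff₀ (by positivity) (by norm_num)]; linarith
  split_ifs at hp with hab
  · have := D.hz_lower t ht a
    linarith
  · have hpos : 0 < |a - b| := abs_pos.2 (sub_ne_zero.2 hab)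
    rw [div_lt_iff₀ hpos] at hp
    rcases le_total (|a - b|) (1 / (100 * A ^ 2)) with h1 | h1
    · have := D.chord_local hT hA ht h1
      nlinarith
    · have e : (1 / (100 * A ^ 2))⁻¹ = 100 * A^2 := by rw [one_div, inv_inv]
      rcases le_total (|a - b|) (100 * A ^ 2) with h2 | h2
      · have := hmin a b ⟨h1, by rw [e]; exact h2⟩
        nlinarith
      · have := D.z_far ht b a
        nlinarith
end

section
variable {ρ1 ρ2 σ grav T A : ℝ}

lemma TwoFluid.in1 (D : TwoFluid ρ1 ρ2 σ grav T A) (hA : 1 ≤ A) {t : ℝ}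
    (ht : t ∈ Icc (0:ℝ) T) {s r : ℝ} (hs : |s| = 1) (hr : 0 < r)
    (hb : ∀ α, Metric.ball (D.c s r α t) r ⊆ D.Ω1 t) {α : ℝ} {q : E2}
    (hq : ‖q - D.z α t‖ ^ 2 < 2 * r * inner ℝ (q - D.z α t) (D.N s α t)) : q ∈ D.Ω1 t := by
  refine hb α ?_
  unfold TwoFluid.c
  rw [ball_iff (D.N_norm hA ht hs α) hr]
  linarith

lemma TwoFluid.no_in (D : TwoFluid ρ1 ρ2 σ grav T A) (hA : 1 ≤ A) {t : ℝ}
    (ht : t ∈ Icc (0:ℝ) T) {s r : ℝ} (hs : |s| = 1) (hr : 0 < r)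
    (hb : ∀ α, Metric.ball (D.c s r α t) r ⊆ D.Ω1 t) (α β : ℝ) :
    2 * r * inner ℝ (D.z β t - D.z α t) (D.N s α t) ≤ ‖D.z β t - D.z α t‖ ^ 2 := by
  by_contra h
  push Not at h
  exact D.z_not1 ht β (D.in1 hA ht hs hr hb h)

lemma TwoFluid.strands (D : TwoFluid ρ1 ρ2 σ grav T A) (hA : 1 ≤ A) {t : ℝ}
    (ht : t ∈ Icc (0:ℝ) T) {s r : ℝ} (hs : |s| = 1) (hr : 0 < r)
    (hb : ∀ α, Metric.ball (D.c s r α t) r ⊆ D.Ω1 t) {a1 a2 d : ℝ} (hne : D.z a2 t ≠ D.z a1 t)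
    (hd : d = ‖D.z a2 t - D.z a1 t‖) (hd2 : d < 2 * r)
    (h1 : inner ℝ (D.z a1 t - D.z a2 t) (D.dz a1 t) = 0)
    (h2 : inner ℝ (D.z a2 t - D.z a1 t) (D.dz a2 t) = 0) :
    0 < d ∧ ∃ e w : E2, ‖e‖ = 1 ∧ ‖w‖ = 1 ∧ inner ℝ e w = 0 ∧ D.z a2 t - D.z a1 t = d • w ∧
      D.N s a1 t = -w ∧ D.N s a2 t = w ∧ D.dz a1 t = ‖D.dz a1 t‖ • e ∧
      D.dz a2 t = -(‖D.dz a2 t‖ • e) := by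
  have hdpos : 0 < d := by rw [hd]; exact norm_pos_iff.2 (sub_ne_zero.2 hne)
  set W := D.z a2 t - D.z a1 t with hW
  set w : E2 := d⁻¹ • W with hw
  have hWw : W = d • w := by rw [hw, smul_smul, mul_inv_cancel₀ hdpos.ne', one_smul]
  have hwn : ‖w‖ = 1 := by
    rw [hw, norm_smul, norm_inv, Real.norm_of_nonneg hdpos.le, hd, inv_mul_cancel₀ (by rw [← hd]; exact hdpos.ne')]
  have hw1 : inner ℝ w (D.dz a1 t) = 0 := by
    rw [show D.z a1 t - D.z a2 t = -W by rw [hW]; abel, inner_neg_left] at h1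
    rw [hw, real_inner_smul_left, neg_eq_zero.1 h1, mul_zero]
  have hw2 : inner ℝ w (D.dz a2 t) = 0 := by
    rw [hw, real_inner_smul_left, h2, mul_zero]
  have hpm : ∀ a, inner ℝ w (D.dz a t) = 0 → D.N s a t = w ∨ D.N s a t = -w := by
    intro a ha
    have hN := decomp hwn (D.dz_ne hA ht a) ha (D.N_inner s a t)
    have hn := D.N_norm hA ht hs a
    rw [hN, norm_smul, hwn, mul_one, Real.norm_eq_abs] at hn
    rcases eq_or_eq_neg_of_abs_eq hn with h | h
    · left; rw [hN, h, one_smul]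
    · right; rw [hN, h, neg_one_smul]
  have hww : inner ℝ w w = (1:ℝ) := by rw [real_inner_self_eq_norm_sq, hwn]; norm_num
  have hN1 : D.N s a1 t = -w := by
    rcases hpm a1 hw1 with h | h
    · exfalso
      have := D.no_in hA ht hs hr hb a1 a2
      rw [h, ← hW, ← hd, hWw, real_inner_smul_left, hww] at this
      nlinarith
    · exact h
  have hN2 : D.N s a2 t = w := by
    rcases hpm a2 hw2 with h | h
    · exact h
    · exfalso
      have := D.no_in hA ht hs hr hb a2 a1
      rw [h, show D.z a1 t - D.z a2 t = -W by rw [hW]; abel, inner_neg_neg, norm_neg, ← hd, hWw, real_inner_smul_left, hww] at this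
      nlinarith
  have hp1 := D.dz_pos hA ht a1
  have hp2 := D.dz_pos hA ht a2
  set e : E2 := ‖D.dz a1 t‖⁻¹ • D.dz a1 t with he
  have hen : ‖e‖ = 1 := by
    rw [he, norm_smul, norm_inv, norm_norm, inv_mul_cancel₀ hp1.ne']
  have hew : inner ℝ e w = 0 := by
    rw [he, real_inner_smul_left, real_inner_comm, hw1, mul_zero]
  have hd1 : D.dz a1 t = ‖D.dz a1 t‖ • e := by
    rw [he, smul_smul, mul_inv_cancel₀ hp1.ne', one_smul]
  refine ⟨hdpos, e, w, hen, hwn, hew, hWw, hN1, hN2, hd1, ?_⟩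
  have hopp := D.dz_opp hA ht hs (α := a1) (β := a2) (by rw [hN1, hN2, neg_neg])
  have hdec := ortho_decomp hen hwn hew (D.dz a2 t)
  rw [hw2, zero_smul, add_zero] at hdec
  have hneg : inner ℝ e (D.dz a2 t) < 0 := by
    rw [he, real_inner_smul_left, real_inner_comm]
    exact mul_neg_of_pos_of_neg (by positivity) hopp
  have hnorm : ‖D.dz a2 t‖ = -inner ℝ e (D.dz a2 t) := by
    conv_lhs => rw [hdec]
    rw [norm_smul, hen, mul_one, Real.norm_of_nonpos hneg.le]
  rw [hnorm, neg_smul, neg_neg]; exact hdec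
end

section
variable {ρ1 ρ2 σ grav T A : ℝ}

lemma tau_aux {δ τ Y : ℝ} (hδ : 0 < δ) (hδ1 : δ ≤ 1) (hY : 0 < Y) (hY2 : Y ≤ 2 * δ ^ 7)
    (h : 2 * (1000 * δ) * (Y * τ) ≤ Y ^ 2) : τ ≤ 1 / 2 := by
  have hp6 : δ ^ 6 ≤ 1 := pow_le_one₀ hδ.le hδ1
  have h7 : δ ^ 7 = δ * δ ^ 6 := by ring
  have h' : 2000 * δ * τ ≤ Y := by
    by_contra hc
    push Not at hc
    have := mul_lt_mul_of_pos_left hc hY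
    nlinarith
  have h8 : δ * δ ^ 6 ≤ δ * 1 := by gcongr
  by_contra hc
  push Not at hc
  have : 2000 * δ * (1 / 2) < 2000 * δ * τ := by gcongr
  linarith

lemma vn_aux {A δ c nq hl ρ yb : ℝ} (hA : 1 ≤ A) (hc : 0 < c) (h1 : A * δ ≤ 1) (h2 : 10 ^ 6 * δ ≤ 1)
    (a1 : nq ≤ 2 * A * δ * c) (a2 : hl ≤ c * (2 * A)) (a3 : ρ ≤ δ * c) (a4 : yb ≤ 2 * δ * c) :
    nq + (hl + ρ) + yb ≤ 7 * A * c := by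
  have k1 : A * δ * c ≤ 1 * c := by gcongr
  have k2 : δ * c ≤ 1 * c := by gcongr; linarith
  have k3 : 1 * c ≤ A * c := by gcongr
  linarith

lemma vi_aux {A δ c : ℝ} (hA : 1 ≤ A) (hδ : 0 < δ) (hc : 0 < c) (hδA : 10 ^ 6 * A ^ 3 * δ ≤ 1) :
    (2 * A * δ + 3 * δ) * c ≤ c * A⁻¹ / 4 := by
  have hApos : 0 < A := by linarith
  have : (2 * A * δ + 3 * δ) ≤ A⁻¹ / 4 := by
    rw [le_div_iff₀ (by norm_num), ← one_div, le_div_iff₀ hApos]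
    have h1 : A ^ 2 * δ ≤ A ^ 3 * δ := by
      gcongr
      norm_num
    have h2 : A * δ ≤ A ^ 3 * δ := by
      gcongr
      exact le_self_pow₀ hA (by norm_num)
    nlinarith
  calc (2 * A * δ + 3 * δ) * c ≤ (A⁻¹ / 4) * c := by gcongr
    _ = _ := by ring

set_option maxHeartbeats 1000000 in
lemma TwoFluid.no_third (D : TwoFluid ρ1 ρ2 σ grav T A) (hT : 0 < T) (hA : 1 ≤ A) {t : ℝ}
    (ht : t ∈ Icc (0:ℝ) T) {s δ : ℝ} (hs : |s| = 1) (hδ : 0 < δ) (hδA : 10 ^ 6 * A ^ 3 * δ ≤ 1)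
    (hb : ∀ α, Metric.ball (D.c s (1000 * δ) α t) (1000 * δ) ⊆ D.Ω1 t)
    {a1 d : ℝ} (hd : 0 < d) (hd8 : d ≤ δ ^ 8) {m e w : E2} (he : ‖e‖ = 1) (hw : ‖w‖ = 1)
    (hew : inner ℝ e w = 0) (hm : D.z a1 t = m - (d / 2) • w) (hdz : D.dz a1 t = ‖D.dz a1 t‖ • e)
    {β1 β2 γ ρ y y1 y2 : ℝ} (hβ1 : D.z β1 t = m + ρ • e + y1 • w) (hβ2 : D.z β2 t = m + ρ • e + y2 • w)
    (hρ : |ρ| ≤ δ ^ 4) (h1 : |y1| ≤ δ ^ 7) (h2 : |y2| ≤ δ ^ 7) (hy1 : y1 < y) (hy2 : y < y2)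
    (hγ : D.z γ t = m + ρ • e + y • w) : False := by
  have hApos : 0 < A := by linarith
  have hA2 : 1 ≤ A ^ 2 := one_le_pow₀ hA
  have hA3 : 1 ≤ A ^ 3 := one_le_pow₀ hA
  have hδ1 : 10 ^ 6 * δ ≤ 1 := by
    have := le_mul_of_one_le_left hδ.le hA3
    linarith
  rw [abs_le] at h1 h2
  have hr : (0:ℝ) < 1000 * δ := by positivity
  set N := D.N s γ t with hN
  have hNn : ‖N‖ = 1 := D.N_norm hA ht hs γ
  set τ : ℝ := inner ℝ w N with hτ
  set η : ℝ := inner ℝ e N with hη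
  have hτ1 : τ ≤ 1 / 2 := by
    have h := D.no_in hA ht hs hr hb γ β2
    rw [hβ2, hγ, show m + ρ • e + y2 • w - (m + ρ • e + y • w) = (y2 - y) • w by rw [sub_smul]; abel,
      real_inner_smul_left, norm_smul, hw, mul_one, Real.norm_eq_abs, sq_abs] at h
    exact tau_aux hδ (by linarith) (by linarith : 0 < y2 - y) (by linarith) h
  have hτ2 : -(1 / 2) ≤ τ := by
    have h := D.no_in hA ht hs hr hb γ β1
    rw [hβ1, hγ, show m + ρ • e + y1 • w - (m + ρ • e + y • w) = (y1 - y) • w by rw [sub_smul]; abel,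
      real_inner_smul_left, norm_smul, hw, mul_one, Real.norm_eq_abs, sq_abs] at h
    have h9 := tau_aux (τ := -τ) hδ (by linarith) (by linarith : 0 < y - y1) (by linarith) (by
      rw [hτ]; convert h using 1 <;> ring)
    linarith
  have hsq : η ^ 2 + τ ^ 2 = 1 := by
    have hdec := ortho_decomp he hw hew N
    have h3 : inner ℝ N N = (1:ℝ) := by rw [real_inner_self_eq_norm_sq, hNn]; norm_num
    nth_rw 1 [hdec] at h3
    rw [inner_add_left, real_inner_smul_left, real_inner_smul_left] at h3
    rw [← h3]; ring
  have hη2 : 1 / 2 ≤ |η| := by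
    by_contra hc
    push Not at hc
    have h4 := sq_abs η
    have h5 : |η| ^ 2 < (1 / 2) ^ 2 := pow_lt_pow_left₀ hc (abs_nonneg _) (by norm_num)
    have h6 : τ ^ 2 ≤ (1 / 2) ^ 2 := sq_le_sq' hτ2 hτ1
    norm_num at h5 h6
    linarith
  obtain ⟨sg, hsg, hsgη⟩ : ∃ sg : ℝ, |sg| = 1 ∧ sg * η = |η| := by
    rcases le_total 0 η with h | h
    · exact ⟨1, by norm_num, by rw [abs_of_nonneg h]; ring⟩
    · exact ⟨-1, by norm_num, by rw [abs_of_nonpos h]; ring⟩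
  set h : ℝ := sg * δ ^ 3 with hh
  have habs : |h| = δ ^ 3 := by rw [hh, abs_mul, hsg, one_mul, abs_of_pos (by positivity)]
  have hz := D.no_in hA ht hs hr hb γ (a1 + h)
  have htay := D.taylor hT hA ht a1 (a1 + h)
  rw [add_sub_cancel_left] at htay
  have hh2 : h ^ 2 = δ ^ 6 := by rw [← sq_abs, habs]; ring
  rw [hh2] at htay
  set Q := D.z (a1 + h) t - D.z a1 t - h • D.dz a1 t with hQ
  set l := ‖D.dz a1 t‖ with hl
  have hl1 : A⁻¹ ≤ l := D.hz_lower t ht a1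
  have hl2 : l ≤ 2 * A := D.dz_bound hT hA ht a1
  have hlpos : 0 < l := lt_of_lt_of_le (by positivity) hl1
  have hV : D.z (a1 + h) t - D.z γ t = Q + (h * l - ρ) • e - (d / 2 + y) • w := by
    rw [hQ, hγ, hdz, hm, smul_smul]
    simp only [sub_smul, add_smul]
    abel
  rw [hV] at hz
  have p4 : δ ^ 4 = δ * δ ^ 3 := by ring
  have p6 : δ ^ 6 = δ ^ 3 * δ ^ 3 := by ring
  have p7 : δ ^ 7 = δ ^ 4 * δ ^ 3 := by ring
  have p8 : δ ^ 8 = δ ^ 5 * δ ^ 3 := by ring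
  have hδ3 : 0 < δ ^ 3 := by positivity
  have hle1 : δ ≤ 1 := by linarith
  have q3 : δ ^ 3 ≤ δ := pow_le_of_le_one hδ.le hle1 (by norm_num)
  have q4 : δ ^ 4 ≤ δ := pow_le_of_le_one hδ.le hle1 (by norm_num)
  have q5 : δ ^ 5 ≤ δ := pow_le_of_le_one hδ.le hle1 (by norm_num)
  have hyb : |d / 2 + y| ≤ 2 * δ * δ ^ 3 := by
    have : δ ^ 4 * δ ^ 3 ≤ δ * δ ^ 3 := by gcongr
    have : δ ^ 5 * δ ^ 3 ≤ δ * δ ^ 3 := by gcongr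
    rw [abs_le]; constructor <;> linarith
  have hQb : ‖Q‖ ≤ 2 * A * δ * δ ^ 3 := by
    refine htay.trans ?_
    rw [p6]
    calc 2 * A * (δ ^ 3 * δ ^ 3) = 2 * A * δ ^ 3 * δ ^ 3 := by ring
      _ ≤ 2 * A * δ * δ ^ 3 := by gcongr
  have hρb : |ρ| ≤ δ * δ ^ 3 := by rw [← p4]; exact hρ
  have hAδ : A * δ ≤ 1 := by
    have : A * δ ≤ A ^ 3 * δ := by
      gcongr
      exact le_self_pow₀ hA (by norm_num)
    have := mul_pos (pow_pos hApos 3) hδ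
    linarith
  -- norm bound
  have hVn : ‖Q + (h * l - ρ) • e - (d / 2 + y) • w‖ ≤ 7 * A * δ ^ 3 := by
    have n1 := norm_sub_le (Q + (h * l - ρ) • e) ((d / 2 + y) • w)
    have n2 := norm_add_le Q ((h * l - ρ) • e)
    rw [norm_smul, hw, mul_one, Real.norm_eq_abs] at n1
    rw [norm_smul, he, mul_one, Real.norm_eq_abs] at n2
    have n3 : |h * l - ρ| ≤ |h * l| + |ρ| := abs_sub _ _
    have n4 : |h * l| ≤ δ ^ 3 * (2 * A) := by
      rw [abs_mul, habs, abs_of_pos hlpos]; gcongr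
    have n5 := vn_aux hA hδ3 hAδ hδ1 hQb n4 hρb hyb
    linarith
  have hVi : δ ^ 3 / (4 * A) ≤ inner ℝ (Q + (h * l - ρ) • e - (d / 2 + y) • w) N := by
    rw [inner_sub_left, inner_add_left, real_inner_smul_left, real_inner_smul_left, ← hτ, ← hη]
    have i1 := (abs_le.1 (abs_real_inner_le_norm Q N)).1
    rw [hNn, mul_one] at i1
    have i2 : h * l * η = δ ^ 3 * l * |η| := by rw [hh, ← hsgη]; ring
    have i3 : δ ^ 3 * A⁻¹ * (1 / 2) ≤ δ ^ 3 * l * |η| := by gcongr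
    have hη1 : |η| ≤ 1 := by
      rw [abs_le_one_iff_mul_self_le_one, ← sq]; linarith [sq_nonneg τ]
    have hτ1 : |τ| ≤ 1 := by
      rw [abs_le_one_iff_mul_self_le_one, ← sq]; linarith [sq_nonneg η]
    have i4 : |ρ * η| ≤ δ * δ ^ 3 := by
      rw [abs_mul]
      calc |ρ| * |η| ≤ |ρ| * 1 := by gcongr
        _ ≤ _ := by linarith
    have i5 : |(d / 2 + y) * τ| ≤ 2 * δ * δ ^ 3 := by
      rw [abs_mul]
      calc |d / 2 + y| * |τ| ≤ |d / 2 + y| * 1 := by gcongr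
        _ ≤ _ := by linarith
    have i6 := (abs_le.1 i4).2
    have i7 := (abs_le.1 i5).2
    have i8 : δ ^ 3 / (4 * A) = δ ^ 3 * A⁻¹ * (1 / 2) - δ ^ 3 * A⁻¹ / 4 := by field_simp; norm_num
    have i9 := vi_aux hA hδ hδ3 hδA
    have i10 : (h * l - ρ) * η = h * l * η - ρ * η := by ring
    rw [i10, i2]
    linarith
  have hVn2 : ‖Q + (h * l - ρ) • e - (d / 2 + y) • w‖ ^ 2 ≤ (7 * A * δ ^ 3) ^ 2 :=
    pow_le_pow_left₀ (norm_nonneg _) hVn 2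
  have f1 : 2 * (1000 * δ) * (δ ^ 3 / (4 * A)) ≤ (7 * A * δ ^ 3) ^ 2 := by
    refine le_trans ?_ (hz.trans hVn2)
    gcongr
  have f2 : 2 * (1000 * δ) * (δ ^ 3 / (4 * A)) = 500 * δ * δ ^ 3 / A := by field_simp; norm_num
  rw [f2, div_le_iff₀ hApos] at f1
  have f3 : (7 * A * δ ^ 3) ^ 2 * A = 49 * (A ^ 3 * δ) * δ ^ 2 * δ ^ 3 := by ring
  rw [f3] at f1
  have f4 : A ^ 3 * δ ≤ 1 := by linarith [mul_pos (pow_pos hApos 3) hδ]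
  have f5 : 49 * (A ^ 3 * δ) * δ ^ 2 * δ ^ 3 ≤ 49 * 1 * δ ^ 2 * δ ^ 3 := by gcongr
  have f6 : 500 * δ * δ ^ 3 ≤ 49 * δ ^ 2 * δ ^ 3 := by linarith
  have f7 : 500 * δ ≤ 49 * δ ^ 2 := le_of_mul_le_mul_right f6 hδ3
  have f8 : δ ^ 2 ≤ δ := pow_le_of_le_one hδ.le hle1 (by norm_num)
  linarith
end


lemma orth_norm {e w : E2} (he : ‖e‖ = 1) (hw : ‖w‖ = 1) (hew : inner ℝ e w = 0) (x y : ℝ) :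
    ‖x • e + y • w‖ ^ 2 = x ^ 2 + y ^ 2 := by
  rw [norm_add_sq_real, norm_smul, norm_smul, he, hw, real_inner_smul_left, real_inner_smul_right, hew]
  simp

def Rm (m e w : E2) (x : E2) : E2 := m + x 0 • e + x 1 • w

lemma Rm_vec2 (m e w : E2) (x y : ℝ) : Rm m e w (vec2 x y) = m + x • e + y • w := by
  unfold Rm; rw [vec2_0, vec2_1]

lemma Rm_isometry {m e w : E2} (he : ‖e‖ = 1) (hw : ‖w‖ = 1) (hew : inner ℝ e w = 0) :
    Isometry (Rm m e w) := by
  refine Isometry.of_dist_eq fun x y => ?_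
  rw [dist_eq_norm, dist_eq_norm]
  refine (sq_eq_sq₀ (norm_nonneg _) (norm_nonneg _)).1 ?_
  have : Rm m e w x - Rm m e w y = (x 0 - y 0) • e + (x 1 - y 1) • w := by
    unfold Rm; simp only [sub_smul]; abel
  rw [this, orth_norm he hw hew, normsq2]
  simp

section
variable {ρ1 ρ2 σ grav T A : ℝ}

lemma TwoFluid.regions (D : TwoFluid ρ1 ρ2 σ grav T A) (hT : 0 < T) (hA : 1 ≤ A) {t : ℝ}
    (ht : t ∈ Icc (0:ℝ) T) {s δ : ℝ} (hs : |s| = 1) (hδ : 0 < δ) (hδA : 10 ^ 6 * A ^ 3 * δ ≤ 1)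
    (hb : ∀ α, Metric.ball (D.c s (1000 * δ) α t) (1000 * δ) ⊆ D.Ω1 t)
    {a1 a2 d : ℝ} (hd : 0 < d) (hd8 : d ≤ δ ^ 8) {m e w : E2} (he : ‖e‖ = 1) (hw : ‖w‖ = 1)
    (hew : inner ℝ e w = 0) (hm : D.z a1 t = m - (d / 2) • w) (hdz : D.dz a1 t = ‖D.dz a1 t‖ • e)
    (hN1 : D.N s a1 t = -w) (hN2 : D.N s a2 t = w) {f1 f2 b1 b2 : ℝ → ℝ}
    (hf1 : ContinuousOn f1 (Ioo (-δ ^ 4) (δ ^ 4))) (hf2 : ContinuousOn f2 (Ioo (-δ ^ 4) (δ ^ 4)))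
    (hf12 : ∀ ρ ∈ Ioo (-δ ^ 4) (δ ^ 4), f1 ρ < f2 ρ)
    (hfb : ∀ ρ ∈ Ioo (-δ ^ 4) (δ ^ 4), |f1 ρ| ≤ δ ^ 7 ∧ |f2 ρ| ≤ δ ^ 7)
    (hbb : ∀ ρ ∈ Ioo (-δ ^ 4) (δ ^ 4), |b1 ρ| ≤ 2 * A * δ ^ 4 ∧ |b2 ρ| ≤ 2 * A * δ ^ 4)
    (hg : ∀ ρ ∈ Ioo (-δ ^ 4) (δ ^ 4), D.z (a1 + b1 ρ) t = m + ρ • e + f1 ρ • w ∧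
      D.z (a2 + b2 ρ) t = m + ρ • e + f2 ρ • w) (hf10 : f1 0 = -(d / 2)) :
    ∀ ρ ∈ Ioo (-δ ^ 4) (δ ^ 4), ∀ y : ℝ,
      (y ∈ Ioo (f2 ρ) (δ ^ 2) → m + ρ • e + y • w ∈ D.Ω1 t) ∧
      (y ∈ Ioo (-δ ^ 2) (f1 ρ) → m + ρ • e + y • w ∈ D.Ω1 t) ∧
      (y ∈ Ioo (f1 ρ) (f2 ρ) → m + ρ • e + y • w ∈ D.Ω2 t) := by
  have hApos : 0 < A := by linarith
  have hA3 : 1 ≤ A ^ 3 := one_le_pow₀ hA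
  have hδ1 : 10 ^ 6 * δ ≤ 1 := by
    have := le_mul_of_one_le_left hδ.le hA3
    linarith
  have hle1 : δ ≤ 1 := by linarith
  have hr : (0:ℝ) < 1000 * δ := by positivity
  have q2 : δ ^ 2 ≤ δ := pow_le_of_le_one hδ.le hle1 (by norm_num)
  have q4 : δ ^ 4 ≤ δ := pow_le_of_le_one hδ.le hle1 (by norm_num)
  have q7 : δ ^ 7 ≤ δ := pow_le_of_le_one hδ.le hle1 (by norm_num)
  have q7' : δ ^ 7 < δ ^ 2 := pow_lt_pow_right_of_lt_one₀ hδ (by linarith) (by norm_num)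
  have hsmall : 2 * A * δ ^ 4 ≤ 1 / (2 * A ^ 2) := by
    rw [le_div_iff₀ (by positivity)]
    have : A ^ 3 * δ ^ 4 ≤ A ^ 3 * δ := by gcongr
    have h0 : 0 < A ^ 3 * δ := by positivity
    nlinarith
  have hup : ∀ ρ ∈ Ioo (-δ ^ 4) (δ ^ 4), ∀ y, y ∈ Ioo (f2 ρ) (δ ^ 2) → m + ρ • e + y • w ∈ D.Ω1 t := by
    intro ρ hρ y hy
    refine D.in1 hA ht hs hr hb (α := a2 + b2 ρ) ?_
    have hn := D.N_close hT hA ht hs (α := a2) (β := a2 + b2 ρ) (by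
      rw [add_sub_cancel_left]; exact (hbb ρ hρ).2.trans hsmall)
    rw [hN2] at hn
    rw [(hg ρ hρ).2, show m + ρ • e + y • w - (m + ρ • e + f2 ρ • w) = (y - f2 ρ) • w by rw [sub_smul]; abel,
      norm_smul, hw, mul_one, Real.norm_eq_abs, sq_abs, real_inner_smul_left]
    have h1 : 0 < y - f2 ρ := by linarith [hy.1]
    have h2 : y - f2 ρ < 1000 * δ := by linarith [hy.2, (abs_le.1 (hfb ρ hρ).2).1]
    calc (y - f2 ρ) ^ 2 = (y - f2 ρ) * (y - f2 ρ) := sq _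
      _ < (1000 * δ) * (y - f2 ρ) := by gcongr
      _ = 2 * (1000 * δ) * ((y - f2 ρ) * (1 / 2)) := by ring
      _ ≤ _ := by gcongr
  have hdown : ∀ ρ ∈ Ioo (-δ ^ 4) (δ ^ 4), ∀ y, y ∈ Ioo (-δ ^ 2) (f1 ρ) → m + ρ • e + y • w ∈ D.Ω1 t := by
    intro ρ hρ y hy
    refine D.in1 hA ht hs hr hb (α := a1 + b1 ρ) ?_
    have hn := D.N_close hT hA ht hs (α := a1) (β := a1 + b1 ρ) (by
      rw [add_sub_cancel_left]; exact (hbb ρ hρ).1.trans hsmall)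
    rw [hN1] at hn
    rw [(hg ρ hρ).1, show m + ρ • e + y • w - (m + ρ • e + f1 ρ • w) = (f1 ρ - y) • (-w) by
        rw [sub_smul, smul_neg, smul_neg]; abel,
      norm_smul, norm_neg, hw, mul_one, Real.norm_eq_abs, sq_abs, real_inner_smul_left]
    have h1 : 0 < f1 ρ - y := by linarith [hy.2]
    have h2 : f1 ρ - y < 1000 * δ := by linarith [hy.1, (abs_le.1 (hfb ρ hρ).1).2]
    calc (f1 ρ - y) ^ 2 = (f1 ρ - y) * (f1 ρ - y) := sq _
      _ < (1000 * δ) * (f1 ρ - y) := by gcongr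
      _ = 2 * (1000 * δ) * ((f1 ρ - y) * (1 / 2)) := by ring
      _ ≤ _ := by gcongr
  set I := Ioo (-δ ^ 4) (δ ^ 4) with hI
  set S : Set E2 := (fun p : ℝ × ℝ => m + p.1 • e + (f1 p.1 + p.2 * (f2 p.1 - f1 p.1)) • w) '' (I ×ˢ Ioo (0:ℝ) 1) with hS
  have hmemS : ∀ ρ ∈ I, ∀ y ∈ Ioo (f1 ρ) (f2 ρ), m + ρ • e + y • w ∈ S := by
    intro ρ hρ y hy
    have h1 : 0 < f2 ρ - f1 ρ := by linarith [hf12 ρ hρ]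
    refine ⟨(ρ, (y - f1 ρ) / (f2 ρ - f1 ρ)), ⟨hρ, ?_, ?_⟩, ?_⟩
    · exact div_pos (by linarith [hy.1]) h1
    · show (y - f1 ρ) / (f2 ρ - f1 ρ) < 1
      rw [div_lt_one h1]; linarith [hy.2]
    · simp only
      rw [div_mul_cancel₀ _ h1.ne', add_sub_cancel]
  have hSconn : IsPreconnected S := by
    refine (isPreconnected_Ioo.prod isPreconnected_Ioo).image _ ?_
    have c1 : ContinuousOn (fun p : ℝ × ℝ => f1 p.1) (I ×ˢ Ioo (0:ℝ) 1) :=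
      hf1.comp continuousOn_fst (fun p hp => hp.1)
    have c2 : ContinuousOn (fun p : ℝ × ℝ => f2 p.1) (I ×ˢ Ioo (0:ℝ) 1) :=
      hf2.comp continuousOn_fst (fun p hp => hp.1)
    exact ((continuousOn_const.add (continuousOn_fst.smul continuousOn_const)).add
      ((c1.add (continuousOn_snd.mul (c2.sub c1))).smul continuousOn_const))
  have hSΓ : ∀ γ, D.z γ t ∉ S := by
    rintro γ ⟨⟨ρ, τ⟩, ⟨hρ, hτ⟩, hp⟩
    simp only at hp hρ hτ
    have h1 : 0 < f2 ρ - f1 ρ := by linarith [hf12 ρ hρ]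
    have h2 : 0 < τ * (f2 ρ - f1 ρ) := mul_pos hτ.1 h1
    have h3 : τ * (f2 ρ - f1 ρ) < 1 * (f2 ρ - f1 ρ) := by
      have := hτ.2
      gcongr
    exact D.no_third hT hA ht hs hδ hδA hb hd hd8 he hw hew hm hdz (hg ρ hρ).1 (hg ρ hρ).2
      (abs_le.2 ⟨by linarith [hρ.1], hρ.2.le⟩) (hfb ρ hρ).1 (hfb ρ hρ).2 (by linarith) (by linarith) hp.symm
  have hS2 : S ⊆ D.Ω2 t := by
    rcases D.ball_dich ht hSconn hSΓ with h | h
    · exfalso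
      have hcl : D.z a1 t ∈ closure (D.Ω2 t) := by
        apply frontier_subset_closure
        rw [D.hFront2 t ht]; exact ⟨a1, rfl⟩
      have hδ4 : 0 < δ ^ 4 := by positivity
      have hδ2 : 0 < δ ^ 2 := by positivity
      set U : Set E2 := {x | inner ℝ e (x - m) ∈ Ioo (-δ ^ 4) (δ ^ 4) ∧ inner ℝ w (x - m) ∈ Ioo (-δ ^ 2) (δ ^ 2)} with hU
      have hUo : IsOpen U := by
        have c1 : Continuous (fun x : E2 => inner ℝ e (x - m)) := by fun_prop
        have c2 : Continuous (fun x : E2 => inner ℝ w (x - m)) := by fun_prop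
        exact (isOpen_Ioo.preimage c1).inter (isOpen_Ioo.preimage c2)
      have hzU : D.z a1 t ∈ U := by
        have e1 : D.z a1 t - m = -(d / 2) • w := by rw [hm, neg_smul]; abel
        show inner ℝ e (D.z a1 t - m) ∈ Ioo (-δ ^ 4) (δ ^ 4) ∧ inner ℝ w (D.z a1 t - m) ∈ Ioo (-δ ^ 2) (δ ^ 2)
        rw [e1, real_inner_smul_right, real_inner_smul_right, hew, real_inner_self_eq_norm_sq, hw]
        have q8 : δ ^ 8 ≤ δ ^ 2 := pow_le_pow_of_le_one hδ.le hle1 (by norm_num)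
        refine ⟨⟨by linarith, by linarith⟩, ⟨by linarith, by linarith⟩⟩
      obtain ⟨x, hxU, hx2⟩ := mem_closure_iff.1 hcl U hUo hzU
      obtain ⟨hxe, hxw⟩ := hxU
      have hdec := ortho_decomp he hw hew (x - m)
      set ρ : ℝ := inner ℝ e (x - m)
      set y : ℝ := inner ℝ w (x - m)
      have hx : x = m + ρ • e + y • w := by rw [add_assoc, ← hdec]; abel
      have hno1 : x ∉ D.Ω1 t := fun h1 => (Set.disjoint_left.1 (D.hDisj12 t ht)) h1 hx2
      rcases lt_trichotomy y (f1 ρ) with c | c | c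
      · exact hno1 (hx ▸ hdown ρ hxe y ⟨hxw.1, c⟩)
      · apply D.z_not2 ht (a1 + b1 ρ)
        rw [(hg ρ hxe).1, ← c, ← hx]; exact hx2
      · rcases lt_trichotomy y (f2 ρ) with c' | c' | c'
        · exact hno1 (hx ▸ h (hmemS ρ hxe y ⟨c, c'⟩))
        · apply D.z_not2 ht (a2 + b2 ρ)
          rw [(hg ρ hxe).2, ← c', ← hx]; exact hx2
        · exact hno1 (hx ▸ hup ρ hxe y ⟨c', hxw.2⟩)
    · exact h
  exact fun ρ hρ y => ⟨hup ρ hρ y, hdown ρ hρ y, fun hy => hS2 (hmemS ρ hρ y hy)⟩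
end

section
variable {ρ1 ρ2 σ grav T A : ℝ}

lemma TwoFluid.zeta1 (D : TwoFluid ρ1 ρ2 σ grav T A) (hT : 0 < T) (hA : 1 ≤ A) {t : ℝ}
    (ht : t ∈ Icc (0:ℝ) T) (a : ℝ) : ContDiff ℝ 4 (fun h => D.z (a + h) t) ∧
    (∀ i, 1 ≤ i → i ≤ 4 → ∀ h, ‖iteratedDeriv i (fun h => D.z (a + h) t) h‖ ≤ 2 * A) ∧
    deriv (fun h => D.z (a + h) t) 0 = D.dz a t := by
  refine ⟨(D.z_contDiff ht).comp (contDiff_const.add contDiff_id), ?_, ?_⟩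
  · intro i h1 h4 h
    rw [iteratedDeriv_comp_const_add i (fun x => D.z x t) a]
    exact D.z_iter_bound hT hA ht h1 h4 _
  · have h1 : deriv (fun h => (fun x => D.z x t) (a + h)) 0 = deriv (fun x => D.z x t) (a + 0) :=
      deriv_comp_const_add (fun x => D.z x t) a 0
    rw [add_zero] at h1
    exact h1

lemma TwoFluid.zeta2 (D : TwoFluid ρ1 ρ2 σ grav T A) (hT : 0 < T) (hA : 1 ≤ A) {t : ℝ}
    (ht : t ∈ Icc (0:ℝ) T) (a : ℝ) : ContDiff ℝ 4 (fun h => D.z (a + -h) t) ∧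
    (∀ i, 1 ≤ i → i ≤ 4 → ∀ h, ‖iteratedDeriv i (fun h => D.z (a + -h) t) h‖ ≤ 2 * A) ∧
    deriv (fun h => D.z (a + -h) t) 0 = -D.dz a t := by
  obtain ⟨c, bd, dd⟩ := D.zeta1 hT hA ht a
  refine ⟨c.comp contDiff_neg, ?_, ?_⟩
  · intro i h1 h4 h
    have := iteratedDeriv_comp_neg i (fun h => D.z (a + h) t) h
    rw [this, norm_smul]
    simp only [norm_pow, norm_neg, norm_one, one_pow, one_mul]
    exact bd i h1 h4 _
  · have h1 : deriv (fun h => (fun x => D.z (a + x) t) (-h)) 0 = -deriv (fun x => D.z (a + x) t) (-0) :=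
      deriv_comp_neg (fun x => D.z (a + x) t) 0
    rw [neg_zero, dd] at h1
    exact h1

lemma sign_keep {f : ℝ → ℝ} {κ d : ℝ} (hd : 0 < d) (hκ : 0 < κ) (hf : ContinuousOn f (Ioo (-κ) κ))
    (h0 : f 0 = d) (h : ∀ ρ ∈ Ioo (-κ) κ, d ≤ |f ρ|) : ∀ ρ ∈ Ioo (-κ) κ, d ≤ f ρ := by
  intro ρ hρ
  by_contra hc
  push Not at hc
  have h1 : f ρ < 0 := by
    by_contra h2
    push Not at h2
    have := h ρ hρ
    rw [abs_of_nonneg h2] at this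
    linarith
  obtain ⟨x, hx, hx0⟩ := isPreconnected_Ioo.intermediate_value hρ (show (0:ℝ) ∈ Ioo (-κ) κ from ⟨by linarith, hκ⟩) hf
    (show (0:ℝ) ∈ Icc (f ρ) (f 0) from ⟨h1.le, by rw [h0]; exact hd.le⟩)
  have := h x hx
  rw [hx0, abs_zero] at this
  linarith
end

lemma delta_facts {A δ : ℝ} (hA : 1 ≤ A) (hδ : 0 < δ) (h : 10 ^ 6 * A ^ 3 * δ ≤ 1) :
    200 * A ^ 2 * δ ^ 100 ≤ δ ^ 8 ∧ δ ^ 8 < 2 * (1000 * δ) ∧ δ ^ 4 < 1 / (8 * A ^ 3) ∧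
    δ ^ 8 / 2 + 8 * A ^ 3 * δ ^ 8 ≤ δ ^ 7 ∧ 2 * A * δ ^ 4 < δ ^ 2 ∧
    4 * A * δ ^ 4 ≤ 1 / (100 * A ^ 2) ∧ 2 * δ ^ 100 ≤ 1 / (2 * A) ∧ δ < 1 ∧ δ ^ 7 < δ ^ 2 ∧
    δ ^ 100 < 1 ∧ δ ^ 8 ≤ 1 := by
  have hApos : 0 < A := by linarith
  have a2 : A ≤ A ^ 2 := le_self_pow₀ hA (by norm_num)
  have a23 : A ^ 2 ≤ A ^ 3 := pow_le_pow_right₀ hA (by norm_num)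
  have a3 : 1 ≤ A ^ 3 := one_le_pow₀ hA
  have h1 : δ ≤ A ^ 3 * δ := le_mul_of_one_le_left hδ.le a3
  have h2 : A ^ 2 * δ ≤ A ^ 3 * δ := by gcongr
  have h3 : A * δ ≤ A ^ 3 * δ := by gcongr; linarith
  have d1 : δ < 1 := by linarith
  have p4 : δ ^ 4 ≤ δ := pow_le_of_le_one hδ.le d1.le (by norm_num)
  have p8 : δ ^ 8 ≤ δ := pow_le_of_le_one hδ.le d1.le (by norm_num)
  have p100 : δ ^ 100 ≤ δ := pow_le_of_le_one hδ.le d1.le (by norm_num)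
  have p99 : δ ^ 99 ≤ δ ^ 8 := pow_le_pow_of_le_one hδ.le d1.le (by norm_num)
  have p32 : δ ^ 3 ≤ δ ^ 2 := pow_le_pow_of_le_one hδ.le d1.le (by norm_num)
  have p43 : δ ^ 4 ≤ δ ^ 3 := pow_le_pow_of_le_one hδ.le d1.le (by norm_num)
  have hp2 : 0 < δ ^ 2 := by positivity
  have hp7 : 0 < δ ^ 7 := by positivity
  refine ⟨?_, by linarith, ?_, ?_, ?_, ?_, ?_, d1, ?_, by linarith, by linarith⟩
  · calc 200 * A ^ 2 * δ ^ 100 = 200 * (A ^ 2 * δ) * δ ^ 99 := by ring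
      _ ≤ 1 * δ ^ 8 := by gcongr; linarith
      _ = δ ^ 8 := one_mul _
  · rw [lt_div_iff₀ (by positivity)]
    have : A ^ 3 * δ ^ 4 ≤ A ^ 3 * δ := by gcongr
    linarith
  · have e : δ ^ 8 / 2 + 8 * A ^ 3 * δ ^ 8 = (δ / 2 + 8 * (A ^ 3 * δ)) * δ ^ 7 := by ring
    rw [e]
    calc (δ / 2 + 8 * (A ^ 3 * δ)) * δ ^ 7 ≤ 1 * δ ^ 7 := by gcongr; linarith
      _ = δ ^ 7 := one_mul _
  · calc 2 * A * δ ^ 4 ≤ 2 * A * δ ^ 3 := by gcongr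
      _ = (2 * (A * δ)) * δ ^ 2 := by ring
      _ < 1 * δ ^ 2 := by gcongr; linarith
      _ = δ ^ 2 := one_mul _
  · rw [le_div_iff₀ (by positivity)]
    have : A ^ 3 * δ ^ 4 ≤ A ^ 3 * δ := by gcongr
    linarith
  · rw [le_div_iff₀ (by positivity)]
    have : A * δ ^ 100 ≤ A * δ := by gcongr
    linarith
  · exact pow_lt_pow_right_of_lt_one₀ hδ d1 (by norm_num)

theorem near_splash_graph_representation (ρ1 ρ2 σ grav T A : ℝ)
    (hρ1 : 0 < ρ1) (hρ2 : 0 < ρ2) (hσ : 0 ≤ σ) (hgrav : 0 ≤ grav) (hT : 0 < T) (hA : 1 ≤ A) :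
    ∃ ε1 ε4 ε5 C : ℝ, 0 < ε1 ∧ 0 < ε4 ∧ ε4 < 1 ∧ 0 < ε5 ∧ ε5 < 1 ∧ ε4 ≤ ε5 ^ 100 ∧ 1 ≤ C ∧
      ∀ D : TwoFluid ρ1 ρ2 σ grav T A,
        (∀ t ∈ Icc (0:ℝ) T, ∀ α β : ℝ, |α - β| ≤ ε1 →
            ε1 * |α - β| ≤ ‖D.z α t - D.z β t‖) ∧
        (∀ t ∈ Icc (0:ℝ) T, ∀ ε : ℝ,
          ε = ⨅ p : ℝ × ℝ, chordArcT D.z p.1 p.2 t → ε ≤ ε4 →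
          ∀ α1 α2 : ℝ,
            |α1 - α2| ∈ Icc (2 * ε1) (ε1⁻¹ / 2) →
            ‖D.z α1 t - D.z α2 t‖ =
              sInf {r : ℝ | ∃ α β : ℝ, |α - β| ∈ Icc ε1 ε1⁻¹ ∧ r = ‖D.z α t - D.z β t‖} →
            ∃ R : E2 → E2, Isometry R ∧
              R (vec2 0 0) = midpoint ℝ (D.z α1 t) (D.z α2 t) ∧
              R (vec2 0 (-(‖D.z α2 t - D.z α1 t‖ / 2))) = D.z α1 t ∧
              R (vec2 0 (‖D.z α2 t - D.z α1 t‖ / 2)) = D.z α2 t ∧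
              ∃ f1 f2 b1 b2 : ℝ → ℝ,
                (∀ ρ ∈ Ioo (-ε5 ^ 4) (ε5 ^ 4),
                  f1 ρ ∈ Ioo (-ε5 ^ 2) (ε5 ^ 2) ∧ f2 ρ ∈ Ioo (-ε5 ^ 2) (ε5 ^ 2) ∧
                  b1 ρ ∈ Ioo (-ε5 ^ 2) (ε5 ^ 2) ∧ b2 ρ ∈ Ioo (-ε5 ^ 2) (ε5 ^ 2)) ∧
                (∀ ρ ∈ Ioo (-ε5 ^ 4) (ε5 ^ 4),
                  R (vec2 ρ (f1 ρ)) = D.z (α1 + b1 ρ) t ∧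
                  R (vec2 ρ (f2 ρ)) = D.z (α2 + b2 ρ) t) ∧
                f1 0 = -(‖D.z α2 t - D.z α1 t‖ / 2) ∧ f2 0 = ‖D.z α2 t - D.z α1 t‖ / 2 ∧
                b1 0 = 0 ∧ b2 0 = 0 ∧
                derivWithin f1 (Ioo (-ε5 ^ 4) (ε5 ^ 4)) 0 = 0 ∧
                derivWithin f2 (Ioo (-ε5 ^ 4) (ε5 ^ 4)) 0 = 0 ∧
                ContDiffOn ℝ 4 f1 (Ioo (-ε5 ^ 4) (ε5 ^ 4)) ∧
                ContDiffOn ℝ 4 f2 (Ioo (-ε5 ^ 4) (ε5 ^ 4)) ∧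
                ContDiffOn ℝ 4 b1 (Ioo (-ε5 ^ 4) (ε5 ^ 4)) ∧
                ContDiffOn ℝ 4 b2 (Ioo (-ε5 ^ 4) (ε5 ^ 4)) ∧
                (∀ ρ ∈ Ioo (-ε5 ^ 4) (ε5 ^ 4), ∀ i : ℕ, i ≤ 4 →
                  |iteratedDerivWithin i f1 (Ioo (-ε5 ^ 4) (ε5 ^ 4)) ρ| +
                  |iteratedDerivWithin i f2 (Ioo (-ε5 ^ 4) (ε5 ^ 4)) ρ| +
                  |iteratedDerivWithin i b1 (Ioo (-ε5 ^ 4) (ε5 ^ 4)) ρ| +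
                  |iteratedDerivWithin i b2 (Ioo (-ε5 ^ 4) (ε5 ^ 4)) ρ| ≤ C) ∧
                (∀ ρ ∈ Ioo (-ε5 ^ 4) (ε5 ^ 4),
                  C⁻¹ ≤ -(derivWithin b1 (Ioo (-ε5 ^ 4) (ε5 ^ 4)) ρ *
                          derivWithin b2 (Ioo (-ε5 ^ 4) (ε5 ^ 4)) ρ) ∧
                  -(derivWithin b1 (Ioo (-ε5 ^ 4) (ε5 ^ 4)) ρ *
                    derivWithin b2 (Ioo (-ε5 ^ 4) (ε5 ^ 4)) ρ) ≤ C ∧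
                  ‖D.z α2 t - D.z α1 t‖ ≤ f2 ρ - f1 ρ) ∧
                (∀ ρ ∈ Ioo (-ε5 ^ 4) (ε5 ^ 4), ∀ y : ℝ,
                  (y ∈ Ioo (f2 ρ) (ε5 ^ 2) → R (vec2 ρ y) ∈ D.Ω1 t) ∧
                  (y ∈ Ioo (-ε5 ^ 2) (f1 ρ) → R (vec2 ρ y) ∈ D.Ω1 t) ∧
                  (y ∈ Ioo (f1 ρ) (f2 ρ) → R (vec2 ρ y) ∈ D.Ω2 t))) := by
  obtain ⟨E, hE, hgl⟩ := graph_lemma A hA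
  have hApos : 0 < A := by linarith
  have hrpos := rr_pos hA T
  have hrle := rr_le hA hT.le
  obtain ⟨δ, hδr⟩ : ∃ δ, 1000 * δ = rr A T := ⟨rr A T / 1000, by ring⟩
  have hδ : 0 < δ := by linarith
  have hδA : 10 ^ 6 * A ^ 3 * δ ≤ 1 := by
    rw [← hδr, le_div_iff₀ (by positivity)] at hrle
    linarith
  obtain ⟨n1, n2, n3, n4, n5, n6, n7, n8, n9, n10, n11⟩ := delta_facts hA hδ hδA
  have hA2 : 1 ≤ A ^ 2 := one_le_pow₀ hA
  have hε1 : (0:ℝ) < 1 / (100 * A ^ 2) := by positivity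
  have hε12 : 1 / (100 * A ^ 2) ≤ 1 / (2 * A) := by
    have a2 : A ≤ A ^ 2 := le_self_pow₀ hA (by norm_num)
    exact one_div_le_one_div_of_le (by positivity) (by linarith)
  have hε13 : 1 / (100 * A ^ 2) ≤ 1 / 2 := one_div_le_one_div_of_le (by positivity) (by linarith)
  refine ⟨1 / (100 * A ^ 2), δ ^ 100, δ, 4 * E + 4 * A ^ 2, hε1, by positivity, n10, hδ, n8, le_rfl,
    by linarith, fun D => ⟨?_, ?_⟩⟩
  · intro t ht α β hab
    have := D.chord_local hT hA ht hab
    refine le_trans ?_ this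
    gcongr
  intro t ht ε hε hε4 α1 α2 hα hinf
  have hmin : ∀ a b, |a - b| ∈ Icc (1 / (100 * A ^ 2)) (1 / (100 * A ^ 2))⁻¹ →
      ‖D.z α1 t - D.z α2 t‖ ≤ ‖D.z a t - D.z b t‖ := by
    intro a b hab
    rw [hinf]
    refine csInf_le ⟨0, ?_⟩ ⟨a, b, hab, rfl⟩
    rintro r ⟨x, y, -, rfl⟩
    exact norm_nonneg _
  have c1 := D.crit ht hε1 hε13 hα (fun x hx => hmin x α2 hx)
  have c2 := D.crit ht (a := α2) (b := α1) hε1 hε13 (by rw [abs_sub_comm]; exact hα) (fun x hx => by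
    rw [norm_sub_rev]; exact hmin x α1 hx)
  have hds := D.d_small hT hA ht (by positivity) n7 (hε ▸ hε4) hmin
  obtain ⟨s, hs, hinj, hb⟩ := D.main_balls hT hA ht
  rw [← hδr] at hb
  have hne : D.z α2 t ≠ D.z α1 t := by
    intro h
    have := hinj _ _ h
    rw [this, sub_self, abs_zero] at hα
    linarith [hα.1]
  obtain ⟨d, hd⟩ : ∃ d, d = ‖D.z α2 t - D.z α1 t‖ := ⟨_, rfl⟩
  rw [norm_sub_rev, ← hd] at hds
  have hd8 : d ≤ δ ^ 8 := hds.trans n1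
  have hmin' : ∀ a b, |a - b| ∈ Icc (1 / (100 * A ^ 2)) (1 / (100 * A ^ 2))⁻¹ →
      d ≤ ‖D.z a t - D.z b t‖ := by
    intro a b hab
    rw [hd, norm_sub_rev]; exact hmin a b hab
  obtain ⟨hdpos, e, w, he, hw, hew, hzz, hN1, hN2, hdz1, hdz2⟩ :=
    D.strands hA ht hs (show 0 < 1000 * δ by positivity) hb hne hd (by linarith) c1 c2
  rw [← hd]
  obtain ⟨m, hm⟩ : ∃ m, m = midpoint ℝ (D.z α1 t) (D.z α2 t) := ⟨_, rfl⟩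
  have hz2 : D.z α2 t = D.z α1 t + d • w := by rw [← hzz]; abel
  have hm' : m = D.z α1 t + (d / 2) • w := by
    rw [hm, midpoint_eq_smul_add, hz2, invOf_eq_inv]
    module
  have hm1 : D.z α1 t = m - (d / 2) • w := by rw [hm']; abel
  have hm2 : D.z α2 t = m + (d / 2) • w := by rw [hm', hz2]; module
  have hee : inner ℝ e e = (1:ℝ) := by rw [real_inner_self_eq_norm_sq, he]; norm_num
  have hww : inner ℝ w w = (1:ℝ) := by rw [real_inner_self_eq_norm_sq, hw]; norm_num
  have hwe : inner ℝ w e = (0:ℝ) := by rw [real_inner_comm]; exact hew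
  obtain ⟨q1, q2, q3⟩ := D.zeta1 hT hA ht α1
  obtain ⟨q4, q5, q6⟩ := D.zeta2 hT hA ht α2
  have g1 := hgl _ q1 q2 m e w he hw hew
  have g2 := hgl _ q4 q5 m e w he hw hew
  have L1 : A⁻¹ ≤ ‖D.dz α1 t‖ := D.hz_lower t ht α1
  have L2 : A⁻¹ ≤ ‖D.dz α2 t‖ := D.hz_lower t ht α2
  have v1 : D.z α1 t - m = (-(d / 2)) • w := by rw [hm1]; module
  have v2 : D.z α2 t - m = (d / 2) • w := by rw [hm2]; module
  have hκ : 0 < δ ^ 4 := by positivity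
  obtain ⟨b1, f1, k1, b10, f10, f1d, f1c, b1c, E1⟩ := g1
    (by simp only [add_zero]; rw [v1, inner_smul_right, hew, mul_zero])
    (by rw [q3, hdz1, inner_smul_right, hee, mul_one]; exact L1)
    (by rw [q3, hdz1, inner_smul_right, hwe, mul_zero])
    (by simp only [add_zero]; rw [v1, inner_smul_right, hww, mul_one, abs_neg, abs_of_pos (by linarith)]; linarith)
    (δ ^ 4) hκ n3
  obtain ⟨b2, f2, k2, b20, f20, f2d, f2c, b2c, E2'⟩ := g2
    (by simp only [neg_zero, add_zero]; rw [v2, inner_smul_right, hew, mul_zero])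
    (by rw [q6, hdz2, neg_neg, inner_smul_right, hee, mul_one]; exact L2)
    (by rw [q6, hdz2, neg_neg, inner_smul_right, hwe, mul_zero])
    (by simp only [neg_zero, add_zero]; rw [v2, inner_smul_right, hww, mul_one, abs_of_pos (by linarith)]; linarith)
    (δ ^ 4) hκ n3
  simp only [add_zero] at f10
  rw [v1, inner_smul_right, hww, mul_one] at f10
  simp only [neg_zero, add_zero] at f20
  rw [v2, inner_smul_right, hww, mul_one] at f20
  clear g1 g2 q1 q2 q3 q4 q5 q6
  have hbb : ∀ ρ ∈ Ioo (-δ ^ 4) (δ ^ 4), |b1 ρ| ≤ 2 * A * δ ^ 4 ∧ |(fun x => -b2 x) ρ| ≤ 2 * A * δ ^ 4 := by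
    intro ρ hρ
    have hr : |ρ| ≤ δ ^ 4 := abs_le.2 ⟨hρ.1.le, hρ.2.le⟩
    have : 2 * A * |ρ| ≤ 2 * A * δ ^ 4 := by gcongr
    refine ⟨(k1 ρ hρ).1.trans this, ?_⟩
    simp only [abs_neg]
    exact (k2 ρ hρ).1.trans this
  have hfb : ∀ ρ ∈ Ioo (-δ ^ 4) (δ ^ 4), |f1 ρ| ≤ δ ^ 7 ∧ |f2 ρ| ≤ δ ^ 7 := by
    intro ρ hρ
    have hr : |ρ| ≤ δ ^ 4 := abs_le.2 ⟨hρ.1.le, hρ.2.le⟩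
    have hr2 : ρ ^ 2 ≤ δ ^ 8 := by
      rw [← sq_abs]
      calc |ρ| ^ 2 ≤ (δ ^ 4) ^ 2 := by gcongr
        _ = δ ^ 8 := by ring
    have h8 : 8 * A ^ 3 * ρ ^ 2 ≤ 8 * A ^ 3 * δ ^ 8 := by gcongr
    have u1 := abs_le.1 (k1 ρ hρ).2.2.1
    have u2 := abs_le.1 (k2 ρ hρ).2.2.1
    rw [f10] at u1
    rw [f20] at u2
    exact ⟨abs_le.2 ⟨by linarith [u1.1, u1.2], by linarith [u1.1, u1.2]⟩,
      abs_le.2 ⟨by linarith [u2.1, u2.2], by linarith [u2.1, u2.2]⟩⟩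
  have hg : ∀ ρ ∈ Ioo (-δ ^ 4) (δ ^ 4), D.z (α1 + b1 ρ) t = m + ρ • e + f1 ρ • w ∧
      D.z (α2 + (fun x => -b2 x) ρ) t = m + ρ • e + f2 ρ • w :=
    fun ρ hρ => ⟨(k1 ρ hρ).2.1, (k2 ρ hρ).2.1⟩
  have hinv : 1 ≤ (1 / (100 * A ^ 2))⁻¹ := by
    rw [one_div, inv_inv]; linarith
  have hgap : ∀ ρ ∈ Ioo (-δ ^ 4) (δ ^ 4), d ≤ f2 ρ - f1 ρ := by
    refine sign_keep (f := fun ρ => f2 ρ - f1 ρ) hdpos hκ (f2c.continuousOn.sub f1c.continuousOn) ?_ ?_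
    · simp only [f10, f20]; ring
    · intro ρ hρ
      obtain ⟨z1, z2⟩ := hg ρ hρ
      obtain ⟨y1, y2⟩ := hbb ρ hρ
      have hx := hmin' (α2 + (fun x => -b2 x) ρ) (α1 + b1 ρ) (by
        have hα1 := hα.1
        have hα2 := hα.2
        have y3 := abs_le.1 y1
        have y4 := abs_le.1 y2
        have m1 : |(α1 - α2) - ((α1 + b1 ρ) - (α2 + (fun x => -b2 x) ρ))| ≤ 4 * A * δ ^ 4 :=
          abs_le.2 ⟨by linarith [y3.1, y3.2, y4.1, y4.2], by linarith [y3.1, y3.2, y4.1, y4.2]⟩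
        have m2 := abs_le.1 ((abs_abs_sub_abs_le _ _).trans m1)
        rw [abs_sub_comm]
        exact ⟨by linarith [m2.1, m2.2], by linarith [m2.1, m2.2]⟩)
      rw [z1, z2] at hx
      have : m + ρ • e + f2 ρ • w - (m + ρ • e + f1 ρ • w) = (f2 ρ - f1 ρ) • w := by module
      rw [this, norm_smul, hw, mul_one] at hx
      exact hx
  have hreg := D.regions hT hA ht hs hδ hδA hb hdpos hd8 he hw hew hm1 hdz1 hN1 hN2
    f1c.continuousOn f2c.continuousOn (fun ρ hρ => by linarith [hgap ρ hρ]) hfb hbb hg f10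
  refine ⟨Rm m e w, Rm_isometry he hw hew, ?_, ?_, ?_, f1, f2, b1, fun x => -b2 x, ?_, ?_, f10, f20, b10, ?_,
    f1d, f2d, f1c, f2c, b1c, b2c.neg, ?_, ?_, ?_⟩
  · rw [Rm_vec2, ← hm]; module
  · rw [Rm_vec2, hm1]; module
  · rw [Rm_vec2, hm2]; module
  · intro ρ hρ
    obtain ⟨x1, x2⟩ := hfb ρ hρ
    obtain ⟨x3, x4⟩ := hbb ρ hρ
    exact ⟨abs_lt.1 (by linarith), abs_lt.1 (by linarith), abs_lt.1 (by linarith), abs_lt.1 (by linarith)⟩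
  · intro ρ hρ
    rw [Rm_vec2, Rm_vec2]
    exact ⟨(hg ρ hρ).1.symm, (hg ρ hρ).2.symm⟩
  · simp only [b20, neg_zero]
  · intro ρ hρ i hi
    rw [iteratedDerivWithin_fun_neg, abs_neg]
    obtain ⟨x1, x2⟩ := E1 ρ hρ i hi
    obtain ⟨x3, x4⟩ := E2' ρ hρ i hi
    linarith
  · intro ρ hρ
    rw [derivWithin.fun_neg]
    obtain ⟨-, -, -, x1, x2⟩ := k1 ρ hρ
    obtain ⟨-, -, -, x3, x4⟩ := k2 ρ hρ
    have hp : 0 < 1 / (2 * A) := by positivity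
    have lo := mul_le_mul x1 x3 hp.le (hp.le.trans x1)
    have hi := mul_le_mul x2 x4 (hp.le.trans x3) (by positivity)
    rw [mul_neg, neg_neg]
    refine ⟨le_trans ?_ lo, ?_, hgap ρ hρ⟩
    · have : 1 / (2 * A) * (1 / (2 * A)) = (4 * A ^ 2)⁻¹ := by field_simp; ring
      rw [this]
      exact inv_anti₀ (by positivity) (by linarith)
    · linarith
  · intro ρ hρ y
    rw [Rm_vec2]
    exact hreg ρ hρ y
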